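/- Let p be a prime number and let the cyclic group C_p of order p act on ℚ(x₁,…,x_p) by cyclically permuting the indeterminates (the regular action). Then the fixed field ℚ(x₁,…,x_p)^{C_p} is rational (purely transcendental) over ℚ if and only if p belongs to the set {2, 3, 5, 7, 11, 13, 17, 19, 23, 29, 31, 37, 41, 43, 61, 67, 71}. -/

import Mathlib

namespace NoetherCyclic

open Polynomial

/-- The norm of `f(ζ_n)` from the `n`-th cyclotomic field, as a resultant. -/
noncomputable def cycNorm (n : ℕ) (f : ℤ[X]) : ℤ :=
  resultant (cyclotomic n ℤ) f (cyclotomic n ℤ).natDegree f.natDegree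

theorem cycNorm_cast {F : Type*} [Field F] {n : ℕ} {z : F} (hz : IsPrimitiveRoot z n)
    [NeZero (n : F)] (f : ℤ[X]) :
    (cycNorm n f : F) = ∏ ζ ∈ primitiveRoots n F, aeval ζ f := by
  classical
  have hs : (cyclotomic n F).Splits := by
    rw [cyclotomic_eq_prod_X_sub_primitiveRoots hz]
    exact Splits.prod fun i _ => Splits.X_sub_C i
  have h := resultant_eq_prod_eval (cyclotomic n F) (f.map (Int.castRingHom F)) f.natDegree
    natDegree_map_le hs
  rw [(cyclotomic.monic n F).leadingCoeff, one_pow, one_mul,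
    cyclotomic.roots_eq_primitiveRoots_val] at h
  have h2 : (cycNorm n f : F) = resultant (cyclotomic n F) (f.map (Int.castRingHom F))
      (cyclotomic n F).natDegree f.natDegree := by
    rw [cycNorm, ← eq_intCast (Int.castRingHom F), ← resultant_map_map, map_cyclotomic_int,
      natDegree_cyclotomic, natDegree_cyclotomic]
  rw [h2, h, Finset.prod]
  congr 1
  refine Multiset.map_congr rfl fun x _ => ?_
  rw [eval_map, ← algebraMap_int_eq, ← aeval_def]

theorem cycNorm_cast_complex {n : ℕ} (hn : 0 < n) (f : ℤ[X]) :
    (cycNorm n f : ℂ) = ∏ ζ ∈ primitiveRoots n ℂ, aeval ζ f := by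
  have : NeZero (n : ℂ) := ⟨by exact_mod_cast hn.ne'⟩
  exact cycNorm_cast (Complex.isPrimitiveRoot_exp n hn.ne') f

theorem cycNorm_mul {n : ℕ} (hn : 0 < n) (f g : ℤ[X]) :
    cycNorm n (f * g) = cycNorm n f * cycNorm n g := by
  have : ((cycNorm n (f * g) : ℤ) : ℂ) = (cycNorm n f * cycNorm n g : ℤ) := by
    push_cast
    simp only [cycNorm_cast_complex hn, map_mul, Finset.prod_mul_distrib]
  exact_mod_cast this

theorem aeval_cyclotomic_of_mem {n : ℕ} {F : Type*} [CommRing F] [IsDomain F] {ζ : F}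
    (hn : 0 < n) (h : ζ ∈ primitiveRoots n F) : aeval ζ (cyclotomic n ℤ) = 0 := by
  have h1 := (isPrimitiveRoot_of_mem_primitiveRoots h).isRoot_cyclotomic hn
  rw [IsRoot.def, ← map_cyclotomic_int, eval_map] at h1
  rwa [aeval_def, algebraMap_int_eq]

theorem cycNorm_congr {n : ℕ} (hn : 0 < n) {f g : ℤ[X]} (h : cyclotomic n ℤ ∣ f - g) :
    cycNorm n f = cycNorm n g := by
  have : ((cycNorm n f : ℤ) : ℂ) = (cycNorm n g : ℤ) := by
    rw [cycNorm_cast_complex hn, cycNorm_cast_complex hn]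
    refine Finset.prod_congr rfl fun ζ hζ => ?_
    obtain ⟨c, hc⟩ := h
    rw [← sub_eq_zero, ← map_sub, hc, map_mul, aeval_cyclotomic_of_mem hn hζ, zero_mul]
  exact_mod_cast this

theorem cycNorm_C {n : ℕ} (hn : 0 < n) (a : ℤ) : cycNorm n (C a) = a ^ n.totient := by
  have : ((cycNorm n (C a) : ℤ) : ℂ) = (a ^ n.totient : ℤ) := by
    rw [cycNorm_cast_complex hn]
    simp [Complex.card_primitiveRoots]
  exact_mod_cast this

theorem cycNorm_C_sub_X {n : ℕ} (hn : 0 < n) (a : ℤ) :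
    cycNorm n (C a - X) = (cyclotomic n ℤ).eval a := by
  have h2 : aeval (a : ℂ) (cyclotomic n ℤ) = ((cyclotomic n ℤ).eval a : ℤ) :=
    aeval_algebraMap_apply_eq_algebraMap_eval a _
  have : ((cycNorm n (C a - X) : ℤ) : ℂ) = ((cyclotomic n ℤ).eval a : ℤ) := by
    rw [cycNorm_cast_complex hn, ← h2, aeval_def, ← eval_map, algebraMap_int_eq,
      map_cyclotomic_int,
      cyclotomic_eq_prod_X_sub_primitiveRoots (Complex.isPrimitiveRoot_exp n hn.ne'), eval_prod]
    simp
  exact_mod_cast this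

theorem cyclotomic_dvd_of_aeval_eq_zero {n : ℕ} (hn : 0 < n) {ζ : ℂ} (hζ : IsPrimitiveRoot ζ n)
    {f : ℤ[X]} (h : aeval ζ f = 0) : cyclotomic n ℤ ∣ f := by
  rw [cyclotomic_eq_minpoly hζ hn]
  exact minpoly.isIntegrallyClosed_dvd (hζ.isIntegral hn) h

theorem cycNorm_ne_zero {n : ℕ} (hn : 0 < n) {f : ℤ[X]} (h : ¬ cyclotomic n ℤ ∣ f) :
    cycNorm n f ≠ 0 := by
  have : (cycNorm n f : ℂ) ≠ 0 := by
    rw [cycNorm_cast_complex hn, Finset.prod_ne_zero_iff]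
    intro ζ hζ h0
    exact h (cyclotomic_dvd_of_aeval_eq_zero hn (isPrimitiveRoot_of_mem_primitiveRoots hζ) h0)
  exact_mod_cast this

/-- `α` generates, modulo `Φ_{p-1}`, the prime ideal `(p, X - g)`. -/
structure Gen (p : ℕ) (g : ZMod p) (α : ℤ[X]) : Prop where
  mem_iff : ∀ f : ℤ[X], aeval g f = 0 ↔ f ∈ Ideal.span {α, cyclotomic (p - 1) ℤ}

section

variable {p : ℕ} [hp : Fact p.Prime] {g : ZMod p} {α : ℤ[X]}

theorem Gen.aeval_eq_zero (h : Gen p g α) : aeval g α = 0 :=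
  (h.mem_iff α).2 (Ideal.subset_span (by simp))

theorem Gen.exists_eq (h : Gen p g α) {f : ℤ[X]} (hf : aeval g f = 0) :
    ∃ c d, c * α + d * cyclotomic (p - 1) ℤ = f :=
  Ideal.mem_span_pair.1 ((h.mem_iff f).1 hf)

theorem p_sub_one_pos : 0 < p - 1 := Nat.sub_pos_of_lt hp.out.one_lt

theorem natCast_p_sub_one_ne_zero : ((p - 1 : ℕ) : ZMod p) ≠ 0 := by
  rw [Nat.cast_sub hp.out.one_le]; simp

theorem Gen.cycNorm_dvd (h : Gen p g α) {f : ℤ[X]} (hf : aeval g f = 0) :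
    cycNorm (p - 1) α ∣ cycNorm (p - 1) f := by
  obtain ⟨c, d, hcd⟩ := h.exists_eq hf
  have hn : 0 < p - 1 := p_sub_one_pos
  rw [cycNorm_congr hn (f := f) (g := c * α) ⟨d, by rw [← hcd]; ring⟩, cycNorm_mul hn]
  exact dvd_mul_left _ _

theorem Gen.p_dvd_cycNorm (h : Gen p g α) (hg : IsPrimitiveRoot g (p - 1)) :
    (p : ℤ) ∣ cycNorm (p - 1) α := by
  have : NeZero ((p - 1 : ℕ) : ZMod p) := ⟨natCast_p_sub_one_ne_zero⟩
  rw [← ZMod.intCast_zmod_eq_zero_iff_dvd _ p]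
  rw [cycNorm_cast hg]
  exact Finset.prod_eq_zero ((mem_primitiveRoots p_sub_one_pos).2 hg) h.aeval_eq_zero

theorem natAbs_cycNorm (h : Gen p g α) (hg : IsPrimitiveRoot g (p - 1)) :
    (cycNorm (p - 1) α).natAbs = p := by
  have hn : 0 < p - 1 := p_sub_one_pos
  have : NeZero ((p - 1 : ℕ) : ZMod p) := ⟨natCast_p_sub_one_ne_zero⟩
  set a : ℤ := (g.val : ℤ) with ha
  have hag : ((a : ℤ) : ZMod p) = g := by simp [ha]
  set Φ := cyclotomic (p - 1) ℤ with hΦ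
  have h1 : cycNorm (p - 1) α ∣ (p : ℤ) ^ (p - 1).totient := by
    rw [← cycNorm_C hn]
    exact h.cycNorm_dvd (by simp)
  have hl : ∀ b : ℤ, ((b : ℤ) : ZMod p) = g → cycNorm (p - 1) α ∣ Φ.eval b := by
    intro b hb
    rw [hΦ, ← cycNorm_C_sub_X hn]
    exact h.cycNorm_dvd (by simp [hb])
  have hd : ¬ (p : ℤ) ∣ Φ.derivative.eval a := by
    rw [← ZMod.intCast_zmod_eq_zero_iff_dvd]
    have e1 : ((Φ.derivative.eval a : ℤ) : ZMod p)
        = (cyclotomic (p - 1) (ZMod p)).derivative.eval g := by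
      rw [← map_cyclotomic_int, derivative_map, ← hag, eval_intCast_map]; simp [hΦ]
    rw [e1]
    have sep : (cyclotomic (p - 1) (ZMod p)).Separable := separable_cyclotomic _ _
    exact sep.eval₂_derivative_ne_zero (RingHom.id _) (by
      have := hg.isRoot_cyclotomic hn
      simpa [IsRoot.def] using this)
  have hsq : ∃ b : ℤ, ((b : ℤ) : ZMod p) = g ∧ ¬ (p : ℤ) ^ 2 ∣ Φ.eval b := by
    by_contra! hcon
    have c1 := hcon a hag
    have c2 := hcon (a + p) (by simp [hag])
    obtain ⟨k, hk⟩ := Φ.binomExpansion a (p : ℤ)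
    rw [hk] at c2
    have c3 : (p : ℤ) ^ 2 ∣ Φ.derivative.eval a * p := by
      have := dvd_sub c2 (dvd_add c1 (dvd_mul_left ((p : ℤ) ^ 2) k))
      rwa [show ∀ x y z : ℤ, x + y + z - (x + z) = y by intros; ring] at this
    rw [sq] at c3
    exact hd (Int.dvd_of_mul_dvd_mul_right (by exact_mod_cast hp.out.ne_zero) c3)
  obtain ⟨b, hb, hb2⟩ := hsq
  obtain ⟨k, -, hk⟩ := (Nat.dvd_prime_pow hp.out).1 (by
    have := Int.natAbs_dvd_natAbs.2 h1
    rwa [Int.natAbs_pow, Int.natAbs_natCast] at this :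
      (cycNorm (p - 1) α).natAbs ∣ p ^ (p - 1).totient)
  have hk1 : 1 ≤ k := by
    rcases Nat.eq_zero_or_pos k with h0 | h0
    · rw [h0, pow_zero] at hk
      have := Int.natAbs_dvd_natAbs.2 (h.p_dvd_cycNorm hg)
      rw [hk, Int.natAbs_natCast, Nat.dvd_one] at this
      exact absurd this hp.out.one_lt.ne'
    · exact h0
  have hk2 : k < 2 := by
    by_contra! h2
    refine hb2 (dvd_trans ?_ (hl b hb))
    rw [← Int.natAbs_dvd_natAbs, hk, Int.natAbs_pow, Int.natAbs_natCast]
    exact pow_dvd_pow _ h2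
  have : k = 1 := by omega
  rw [hk, this, pow_one]

theorem Gen.aeval_ne_zero (h : Gen p g α) {t : ZMod p} (ht : IsPrimitiveRoot t (p - 1))
    (htg : t ≠ g) : aeval t α ≠ 0 := by
  intro h0
  obtain ⟨a, rfl⟩ := ZMod.intCast_surjective g
  obtain ⟨c, d, hcd⟩ := h.exists_eq (f := X - C a) (by simp)
  have := congrArg (aeval t) hcd
  rw [map_add, map_mul, map_mul, h0, aeval_cyclotomic_of_mem p_sub_one_pos
    ((mem_primitiveRoots p_sub_one_pos).2 ht)] at this
  simp only [mul_zero, add_zero, map_sub, aeval_X, eq_intCast, map_intCast]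
    at this
  exact htg (sub_eq_zero.1 this.symm)

end

theorem pow_eq_of_modEq {M : Type*} [Monoid M] {z : M} {n a b : ℕ} (hz : z ^ n = 1)
    (h : a ≡ b [MOD n]) : z ^ a = z ^ b := by
  rw [← Nat.mod_add_div a n, ← Nat.mod_add_div b n, h]
  simp only [pow_add, pow_mul, hz, one_pow, mul_one]

theorem cycNorm_expand {n m : ℕ} (hn : 0 < n) (hm : m.Coprime n) (f : ℤ[X]) :
    cycNorm n (expand ℤ m f) = cycNorm n f := by
  have : ((cycNorm n (expand ℤ m f) : ℤ) : ℂ) = (cycNorm n f : ℤ) := by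
    rw [cycNorm_cast_complex hn, cycNorm_cast_complex hn]
    simp only [expand_aeval]
    have hinj : Set.InjOn (fun z : ℂ => z ^ m) (primitiveRoots n ℂ) := by
      intro x hx y hy hxy
      have hx' := (isPrimitiveRoot_of_mem_primitiveRoots hx).pow_eq_one
      have hy' := (isPrimitiveRoot_of_mem_primitiveRoots hy).pow_eq_one
      obtain ⟨k, -, hk⟩ := Nat.exists_mul_mod_eq_of_coprime 1 hm hn.ne'
      have key : ∀ z : ℂ, z ^ n = 1 → (z ^ m) ^ k = z := fun z hz => by
        rw [← pow_mul, pow_eq_of_modEq hz hk, pow_one]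
      rw [← key x hx', ← key y hy']
      exact congrArg (· ^ k) hxy
    refine Finset.prod_nbij (fun z => z ^ m) ?_ hinj ?_ (fun _ _ => rfl)
    · intro z hz
      exact (mem_primitiveRoots hn).2
        ((isPrimitiveRoot_of_mem_primitiveRoots hz).pow_of_coprime m hm)
    · exact Finset.surjOn_of_injOn_of_card_le _ (fun z hz => (mem_primitiveRoots hn).2
        ((isPrimitiveRoot_of_mem_primitiveRoots hz).pow_of_coprime m hm)) hinj le_rfl
  exact_mod_cast this

theorem cycNorm_pow {n : ℕ} (hn : 0 < n) (f : ℤ[X]) (k : ℕ) :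
    cycNorm n (f ^ k) = cycNorm n f ^ k := by
  induction k with
  | zero => simpa using cycNorm_C hn 1
  | succ k ih => rw [pow_succ, cycNorm_mul hn, ih, pow_succ]

theorem C_dvd_of_map_eq_zero {q : ℕ} {f : ℤ[X]}
    (h : f.map (Int.castRingHom (ZMod q)) = 0) : C (q : ℤ) ∣ f := by
  rw [C_dvd_iff_dvd_coeff]
  intro i
  rw [← ZMod.intCast_zmod_eq_zero_iff_dvd]
  simpa using congrArg (fun r => coeff r i) h

theorem C_dvd_pow_sub_expand {q : ℕ} (hq : q.Prime) (f : ℤ[X]) :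
    C (q : ℤ) ∣ f ^ q - expand ℤ q f := by
  have := Fact.mk hq
  refine C_dvd_of_map_eq_zero ?_
  rw [Polynomial.map_sub, Polynomial.map_pow, map_expand, ZMod.expand_card, sub_self]

theorem aeval_conj (z : ℂ) (f : ℤ[X]) :
    aeval ((starRingEnd ℂ) z) f = (starRingEnd ℂ) (aeval z f) := by
  rw [aeval_def, aeval_def, hom_eval₂]
  congr 1
  exact RingHom.ext_int _ _

theorem norm_aeval_pow_mul_sub_one {n : ℕ} (hn : 0 < n) {z : ℂ} (hz : z ^ n = 1) (k : ℕ)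
    (f : ℤ[X]) : ‖aeval (z ^ (k * (n - 1))) f‖ = ‖aeval (z ^ k) f‖ := by
  have h1 : ‖z ^ k‖ = 1 := by rw [norm_pow, Complex.norm_eq_one_of_pow_eq_one hz hn.ne', one_pow]
  have h2 : z ^ (k * (n - 1)) = (starRingEnd ℂ) (z ^ k) := by
    have h0 : z ^ k ≠ 0 := by intro h; simp [h] at h1
    apply mul_right_cancel₀ h0
    rw [← Complex.normSq_eq_conj_mul_self, Complex.normSq_eq_norm_sq, h1, ← pow_add]
    rw [show k * (n - 1) + k = n * k by
      rw [Nat.mul_sub, mul_one, Nat.sub_add_cancel (Nat.le_mul_of_pos_right k hn), mul_comm],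
      pow_mul, hz]
    simp
  rw [h2, aeval_conj, Complex.norm_conj]

theorem pow_totient_le {n q : ℕ} (hn : 0 < n) {u v : ℤ[X]}
    (hq : u - v ∈ Ideal.span {C (q : ℤ), cyclotomic n ℤ})
    (hnorm : ∀ z : ℂ, IsPrimitiveRoot z n → ‖aeval z u‖ = ‖aeval z v‖)
    (hne : ¬ cyclotomic n ℤ ∣ u - v) :
    q ^ n.totient ≤ 2 ^ n.totient * (cycNorm n u).natAbs := by
  obtain ⟨d, e, hde⟩ := Ideal.mem_span_pair.1 hq
  have hd : ¬ cyclotomic n ℤ ∣ d := fun h => hne (by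
    rw [← hde]
    exact dvd_add (h.mul_right _) (dvd_mul_left _ _))
  have h1 : cycNorm n (u - v) = q ^ n.totient * cycNorm n d := by
    rw [← cycNorm_C hn, ← cycNorm_mul hn]
    exact cycNorm_congr hn ⟨e, by rw [← hde]; ring⟩
  have h2 : (q : ℝ) ^ n.totient ≤ ‖(cycNorm n (u - v) : ℂ)‖ := by
    rw [h1]
    push_cast
    rw [norm_mul, norm_pow]
    simp only [Complex.norm_natCast, Complex.norm_intCast]
    refine le_mul_of_one_le_right (by positivity) ?_
    exact_mod_cast Int.one_le_abs (cycNorm_ne_zero hn hd)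
  have h3 : ‖(cycNorm n (u - v) : ℂ)‖ ≤ 2 ^ n.totient * ‖(cycNorm n u : ℂ)‖ := by
    rw [cycNorm_cast_complex hn, cycNorm_cast_complex hn, norm_prod, norm_prod,
      ← Complex.card_primitiveRoots, ← Finset.prod_const, ← Finset.prod_mul_distrib]
    refine Finset.prod_le_prod (fun _ _ => norm_nonneg _) fun z hz => ?_
    rw [map_sub]
    refine (norm_sub_le _ _).trans ?_
    rw [← hnorm z (isPrimitiveRoot_of_mem_primitiveRoots hz), two_mul]
  have h4 : ‖(cycNorm n u : ℂ)‖ = ((cycNorm n u).natAbs : ℝ) := by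
    rw [Complex.norm_intCast, Nat.cast_natAbs, Int.cast_abs]
  rw [h4] at h3
  exact_mod_cast h2.trans h3

section

variable {p : ℕ} [hp : Fact p.Prime] {g : ZMod p} {α : ℤ[X]}

theorem cyclotomic_not_dvd (hg : IsPrimitiveRoot g (p - 1)) {f : ℤ[X]} (hf : aeval g f ≠ 0) :
    ¬ cyclotomic (p - 1) ℤ ∣ f := by
  rintro ⟨c, rfl⟩
  rw [map_mul, aeval_cyclotomic_of_mem p_sub_one_pos
    ((mem_primitiveRoots p_sub_one_pos).2 hg), zero_mul] at hf
  exact hf rfl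

theorem ne_of_pow_ne {m : ℕ} (hg : IsPrimitiveRoot g (p - 1)) (hm : ¬ m ≡ 1 [MOD p - 1]) :
    g ^ m ≠ g := by
  intro h
  apply hm
  have hn : 0 < p - 1 := p_sub_one_pos
  obtain ⟨u, rfl⟩ := hg.isUnit hn.ne'
  rw [hg.eq_orderOf, orderOf_units]
  refine (pow_eq_pow_iff_modEq (x := u)).1 (Units.ext ?_)
  rw [Units.val_pow_eq_pow_val, h, pow_one]

theorem Gen.aeval_pow_ne_zero (h : Gen p g α) (hg : IsPrimitiveRoot g (p - 1)) {m : ℕ}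
    (hm : m.Coprime (p - 1)) (hm1 : ¬ m ≡ 1 [MOD p - 1]) : aeval (g ^ m) α ≠ 0 :=
  h.aeval_ne_zero (hg.pow_of_coprime m hm) (ne_of_pow_ne hg hm1)

theorem sub_one_coprime {n : ℕ} (hn : 0 < n) : (n - 1).Coprime n := by
  exact (Nat.coprime_self_sub_left hn).2 (Nat.coprime_one_left n)

theorem not_sub_one_modEq_one {n : ℕ} (hn : 2 < n) : ¬ n - 1 ≡ 1 [MOD n] := by
  intro h
  rw [Nat.ModEq, Nat.mod_eq_of_lt (by omega), Nat.mod_eq_of_lt (by omega)] at h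
  omega

/-- The bound coming from an unramified prime. -/
theorem Gen.bound_of_not_dvd (h : Gen p g α) (hg : IsPrimitiveRoot g (p - 1)) {q : ℕ}
    (hq : q.Prime) (hqp : q < p - 1) (hqn : ¬ q ∣ p - 1) :
    q ^ (p - 1).totient ≤ 2 ^ (p - 1).totient * p ^ (q + 1) := by
  have hn : 0 < p - 1 := p_sub_one_pos
  have hq2 := hq.two_le
  have hqc : q.Coprime (p - 1) := hq.coprime_iff_not_dvd.2 hqn
  set n := p - 1 with hnp
  set u := α ^ q * expand ℤ (q * (n - 1)) α
  set v := expand ℤ (1 * (n - 1)) α ^ q * expand ℤ q α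
  have key := pow_totient_le hn (u := u) (v := v) (q := q) ?_ ?_ ?_
  · have : cycNorm n u = cycNorm n α ^ (q + 1) := by
      rw [cycNorm_mul hn, cycNorm_pow hn, cycNorm_expand hn, pow_succ]
      exact Nat.Coprime.mul_left hqc (sub_one_coprime hn)
    rwa [this, Int.natAbs_pow, natAbs_cycNorm h hg] at key
  · refine Ideal.span_mono (s := {C (q : ℤ)}) (by simp) (Ideal.mem_span_singleton.2 ?_)
    have h1 := C_dvd_pow_sub_expand hq α
    have h2 := C_dvd_pow_sub_expand hq (expand ℤ (1 * (n - 1)) α)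
    rw [expand_expand] at h2
    have : u - v = (α ^ q - expand ℤ q α) * expand ℤ (q * (n - 1)) α
      - (expand ℤ (1 * (n - 1)) α ^ q - expand ℤ (q * (1 * (n - 1))) α) * expand ℤ q α := by
      simp only [u, v, one_mul]; ring
    rw [this]
    exact dvd_sub (h1.mul_right _) (h2.mul_right _)
  · intro z hz
    simp only [u, v, map_mul, map_pow, expand_aeval, norm_mul, norm_pow]
    rw [norm_aeval_pow_mul_sub_one hn hz.pow_eq_one, norm_aeval_pow_mul_sub_one hn hz.pow_eq_one,
      pow_one]
  · refine cyclotomic_not_dvd hg ?_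
    simp only [u, v, map_sub, map_mul, map_pow, expand_aeval, h.aeval_eq_zero]
    rw [zero_pow hq.ne_zero, zero_mul, zero_sub, neg_ne_zero]
    refine mul_ne_zero (pow_ne_zero _ (h.aeval_pow_ne_zero hg ?_ ?_))
      (h.aeval_pow_ne_zero hg hqc ?_)
    · rw [one_mul]; exact sub_one_coprime hn
    · rw [one_mul]; exact not_sub_one_modEq_one (by omega)
    · intro hh
      rw [Nat.ModEq, Nat.mod_eq_of_lt hqp, Nat.mod_eq_of_lt (by omega)] at hh
      omega

/-- The bound coming from a ramified prime. -/
theorem Gen.bound_of_modEq (h : Gen p g α) (hg : IsPrimitiveRoot g (p - 1)) {q a : ℕ}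
    (hq : q.Prime) (h2 : 2 < p - 1) (ha : a.Coprime (p - 1)) (ha1 : ¬ a ≡ 1 [MOD p - 1])
    (haq : q * a ≡ q [MOD p - 1]) :
    q ^ (p - 1).totient ≤ 2 ^ (p - 1).totient * p ^ (2 * q) := by
  have hn : 0 < p - 1 := p_sub_one_pos
  have hq2 := hq.two_le
  set n := p - 1 with hnp
  set u := α ^ q * expand ℤ (a * (n - 1)) α ^ q
  set v := expand ℤ (1 * (n - 1)) α ^ q * expand ℤ a α ^ q
  have key := pow_totient_le hn (u := u) (v := v) (q := q) ?_ ?_ ?_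
  · have : cycNorm n u = cycNorm n α ^ (2 * q) := by
      rw [cycNorm_mul hn, cycNorm_pow hn, cycNorm_pow hn, cycNorm_expand hn, ← pow_add, two_mul]
      exact Nat.Coprime.mul_left ha (sub_one_coprime hn)
    rwa [this, Int.natAbs_pow, natAbs_cycNorm h hg] at key
  · have hC : ∀ f : ℤ[X], C (q : ℤ) ∣ f → f ∈ Ideal.span {C (q : ℤ), cyclotomic n ℤ} :=
      fun f hf => Ideal.span_mono (s := {C (q : ℤ)}) (by simp) (Ideal.mem_span_singleton.2 hf)
    have hΦ : ∀ f : ℤ[X], cyclotomic n ℤ ∣ f → f ∈ Ideal.span {C (q : ℤ), cyclotomic n ℤ} :=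
      fun f hf => Ideal.span_mono (s := {cyclotomic n ℤ}) (by simp)
        (Ideal.mem_span_singleton.2 hf)
    have h1 := hC _ (C_dvd_pow_sub_expand hq α)
    have h2 := hC _ (C_dvd_pow_sub_expand hq (expand ℤ (1 * (n - 1)) α))
    have h3 := hC _ (C_dvd_pow_sub_expand hq (expand ℤ a α))
    have h4 := hC _ (C_dvd_pow_sub_expand hq (expand ℤ (a * (n - 1)) α))
    rw [expand_expand] at h2 h3 h4
    have hz := Complex.isPrimitiveRoot_exp n hn.ne'
    set z := Complex.exp (2 * Real.pi * Complex.I / n)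
    have hpow : ∀ k : ℕ, z ^ (q * a * k) = z ^ (q * k) := fun k => by
      rw [pow_mul z (q * a) k, pow_mul z q k, pow_eq_of_modEq hz.pow_eq_one haq]
    have h5 := hΦ (expand ℤ (q * a) α - expand ℤ q α) (cyclotomic_dvd_of_aeval_eq_zero hn hz (by
      have := hpow 1
      rw [mul_one, mul_one] at this
      rw [map_sub, expand_aeval, expand_aeval, this, sub_self]))
    have h6 := hΦ (expand ℤ (q * (a * (n - 1))) α - expand ℤ (q * (1 * (n - 1))) α)
      (cyclotomic_dvd_of_aeval_eq_zero hn hz (by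
      have := hpow (n - 1)
      rw [map_sub, expand_aeval, expand_aeval, ← mul_assoc, this, one_mul, sub_self]))
    rw [← Ideal.Quotient.eq_zero_iff_mem] at h1 h2 h3 h4 h5 h6 ⊢
    rw [map_sub, sub_eq_zero] at h1 h2 h3 h4 h5 h6 ⊢
    simp only [u, v, map_mul]
    rw [h1, h2, h3, h4, h5, h6, mul_comm]
  · intro z hz
    simp only [u, v, map_mul, map_pow, expand_aeval, norm_mul, norm_pow]
    rw [norm_aeval_pow_mul_sub_one hn hz.pow_eq_one, norm_aeval_pow_mul_sub_one hn hz.pow_eq_one,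
      pow_one]
  · refine cyclotomic_not_dvd hg ?_
    simp only [u, v, map_sub, map_mul, map_pow, expand_aeval, h.aeval_eq_zero]
    rw [zero_pow hq.ne_zero, zero_mul, zero_sub, neg_ne_zero]
    refine mul_ne_zero (pow_ne_zero _ (h.aeval_pow_ne_zero hg ?_ ?_))
      (pow_ne_zero _ (h.aeval_pow_ne_zero hg ha ha1))
    · rw [one_mul]; exact sub_one_coprime hn
    · rw [one_mul]; exact not_sub_one_modEq_one (by omega)

end

/-- The factor by which `n ^ 3` may exceed `φ(n) ^ 4`. -/
def totientWeight (n : ℕ) : ℚ := (if 2 ∣ n then 8 else 1) * (if 3 ∣ n then 27 / 16 else 1)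

theorem ite_dvd_mul_of_coprime {q a b : ℕ} (hq : q.Prime) (hab : a.Coprime b) (c : ℚ) :
    (if q ∣ a * b then c else 1) = (if q ∣ a then c else 1) * (if q ∣ b then c else 1) := by
  by_cases ha : q ∣ a
  · have hb : ¬ q ∣ b := fun hb => hq.one_lt.ne' (Nat.dvd_one.1 (hab ▸ Nat.dvd_gcd ha hb))
    rw [if_pos (ha.mul_right b), if_pos ha, if_neg hb, mul_one]
  · by_cases hb : q ∣ b
    · rw [if_pos (hb.mul_left a), if_pos hb, if_neg ha, one_mul]
    · rw [if_neg (fun h => (hq.dvd_mul.1 h).elim ha hb), if_neg ha, if_neg hb, one_mul]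

theorem totientWeight_mul {a b : ℕ} (hab : a.Coprime b) :
    totientWeight (a * b) = totientWeight a * totientWeight b := by
  rw [totientWeight, ite_dvd_mul_of_coprime Nat.prime_two hab,
    ite_dvd_mul_of_coprime Nat.prime_three hab, totientWeight, totientWeight]
  ring

theorem cube_le_totient (n : ℕ) : (n : ℚ) ^ 3 ≤ totientWeight n * (n.totient : ℚ) ^ 4 := by
  induction n using Nat.recOnPosPrimePosCoprime with
  | zero => simp
  | one => norm_num [totientWeight]
  | prime_pow p k hp hk =>
    obtain ⟨k, rfl⟩ := Nat.exists_eq_add_of_le' hk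
    rw [Nat.totient_prime_pow_succ hp]
    have hp2 := hp.two_le
    push_cast [Nat.cast_sub hp.one_le]
    have key : (p : ℚ) ^ 3 ≤ totientWeight (p ^ (k + 1)) * ((p : ℚ) - 1) ^ 4 := by
      have e2 : 2 ∣ p ^ (k + 1) ↔ 2 = p :=
        ⟨fun h => (Nat.prime_dvd_prime_iff_eq Nat.prime_two hp).1 (Nat.prime_two.dvd_of_dvd_pow h),
          fun h => h ▸ dvd_pow_self _ k.succ_ne_zero⟩
      have e3 : 3 ∣ p ^ (k + 1) ↔ 3 = p :=
        ⟨fun h => (Nat.prime_dvd_prime_iff_eq Nat.prime_three hp).1 (Nat.prime_three.dvd_of_dvd_pow h),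
          fun h => h ▸ dvd_pow_self _ k.succ_ne_zero⟩
      unfold totientWeight
      simp only [e2, e3]
      by_cases h2 : 2 = p
      · subst h2; norm_num
      by_cases h3 : 3 = p
      · subst h3; norm_num
      have h4 : (4 : ℚ) ≤ p := by
        have : 4 ≤ p := by omega
        exact_mod_cast this
      simp only [h2, h3, if_false, one_mul]
      obtain ⟨x, hx⟩ : ∃ x : ℚ, (p : ℚ) = x + 4 := ⟨p - 4, by ring⟩
      have hx0 : 0 ≤ x := by linarith
      rw [hx]
      have : (x + 4 - 1) ^ 4 - (x + 4) ^ 3 = x ^ 4 + 11 * x ^ 3 + 42 * x ^ 2 + 60 * x + 17 := by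
        ring
      have : 0 ≤ x ^ 4 + 11 * x ^ 3 + 42 * x ^ 2 + 60 * x + 17 := by positivity
      linarith
    have h1 : (1 : ℚ) ≤ (p : ℚ) ^ k := one_le_pow₀ (by exact_mod_cast hp.one_le)
    calc ((p : ℚ) ^ (k + 1)) ^ 3 = ((p : ℚ) ^ k) ^ 3 * (p : ℚ) ^ 3 := by ring
      _ ≤ ((p : ℚ) ^ k) ^ 4 * (totientWeight (p ^ (k + 1)) * ((p : ℚ) - 1) ^ 4) := by
        gcongr
        norm_num
      _ = _ := by ring
  | coprime a b ha hb hab iha ihb =>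
    rw [totientWeight_mul hab, Nat.totient_mul hab]
    push_cast
    calc ((a : ℚ) * b) ^ 3 = (a : ℚ) ^ 3 * (b : ℚ) ^ 3 := by ring
      _ ≤ _ := mul_le_mul iha ihb (by positivity) ((by positivity : (0:ℚ) ≤ (a:ℚ) ^ 3).trans iha)
      _ = _ := by ring

theorem two_mul_cube_le_totient (n : ℕ) : 2 * n ^ 3 ≤ 27 * n.totient ^ 4 := by
  have h := cube_le_totient n
  have hw : totientWeight n ≤ 27 / 2 := by
    unfold totientWeight
    split_ifs <;> norm_num
  have h2 : (n : ℚ) ^ 3 ≤ 27 / 2 * (n.totient : ℚ) ^ 4 := h.trans (by gcongr)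
  have h3 : (2 : ℚ) * (n : ℚ) ^ 3 ≤ 27 * (n.totient : ℚ) ^ 4 := by linarith
  exact_mod_cast h3

theorem lt_pow_totient {n : ℕ} (hn : 1000 ≤ n) :
    2 ^ n.totient * (n + 1) ^ 10 < 5 ^ n.totient := by
  have h := two_mul_cube_le_totient n
  set f := n.totient
  have h1 : (n + 1) ^ 3 ≤ 14 * f ^ 4 := by
    obtain ⟨m, rfl⟩ := Nat.exists_eq_add_of_le hn
    have e : 27 * (1000 + m + 1) ^ 3 ≤ 14 * (2 * (1000 + m) ^ 3) := by
      have : 14 * (2 * (1000 + m) ^ 3) = 27 * (1000 + m + 1) ^ 3 +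
        (m ^ 3 + 2919 * m ^ 2 + 2837919 * m + 918918973) := by ring
      omega
    omega
  have hf : 92 ≤ f := by
    by_contra! hlt
    have h2 : f ^ 4 ≤ 91 ^ 4 := Nat.pow_le_pow_left (by omega) 4
    have h3 : 1001 ^ 3 ≤ (n + 1) ^ 3 := Nat.pow_le_pow_left (by omega) 3
    norm_num at h2 h3
    omega
  have h2 : ∀ m : ℕ, 92 ≤ m → 8 ^ m * (14 ^ 10 * m ^ 40) < 125 ^ m := by
    intro m hm
    induction m, hm using Nat.le_induction with
    | base => norm_num
    | succ m hm ih =>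
      have e1 : (m + 1) ^ 40 ≤ 2 * m ^ 40 := by
        have : (92 * (m + 1)) ^ 40 ≤ (93 * m) ^ 40 := Nat.pow_le_pow_left (by omega) _
        rw [mul_pow, mul_pow] at this
        have e : 93 ^ 40 * m ^ 40 ≤ 92 ^ 40 * (2 * m ^ 40) := by
          rw [← mul_assoc]; exact Nat.mul_le_mul_right _ (by norm_num)
        exact Nat.le_of_mul_le_mul_left (this.trans e) (by norm_num)
      calc 8 ^ (m + 1) * (14 ^ 10 * (m + 1) ^ 40) ≤ 8 ^ (m + 1) * (14 ^ 10 * (2 * m ^ 40)) := by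
            gcongr
        _ = 16 * (8 ^ m * (14 ^ 10 * m ^ 40)) := by ring
        _ < 125 * 125 ^ m := by omega
        _ = 125 ^ (m + 1) := by ring
  have h3 : (2 ^ f * (n + 1) ^ 10) ^ 3 < (5 ^ f) ^ 3 := by
    calc (2 ^ f * (n + 1) ^ 10) ^ 3 = 8 ^ f * ((n + 1) ^ 3) ^ 10 := by
          rw [show 8 = 2 ^ 3 by rfl, ← pow_mul 2 3]; ring
      _ ≤ 8 ^ f * (14 * f ^ 4) ^ 10 := by gcongr
      _ = 8 ^ f * (14 ^ 10 * f ^ 40) := by rw [mul_pow, ← pow_mul]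
      _ < 125 ^ f := h2 f hf
      _ = (5 ^ f) ^ 3 := by rw [show 125 = 5 ^ 3 by rfl, ← pow_mul, ← pow_mul, mul_comm]
  exact lt_of_pow_lt_pow_left₀ 3 (by positivity) h3

theorem exists_ramified_exponent {n : ℕ} (hn : 1000 ≤ n) (h5 : 5 ∣ n) :
    ∃ a : ℕ, a.Coprime n ∧ ¬ a ≡ 1 [MOD n] ∧ 5 * a ≡ 5 [MOD n] := by
  obtain ⟨m, rfl⟩ := h5
  obtain ⟨k, hk1, hk2, hk⟩ : ∃ k, 1 ≤ k ∧ k ≤ 2 ∧ ¬ 5 ∣ 1 + k * m := by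
    by_cases h : 5 ∣ 1 + 1 * m
    · exact ⟨2, by norm_num, le_rfl, by omega⟩
    · exact ⟨1, le_rfl, by norm_num, h⟩
  refine ⟨1 + k * m, ?_, ?_, ?_⟩
  · refine Nat.Coprime.mul_right ?_ ?_
    · exact ((Nat.Prime.coprime_iff_not_dvd Nat.prime_five).2 hk).symm
    · simp
  · intro h
    have h1 : k * m ≡ 0 [MOD 5 * m] := Nat.ModEq.add_left_cancel' 1 h
    rw [Nat.modEq_zero_iff_dvd] at h1
    have h2 := Nat.le_of_dvd (Nat.mul_pos hk1 (by omega)) h1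
    nlinarith
  · have : 5 * (1 + k * m) = 5 + 5 * m * k := by ring
    rw [this]
    simp [Nat.ModEq]

/-- Decidable form of the bounds from the unramified primes `5`, `7`, `11`. -/
def boundFails (n f : ℕ) : Bool :=
  [5, 7, 11].any fun q => decide (q < n ∧ n % q ≠ 0 ∧ 2 ^ f * (n + 1) ^ (q + 1) < q ^ f)

theorem boundFails_table :
    ∀ n < 1000,
      ((List.range 32).any fun k => decide (2 ≤ k ∧ k < n + 1 ∧ (n + 1) % k = 0)) = true ∨
      n = 0 ∨
      n + 1 ∈ ({2, 3, 5, 7, 11, 13, 17, 19, 23, 29, 31, 37, 41, 43, 61, 67, 71} : Finset ℕ) ∨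
      n + 1 ∈ ({47, 53, 73, 79} : Finset ℕ) ∨
      boundFails n ((List.range n).countP fun k => Nat.gcd n k == 1) = true := by
  decide +kernel

theorem totient_eq_countP (n : ℕ) :
    n.totient = (List.range n).countP fun k => Nat.gcd n k == 1 := by
  rw [Nat.totient, Finset.card, Finset.filter_val, Finset.range_val, Multiset.range,
    Multiset.filter_coe, Multiset.coe_card, List.countP_eq_length_filter]
  congr 1

theorem mem_of_gen {p : ℕ} [hp : Fact p.Prime] {g : ZMod p} {α : ℤ[X]} (h : Gen p g α)
    (hg : IsPrimitiveRoot g (p - 1)) :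
    p ∈ ({2, 3, 5, 7, 11, 13, 17, 19, 23, 29, 31, 37, 41, 43, 61, 67, 71} : Finset ℕ) ∨
      p ∈ ({47, 53, 73, 79} : Finset ℕ) := by
  have hp1 := hp.out.one_lt
  have hpn : p - 1 + 1 = p := by omega
  rcases lt_or_ge (p - 1) 1000 with hlt | hge
  · rcases boundFails_table (p - 1) hlt with h1 | h1 | h1 | h1 | h1
    · rw [hpn, List.any_eq_true] at h1
      obtain ⟨k, -, hk⟩ := h1
      rw [decide_eq_true_eq] at hk
      rcases (Nat.dvd_prime hp.out).1 (Nat.dvd_of_mod_eq_zero hk.2.2) with h2 | h2 <;> omega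
    · omega
    · rw [hpn] at h1
      exact Or.inl h1
    · rw [hpn] at h1
      exact Or.inr h1
    · rw [← totient_eq_countP, boundFails, List.any_eq_true] at h1
      obtain ⟨q, hq, hq'⟩ := h1
      rw [decide_eq_true_eq] at hq'
      have hqp : q.Prime := by
        simp only [List.mem_cons, List.not_mem_nil, or_false] at hq
        rcases hq with rfl | rfl | rfl <;> norm_num
      have := h.bound_of_not_dvd hg hqp hq'.1 (fun hd => hq'.2.1 (Nat.mod_eq_zero_of_dvd hd))
      rw [hpn] at hq'
      omega
  · exfalso
    have hb := lt_pow_totient hge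
    rw [hpn] at hb
    by_cases h5 : 5 ∣ p - 1
    · obtain ⟨a, ha, ha1, ha5⟩ := exists_ramified_exponent hge h5
      have := h.bound_of_modEq hg Nat.prime_five (by omega) ha ha1 ha5
      norm_num at this
      omega
    · have := h.bound_of_not_dvd hg Nat.prime_five (by omega) h5
      have h2 : p ^ (5 + 1) ≤ p ^ 10 := Nat.pow_le_pow_right (by omega) (by norm_num)
      have h3 := Nat.mul_le_mul_left (2 ^ (p - 1).totient) h2
      omega

theorem exists_int_of_invariant_of_isCyclotomicExtension {n : ℕ} (K : Type*) [Field K]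
    [Algebra ℚ K] [IsCyclotomicExtension {n} ℚ K] (hn : 0 < n) {z : ℂ} (hz : IsPrimitiveRoot z n) {f : ℤ[X]}
    (h : ∀ b < n, b.Coprime n → aeval (z ^ b) f = aeval z f) :
    ∃ U : ℤ, cyclotomic n ℤ ∣ f - C U := by
  have : NeZero n := ⟨hn.ne'⟩
  have : CharZero K := algebraRat.charZero K
  have hζ := IsCyclotomicExtension.zeta_spec n ℚ K
  set ζ := IsCyclotomicExtension.zeta n ℚ K
  have : IsGalois ℚ K :=
    IsCyclotomicExtension.isGalois {n} ℚ K
  have hdvd : ∀ r : ℤ[X], aeval ζ r = 0 ↔ cyclotomic n ℤ ∣ r := by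
    intro r
    constructor
    · intro hr
      rw [cyclotomic_eq_minpoly hζ hn]
      exact minpoly.isIntegrallyClosed_dvd (hζ.isIntegral hn) hr
    · rintro ⟨c, rfl⟩
      rw [map_mul, aeval_cyclotomic_of_mem hn ((mem_primitiveRoots hn).2 hζ), zero_mul]
  have hc : aeval ζ f ∈ (⊥ : IntermediateField ℚ K) := by
    have : FiniteDimensional ℚ K := IsCyclotomicExtension.finiteDimensional {n} ℚ K
    rw [IsGalois.mem_bot_iff_fixed]
    intro σ
    have h1 : σ (aeval ζ f) = aeval (σ ζ) f := by
      rw [aeval_def, aeval_def]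
      exact (hom_eval₂ f (algebraMap ℤ K) (σ : K →+* K) ζ).trans
        (congrArg (fun r => eval₂ r (σ ζ) f) (RingHom.ext_int _ _))
    have hσ : IsPrimitiveRoot (σ ζ) n := hζ.map_of_injective σ.injective
    obtain ⟨b, hb, hb2⟩ := hζ.eq_pow_of_pow_eq_one hσ.pow_eq_one
    have hbn : b.Coprime n := (hζ.pow_iff_coprime hn b).1 (hb2 ▸ hσ)
    have h2 := cyclotomic_dvd_of_aeval_eq_zero hn hz (f := expand ℤ b f - f) (by
      rw [map_sub, expand_aeval, h b hb hbn, sub_self])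
    rw [← hdvd, map_sub, expand_aeval, sub_eq_zero] at h2
    rw [h1, ← hb2, h2]
  obtain ⟨r, hr⟩ := IntermediateField.mem_bot.1 hc
  have hr_int : IsIntegral ℤ r := by
    have h3 : IsIntegral ℤ (algebraMap ℚ K r) := by
      rw [hr]
      exact IsIntegral.of_mem_of_fg _ (hζ.isIntegral hn).fg_adjoin_singleton _
        (aeval_mem_adjoin_singleton ℤ ζ)
    exact (isIntegral_algebraMap_iff (algebraMap ℚ K).injective).1 h3
  obtain ⟨U, rfl⟩ := IsIntegrallyClosed.isIntegral_iff.1 hr_int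
  refine ⟨U, (hdvd _).1 ?_⟩
  rw [map_sub, ← hr]
  simp

/-- An integral polynomial whose value at `ζ_n` is Galois invariant takes an integral value. -/
theorem exists_int_of_invariant {n : ℕ} (hn : 0 < n) {z : ℂ} (hz : IsPrimitiveRoot z n) {f : ℤ[X]}
    (h : ∀ b < n, b.Coprime n → aeval (z ^ b) f = aeval z f) :
    ∃ U : ℤ, cyclotomic n ℤ ∣ f - C U := by
  have : NeZero n := ⟨hn.ne'⟩
  have : NeZero ((n : ℕ) : ℚ) := ⟨by exact_mod_cast hn.ne'⟩
  have : IsCyclotomicExtension {n} ℚ (CyclotomicField n ℚ) :=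
    CyclotomicField.isCyclotomicExtension n ℚ
  exact exists_int_of_invariant_of_isCyclotomicExtension (CyclotomicField n ℚ) hn hz h

/-- The product of `α(X ^ a)` over a list of exponents. -/
noncomputable def partialNorm (S : List ℕ) (α : ℤ[X]) : ℤ[X] := (S.map fun a => expand ℤ a α).prod

theorem aeval_partialNorm {R : Type*} [CommRing R] (S : List ℕ) (α : ℤ[X]) (t : R) :
    aeval t (partialNorm S α) = (S.map fun a => aeval (t ^ a) α).prod := by
  rw [partialNorm, map_list_prod, List.map_map]
  congr 1
  exact List.map_congr_left fun a _ => expand_aeval _ _ _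

theorem aeval_pow_partialNorm {R : Type*} [CommRing R] {n b : ℕ} {S T : List ℕ} (α : ℤ[X]) {t : R}
    (ht : t ^ n = 1) (h : (S.map fun a => b * a % n).Perm T) :
    aeval (t ^ b) (partialNorm S α) = aeval t (partialNorm T α) := by
  rw [aeval_partialNorm, aeval_partialNorm, ← (h.map fun a => aeval (t ^ a) α).prod_eq,
    List.map_map]
  congr 1
  refine List.map_congr_left fun a _ => ?_
  rw [Function.comp_apply, ← pow_mul, pow_eq_of_modEq ht (Nat.mod_modEq _ _).symm]

theorem cycNorm_eq_partialNorm {n : ℕ} (hn : 0 < n) {z : ℂ} (hz : IsPrimitiveRoot z n) (α : ℤ[X]) :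
    (cycNorm n α : ℂ) = aeval z (partialNorm ((List.range n).filter fun a => a.Coprime n) α) := by
  rw [cycNorm_cast_complex hn, aeval_partialNorm]
  have h1 : (((List.range n).filter fun a => a.Coprime n).map fun a => aeval (z ^ a) α).prod =
      ∏ a ∈ (Finset.range n).filter (fun a => a.Coprime n), aeval (z ^ a) α := rfl
  rw [h1]
  symm
  refine Finset.prod_bij (fun a _ => z ^ a) ?_ ?_ ?_ (fun _ _ => rfl)
  · intro a ha
    rw [Finset.mem_filter] at ha
    exact (mem_primitiveRoots hn).2 (hz.pow_of_coprime a ha.2)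
  · intro a ha b hb hab
    rw [Finset.mem_filter, Finset.mem_range] at ha hb
    exact hz.pow_inj ha.1 hb.1 hab
  · intro x hx
    have hx' := isPrimitiveRoot_of_mem_primitiveRoots hx
    have : NeZero n := ⟨hn.ne'⟩
    obtain ⟨b, hb, rfl⟩ := hz.eq_pow_of_pow_eq_one hx'.pow_eq_one
    exact ⟨b, by simpa [hb] using (hz.pow_iff_coprime hn b).1 hx', rfl⟩

/-- The combinatorial data of an imaginary quadratic subfield of `ℚ(ζ_n)`: the classes `S`
fixing it and the complementary classes `T`. -/
structure QuadraticData (n : ℕ) (S T : List ℕ) : Prop where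
  pos : 2 < n
  map_neg : (S.map fun a => (n - 1) * a % n).Perm T
  append : (S ++ T).Perm ((List.range n).filter fun a => a.Coprime n)
  map_mem : ∀ b ∈ S, (S.map fun a => b * a % n).Perm S ∧ (T.map fun a => b * a % n).Perm T
  map_not_mem : ∀ b ∈ T, (S.map fun a => b * a % n).Perm T ∧ (T.map fun a => b * a % n).Perm S

theorem QuadraticData.aeval_mul_conj {n : ℕ} {S T : List ℕ} (D : QuadraticData n S T)
    {z : ℂ} (hz : IsPrimitiveRoot z n) (α : ℤ[X]) :
    aeval z (partialNorm T α) = (starRingEnd ℂ) (aeval z (partialNorm S α)) := by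
  have hn : 0 < n := by have := D.pos; omega
  have h1 : ‖z‖ = 1 := Complex.norm_eq_one_of_pow_eq_one hz.pow_eq_one hn.ne'
  have h0 : z ≠ 0 := by intro h; simp [h] at h1
  have h2 : z ^ (n - 1) = (starRingEnd ℂ) z := by
    apply mul_right_cancel₀ h0
    rw [← Complex.normSq_eq_conj_mul_self, Complex.normSq_eq_norm_sq, h1, ← pow_succ,
      Nat.sub_add_cancel hn, hz.pow_eq_one]
    simp
  rw [← aeval_pow_partialNorm α hz.pow_eq_one D.map_neg, ← aeval_conj, h2]

theorem QuadraticData.aeval_mul {n : ℕ} {S T : List ℕ} (D : QuadraticData n S T)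
    {z : ℂ} (hz : IsPrimitiveRoot z n) (α : ℤ[X]) :
    aeval z (partialNorm S α) * aeval z (partialNorm T α) = ((cycNorm n α).natAbs : ℂ) := by
  have hn : 0 < n := by have := D.pos; omega
  have h1 : aeval z (partialNorm S α) * aeval z (partialNorm T α) = (cycNorm n α : ℂ) := by
    rw [cycNorm_eq_partialNorm hn hz, aeval_partialNorm, aeval_partialNorm, aeval_partialNorm,
      ← (D.append.map fun a => aeval (z ^ a) α).prod_eq, List.map_append, List.prod_append]
  have h2 : 0 ≤ cycNorm n α := by
    have h3 : ((cycNorm n α : ℤ) : ℂ) = ((Complex.normSq (aeval z (partialNorm S α)) : ℝ) : ℂ) := by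
      rw [← h1, D.aeval_mul_conj hz, Complex.mul_conj]
    have h4 : ((cycNorm n α : ℤ) : ℝ) = Complex.normSq (aeval z (partialNorm S α)) := by
      exact_mod_cast h3
    have h5 := Complex.normSq_nonneg (aeval z (partialNorm S α))
    rw [← h4] at h5
    exact_mod_cast h5
  rw [h1, ← Int.cast_natCast, Int.natAbs_of_nonneg h2]

theorem Gen.quadratic {p n : ℕ} [hp : Fact p.Prime] {g : ZMod p} {α : ℤ[X]} (h : Gen p g α)
    (hg : IsPrimitiveRoot g (p - 1)) {S T : List ℕ} (hpn : p - 1 = n) (D : QuadraticData n S T)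
    {z : ℂ} (hz : IsPrimitiveRoot z n) (s : ℤ[X])
    (hs : ∀ b ∈ S, aeval (z ^ b) s = aeval z s) (hs' : ∀ b ∈ T, aeval (z ^ b) s = - aeval z s) :
    ∃ U W : ℤ, U ^ 2 ≤ 4 * p ∧
      cyclotomic n ℤ ∣ partialNorm S α + partialNorm T α - C U ∧
      cyclotomic n ℤ ∣ partialNorm S α * partialNorm T α - C (p : ℤ) ∧
      cyclotomic n ℤ ∣ (partialNorm S α - partialNorm T α) * s - C W := by
  have hn : 0 < n := by have := D.pos; omega
  have hmem : ∀ b < n, b.Coprime n → b ∈ S ∨ b ∈ T := fun b hb hbn => by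
    rw [← List.mem_append, D.append.mem_iff]
    simpa [hb] using hbn
  have hST : ∀ b < n, b.Coprime n →
      (b ∈ S ∧ aeval (z ^ b) (partialNorm S α) = aeval z (partialNorm S α) ∧
        aeval (z ^ b) (partialNorm T α) = aeval z (partialNorm T α)) ∨
      (b ∈ T ∧ aeval (z ^ b) (partialNorm S α) = aeval z (partialNorm T α) ∧
        aeval (z ^ b) (partialNorm T α) = aeval z (partialNorm S α)) := by
    intro b hb hbn
    refine (hmem b hb hbn).imp (fun h => ⟨h, ?_⟩) (fun h => ⟨h, ?_⟩)
    · exact ⟨aeval_pow_partialNorm α hz.pow_eq_one (D.map_mem b h).1,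
        aeval_pow_partialNorm α hz.pow_eq_one (D.map_mem b h).2⟩
    · exact ⟨aeval_pow_partialNorm α hz.pow_eq_one (D.map_not_mem b h).1,
        aeval_pow_partialNorm α hz.pow_eq_one (D.map_not_mem b h).2⟩
  obtain ⟨U, hU⟩ := exists_int_of_invariant hn hz (f := partialNorm S α + partialNorm T α) (by
    intro b hb hbn
    rcases hST b hb hbn with ⟨-, h1, h2⟩ | ⟨-, h1, h2⟩
    · rw [map_add, map_add, h1, h2]
    · rw [map_add, map_add, h1, h2, add_comm])
  obtain ⟨W, hW⟩ := exists_int_of_invariant hn hz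
    (f := (partialNorm S α - partialNorm T α) * s) (by
    intro b hb hbn
    rcases hST b hb hbn with ⟨h0, h1, h2⟩ | ⟨h0, h1, h2⟩
    · rw [map_mul, map_mul, map_sub, map_sub, h1, h2, hs b h0]
    · rw [map_mul, map_mul, map_sub, map_sub, h1, h2, hs' b h0]; ring)
  have hN : (cycNorm n α).natAbs = p := by rw [← hpn]; exact natAbs_cycNorm h hg
  have hmul := D.aeval_mul hz α
  rw [hN] at hmul
  refine ⟨U, W, ?_, hU, ?_, hW⟩
  · obtain ⟨c, hc⟩ := hU
    have h1 := congrArg (aeval z) hc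
    rw [map_mul, aeval_cyclotomic_of_mem hn ((mem_primitiveRoots hn).2 hz), zero_mul, map_sub,
      map_add, sub_eq_zero] at h1
    rw [D.aeval_mul_conj hz, aeval_C, algebraMap_int_eq, eq_intCast] at h1
    rw [D.aeval_mul_conj hz, Complex.mul_conj] at hmul
    set x := aeval z (partialNorm S α)
    have h2 : 2 * x.re = U := by
      have := congrArg Complex.re h1
      simp at this
      linarith
    have h3 : x.re * x.re + x.im * x.im = p := by
      rw [← Complex.normSq_apply]
      exact_mod_cast hmul
    have h4 : (U : ℝ) ^ 2 ≤ 4 * p := by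
      rw [← h2]
      nlinarith [mul_self_nonneg x.im]
    exact_mod_cast h4
  · refine cyclotomic_dvd_of_aeval_eq_zero hn hz ?_
    rw [map_sub, map_mul, hmul]
    simp

theorem aeval_cyclotomic_mul_prime {m q : ℕ} [hq : Fact q.Prime] (hm : 0 < m) (hqm : ¬ q ∣ m)
    {t : ZMod q} (ht : IsPrimitiveRoot t m) : aeval t (cyclotomic (m * q) ℤ) = 0 := by
  have h1 := ht.isRoot_cyclotomic hm
  rw [IsRoot.def] at h1
  rw [aeval_def, algebraMap_int_eq, ← eval_map, map_cyclotomic_int,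
    cyclotomic_mul_prime_eq_pow_of_not_dvd _ hqm, eval_pow, h1, zero_pow]
  have := hq.out.two_le
  omega

theorem Gen.quadratic_sq {p n : ℕ} [hp : Fact p.Prime] {g : ZMod p} {α : ℤ[X]} (h : Gen p g α)
    (hg : IsPrimitiveRoot g (p - 1)) {S T : List ℕ} (hpn : p - 1 = n) (D : QuadraticData n S T)
    {z : ℂ} (hz : IsPrimitiveRoot z n) (s : ℤ[X]) (d : ℤ)
    (hs : ∀ b ∈ S, aeval (z ^ b) s = aeval z s) (hs' : ∀ b ∈ T, aeval (z ^ b) s = - aeval z s)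
    (hd : aeval z s ^ 2 = - d) :
    ∃ U W : ℤ, U ^ 2 ≤ 4 * p ∧ W ^ 2 = d * (4 * p - U ^ 2) ∧
      cyclotomic n ℤ ∣ partialNorm S α + partialNorm T α - C U ∧
      cyclotomic n ℤ ∣ partialNorm S α * partialNorm T α - C (p : ℤ) := by
  obtain ⟨U, W, h1, h2, h3, h4⟩ := h.quadratic hg hpn D hz s hs hs'
  refine ⟨U, W, h1, ?_, h2, h3⟩
  have hn : 0 < n := by have := D.pos; omega
  have hev : ∀ f : ℤ[X], cyclotomic n ℤ ∣ f → aeval z f = 0 := by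
    rintro _ ⟨c, rfl⟩
    rw [map_mul, aeval_cyclotomic_of_mem hn ((mem_primitiveRoots hn).2 hz), zero_mul]
  replace h2 := hev _ h2
  replace h3 := hev _ h3
  replace h4 := hev _ h4
  simp only [map_sub, map_add, map_mul, eq_intCast, map_intCast, map_natCast] at h2 h3 h4
  have h5 : (W : ℂ) ^ 2 = d * (4 * p - U ^ 2) := by
    generalize aeval z (partialNorm S α) = P at *
    generalize aeval z (partialNorm T α) = Q at *
    generalize aeval z s = r at *
    have hW : (W : ℂ) = (P - Q) * r := by linear_combination -h4
    have hU : (U : ℂ) = P + Q := by linear_combination -h2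
    have hp' : (p : ℂ) = P * Q := by linear_combination -h3
    rw [hW, hU, hp', mul_pow, hd]
    ring
  exact_mod_cast h5

theorem partialNorm_const {R : Type*} [CommRing R] {S : List ℕ} {t u : R} (α : ℤ[X])
    (h : ∀ a ∈ S, t ^ a = u) : aeval t (partialNorm S α) = aeval u α ^ S.length := by
  rw [aeval_partialNorm, List.map_congr_left (g := fun _ => aeval u α), List.map_const',
    List.prod_replicate]
  intro a ha
  rw [h a ha]

/-- Values at roots of the cyclotomic polynomial modulo a prime. -/
theorem aeval_of_dvd_sub {R : Type*} [CommRing R] {n : ℕ} {t : R} {P Q : ℤ[X]} {U V : ℤ}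
    (ht : aeval t (cyclotomic n ℤ) = 0) (h1 : cyclotomic n ℤ ∣ P + Q - C U)
    (h2 : cyclotomic n ℤ ∣ P * Q - C V) :
    aeval t P + aeval t Q = U ∧ aeval t P * aeval t Q = V := by
  obtain ⟨c, hc⟩ := h1
  obtain ⟨d, hd⟩ := h2
  have hc' := congrArg (aeval t) hc
  have hd' := congrArg (aeval t) hd
  rw [map_mul, ht, zero_mul] at hc' hd'
  simp only [map_sub, map_add, map_mul, eq_intCast, map_intCast] at hc' hd'
  exact ⟨sub_eq_zero.1 hc', sub_eq_zero.1 hd'⟩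

theorem pow_half_eq_neg_one {z : ℂ} {m : ℕ} (hm : 0 < m) (hz : IsPrimitiveRoot z (2 * m)) :
    z ^ m = -1 := by
  have h1 : (z ^ m) ^ 2 = 1 := by rw [← pow_mul, mul_comm, hz.pow_eq_one]
  have h2 : (z ^ m - 1) * (z ^ m + 1) = 0 := by linear_combination h1
  rcases mul_eq_zero.1 h2 with h | h
  · exact absurd (hz.dvd_of_pow_eq_one m (sub_eq_zero.1 h))
      (fun hd => by have := Nat.le_of_dvd hm hd; omega)
  · exact eq_neg_of_add_eq_zero_left h

theorem not_gen_47 [Fact (Nat.Prime 47)] {g : ZMod 47} {α : ℤ[X]} (h : Gen 47 g α)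
    (hg : IsPrimitiveRoot g (47 - 1)) : False := by
  have D : QuadraticData 46 [1, 3, 9, 13, 25, 27, 29, 31, 35, 39, 41]
      [5, 7, 11, 15, 17, 19, 21, 33, 37, 43, 45] := by
    constructor <;> decide
  obtain ⟨U, W, h1, -, h2, h3⟩ := h.quadratic_sq hg rfl D
    (Complex.isPrimitiveRoot_exp 46 (by norm_num)) 0 0 (by simp) (by simp) (by simp)
  have k1 : ∀ a ∈ [1, 3, 9, 13, 25, 27, 29, 31, 35, 39, 41], (-1 : ZMod 23) ^ a = -1 := by decide
  have k2 : ∀ a ∈ [5, 7, 11, 15, 17, 19, 21, 33, 37, 43, 45], (-1 : ZMod 23) ^ a = -1 := by decide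
  have k3 : ∀ U ∈ Finset.Icc (-13 : ℤ) 13, (U : ZMod 23) ^ 2 = 4 → U = 2 ∨ U = -2 := by decide
  have k4 : (((47 : ℕ) : ℤ) : ZMod 23) = 1 := by decide
  have k5 : (8 : ZMod 139) ^ 46 = 1 ∧ ∀ l ∈ Finset.Ico 1 46, (8 : ZMod 139) ^ l ≠ 1 := by
    decide +kernel
  have k6 : ∀ x : ZMod 139, x ^ 2 ≠ -184 := by decide +kernel
  have : Fact (Nat.Prime 23) := ⟨by norm_num⟩
  have : Fact (Nat.Prime 139) := ⟨by norm_num⟩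
  have e1 := aeval_of_dvd_sub (aeval_cyclotomic_mul_prime (m := 2) (q := 23) (by norm_num)
    (by norm_num) (t := -1) (IsPrimitiveRoot.neg_one 23 (by norm_num))) h2 h3
  rw [partialNorm_const (u := -1) α k1, partialNorm_const (u := -1) α k2] at e1
  have hU : U = 2 ∨ U = -2 := by
    have h4 : (U : ZMod 23) ^ 2 = 4 := by
      obtain ⟨a1, a2⟩ := e1
      rw [k4] at a2
      simp only [List.length_cons, List.length_nil] at a1 a2
      rw [← a1]
      linear_combination 4 * a2
    have h6 : -13 ≤ U := by push_cast at h1; nlinarith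
    have h7 : U ≤ 13 := by push_cast at h1; nlinarith
    exact k3 U (Finset.mem_Icc.2 ⟨h6, h7⟩) h4
  have ht : IsPrimitiveRoot (8 : ZMod 139) 46 := 
    (IsPrimitiveRoot.iff (by norm_num)).2
      ⟨k5.1, fun l h h' => k5.2 l (Finset.mem_Ico.2 ⟨h, h'⟩)⟩
  obtain ⟨a1, a2⟩ := aeval_of_dvd_sub
    (aeval_cyclotomic_of_mem (by norm_num) ((mem_primitiveRoots (by norm_num)).2 ht)) h2 h3
  generalize aeval (8 : ZMod 139) (partialNorm _ α) = P at *
  generalize aeval (8 : ZMod 139) (partialNorm _ α) = Q at *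
  have hPQ : (P - Q) ^ 2 = -184 := by
    have h5 : (U : ZMod 139) ^ 2 = 4 := by rcases hU with rfl | rfl <;> norm_num
    push_cast at a2
    rw [← a1] at h5
    linear_combination h5 - 4 * a2
  exact k6 _ hPQ

theorem not_gen_53 [Fact (Nat.Prime 53)] {g : ZMod 53} {α : ℤ[X]} (h : Gen 53 g α)
    (hg : IsPrimitiveRoot g (53 - 1)) : False := by
  have D : QuadraticData 52 [1, 5, 9, 17, 21, 25, 29, 33, 37, 41, 45, 49]
      [3, 7, 11, 15, 19, 23, 27, 31, 35, 43, 47, 51] := by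
    constructor <;> decide
  have hz := Complex.isPrimitiveRoot_exp 52 (by norm_num)
  have hz2 := pow_half_eq_neg_one (m := 26) (by norm_num) hz
  set z := Complex.exp (2 * Real.pi * Complex.I / (52 : ℕ))
  have hz3 : z ^ 39 = - z ^ 13 := by linear_combination z ^ 13 * hz2
  obtain ⟨U, W, h1, h4, h2, h3⟩ := h.quadratic_sq hg rfl D hz (X ^ 13) 1
    (by
      intro b hb
      have hb' : b * 13 ≡ 13 [MOD 52] := by revert b; decide
      rw [map_pow, map_pow, aeval_X, aeval_X, ← pow_mul, pow_eq_of_modEq hz.pow_eq_one hb'])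
    (by
      intro b hb
      have hb' : b * 13 ≡ 39 [MOD 52] := by revert b; decide
      rw [map_pow, map_pow, aeval_X, aeval_X, ← pow_mul, pow_eq_of_modEq hz.pow_eq_one hb', hz3])
    (by rw [map_pow, aeval_X, ← pow_mul, hz2]; simp)
  have k1 : ∀ a ∈ [1, 5, 9, 17, 21, 25, 29, 33, 37, 41, 45, 49], (5 : ZMod 13) ^ a = 5 := by decide
  have k2 : ∀ a ∈ [3, 7, 11, 15, 19, 23, 27, 31, 35, 43, 47, 51], (5 : ZMod 13) ^ a = 8 := by
    decide
  have k3 : ∀ U ∈ Finset.Icc (-14 : ℤ) 14, (U : ZMod 13) = 2 → U = 2 ∨ U = -11 := by decide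
  have k4 : (((53 : ℕ) : ℤ) : ZMod 13) = 1 := by decide
  have k5 : (5 : ZMod 13) ^ 4 = 1 ∧ ∀ l ∈ Finset.Ico 1 4, (5 : ZMod 13) ^ l ≠ 1 := by decide
  have k6 : ∀ W ∈ Finset.Icc (-15 : ℤ) 15, W ^ 2 ≠ 208 ∧ W ^ 2 ≠ 91 := by decide
  have k7 : ∀ x y : ZMod 13, x ^ 12 * y ^ 12 = 1 → x ^ 12 + y ^ 12 = 2 := by decide
  have : Fact (Nat.Prime 13) := ⟨by norm_num⟩
  have ht : IsPrimitiveRoot (5 : ZMod 13) 4 :=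
    (IsPrimitiveRoot.iff (by norm_num)).2
      ⟨k5.1, fun l h h' => k5.2 l (Finset.mem_Ico.2 ⟨h, h'⟩)⟩
  obtain ⟨a1, a2⟩ := aeval_of_dvd_sub (aeval_cyclotomic_mul_prime (m := 4) (q := 13) (by norm_num)
    (by norm_num) ht) h2 h3
  rw [partialNorm_const (u := 5) α k1, partialNorm_const (u := 8) α k2] at a1 a2
  have hU : U = 2 ∨ U = -11 := by
    push_cast at h1
    exact k3 U (Finset.mem_Icc.2 ⟨by nlinarith, by nlinarith⟩)
      (a1.symm.trans (k7 _ _ (a2.trans k4)))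
  push_cast at h4
  have hW : -15 ≤ W ∧ W ≤ 15 := ⟨by nlinarith, by nlinarith⟩
  have k6' := k6 W (Finset.mem_Icc.2 hW)
  rcases hU with rfl | rfl
  · exact k6'.1 (h4.trans (by norm_num))
  · exact k6'.2 (h4.trans (by norm_num))

theorem not_gen_79 [Fact (Nat.Prime 79)] {g : ZMod 79} {α : ℤ[X]} (h : Gen 79 g α)
    (hg : IsPrimitiveRoot g (79 - 1)) : False := by
  have D : QuadraticData 78 [1, 7, 19, 25, 31, 37, 43, 49, 55, 61, 67, 73]
      [5, 11, 17, 23, 29, 35, 41, 47, 53, 59, 71, 77] := by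
    constructor <;> decide
  have hz := Complex.isPrimitiveRoot_exp 78 (by norm_num)
  set z := Complex.exp (2 * Real.pi * Complex.I / (78 : ℕ))
  have hz2 : (z ^ 13) ^ 2 - z ^ 13 + 1 = 0 := by
    have h3 : z ^ 39 = -1 := pow_half_eq_neg_one (m := 39) (by norm_num) hz
    have h4 : (z ^ 13 + 1) * ((z ^ 13) ^ 2 - z ^ 13 + 1) = 0 := by linear_combination h3
    refine (mul_eq_zero.1 h4).resolve_left fun h5 => ?_
    have h6 : z ^ 26 = 1 := by linear_combination (z ^ 13 - 1) * h5
    have h7 := hz.dvd_of_pow_eq_one 26 h6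
    norm_num at h7
  have hz3 : z ^ 65 = 1 - z ^ 13 := by
    linear_combination (z ^ 39 + z ^ 26 - 1) * hz2
  obtain ⟨U, W, h1, h4, h2, h3⟩ := h.quadratic_sq hg rfl D hz (2 * X ^ 13 - 1) 3
    (by
      intro b hb
      have hb' : b * 13 ≡ 13 [MOD 78] := by revert b; decide
      simp only [map_sub, map_mul, map_pow, aeval_X, ← pow_mul,
        pow_eq_of_modEq hz.pow_eq_one hb', map_ofNat, map_one])
    (by
      intro b hb
      have hb' : b * 13 ≡ 65 [MOD 78] := by revert b; decide
      simp only [map_sub, map_mul, map_pow, aeval_X, ← pow_mul,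
        pow_eq_of_modEq hz.pow_eq_one hb', hz3, map_ofNat, map_one]
      ring)
    (by
      simp only [map_sub, map_mul, map_pow, aeval_X, map_ofNat, map_one]
      push_cast
      linear_combination 4 * hz2)
  have k1 : ∀ a ∈ [1, 7, 19, 25, 31, 37, 43, 49, 55, 61, 67, 73], (4 : ZMod 13) ^ a = 4 := by decide
  have k2 : ∀ a ∈ [5, 11, 17, 23, 29, 35, 41, 47, 53, 59, 71, 77], (4 : ZMod 13) ^ a = 10 := by
    decide
  have k3 : ∀ U ∈ Finset.Icc (-17 : ℤ) 17, (U : ZMod 13) = 2 → U = 2 ∨ U = -11 ∨ U = 15 := by decide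
  have k4 : (((79 : ℕ) : ℤ) : ZMod 13) = 1 := by decide
  have k5 : (4 : ZMod 13) ^ 6 = 1 ∧ ∀ l ∈ Finset.Ico 1 6, (4 : ZMod 13) ^ l ≠ 1 := by decide
  have k6 : ∀ W ∈ Finset.Icc (-31 : ℤ) 31, W ^ 2 ≠ 936 ∧ W ^ 2 ≠ 585 ∧ W ^ 2 ≠ 273 := by decide
  have k7 : ∀ x y : ZMod 13, x ^ 12 * y ^ 12 = 1 → x ^ 12 + y ^ 12 = 2 := by decide
  have : Fact (Nat.Prime 13) := ⟨by norm_num⟩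
  have ht : IsPrimitiveRoot (4 : ZMod 13) 6 :=
    (IsPrimitiveRoot.iff (by norm_num)).2
      ⟨k5.1, fun l h h' => k5.2 l (Finset.mem_Ico.2 ⟨h, h'⟩)⟩
  obtain ⟨a1, a2⟩ := aeval_of_dvd_sub (aeval_cyclotomic_mul_prime (m := 6) (q := 13) (by norm_num)
    (by norm_num) ht) h2 h3
  rw [partialNorm_const (u := 4) α k1, partialNorm_const (u := 10) α k2] at a1 a2
  have hU : U = 2 ∨ U = -11 ∨ U = 15 := by
    push_cast at h1
    exact k3 U (Finset.mem_Icc.2 ⟨by nlinarith, by nlinarith⟩)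
      (a1.symm.trans (k7 _ _ (a2.trans k4)))
  push_cast at h4
  have hW : -31 ≤ W ∧ W ≤ 31 := ⟨by nlinarith, by nlinarith⟩
  have k6' := k6 W (Finset.mem_Icc.2 hW)
  rcases hU with rfl | rfl | rfl
  · exact k6'.1 (h4.trans (by norm_num))
  · exact k6'.2.1 (h4.trans (by norm_num))
  · exact k6'.2.2 (h4.trans (by norm_num))

/-- The polynomial with prescribed sections modulo `3`. -/
noncomputable def ofSections (a b c : ℤ[X]) : ℤ[X] :=
  expand ℤ 3 a + X * expand ℤ 3 b + X ^ 2 * expand ℤ 3 c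

theorem exists_ofSections (f : ℤ[X]) : ∃ a b c, f = ofSections a b c := by
  induction f using Polynomial.induction_on with
  | C r => exact ⟨C r, 0, 0, by simp [ofSections]⟩
  | add f g hf hg =>
    obtain ⟨a, b, c, rfl⟩ := hf
    obtain ⟨a', b', c', rfl⟩ := hg
    exact ⟨a + a', b + b', c + c', by simp only [ofSections, map_add]; ring⟩
  | monomial n r h =>
    obtain ⟨a, b, c, h⟩ := h
    refine ⟨X * c, a, b, ?_⟩
    rw [pow_succ, ← mul_assoc, h, ofSections, ofSections, map_mul, expand_X]
    ring

/-- The transform whose roots are the cubes of the roots of `ofSections a b c`. -/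
noncomputable def graeffe (a b c : ℤ[X]) : ℤ[X] :=
  a ^ 3 + X * b ^ 3 + X ^ 2 * c ^ 3 - 3 * X * a * b * c

theorem aeval_graeffe {R : Type*} [CommRing R] {y w : R} (hw : w ^ 2 + w + 1 = 0) (a b c : ℤ[X]) :
    aeval (y ^ 3) (graeffe a b c) = aeval y (ofSections a b c) *
      aeval (y * w) (ofSections a b c) * aeval (y * w ^ 2) (ofSections a b c) := by
  have h3 : w ^ 3 = 1 := by linear_combination (w - 1) * hw
  have h1 : (y * w) ^ 3 = y ^ 3 := by rw [mul_pow, h3, mul_one]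
  have h2 : (y * w ^ 2) ^ 3 = y ^ 3 := by
    linear_combination y ^ 3 * (w ^ 3 + 1) * h3
  simp only [graeffe, ofSections, map_add, map_mul, map_sub, map_pow, aeval_X, expand_aeval, h1, h2,
    map_ofNat]
  generalize aeval (y ^ 3) a = A
  generalize aeval (y ^ 3) b = B
  generalize aeval (y ^ 3) c = D
  linear_combination -(A + y * B + y ^ 2 * D) * (h3 * (y * B) ^ 2 +
    (w ^ 3 + 1) * h3 * (y ^ 2 * D) ^ 2 + A * (y * B) * hw + A * (y ^ 2 * D) * (hw + w * h3) +
    y * B * (y ^ 2 * D) * (hw + (w ^ 2 + w) * h3))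

theorem C_three_dvd_graeffe_sub (a b c : ℤ[X]) :
    C (3 : ℤ) ∣ graeffe a b c - ofSections a b c := by
  obtain ⟨u, hu⟩ := C_dvd_pow_sub_expand Nat.prime_three a
  obtain ⟨v, hv⟩ := C_dvd_pow_sub_expand Nat.prime_three b
  obtain ⟨w, hw⟩ := C_dvd_pow_sub_expand Nat.prime_three c
  have h3 : (C (3 : ℤ)) = 3 := rfl
  rw [Nat.cast_ofNat, h3] at hu hv hw
  rw [h3]
  refine ⟨u + X * v + X ^ 2 * w - X * a * b * c, ?_⟩
  rw [graeffe, ofSections]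
  linear_combination hu + X * hv + X ^ 2 * hw

theorem exists_graeffe_pair (α : ℤ[X]) : ∃ h k : ℤ[X], C (3 : ℤ) ∣ h - α ∧ C (9 : ℤ) ∣ k - h ∧
    (∀ y w : ℂ, w ^ 2 + w + 1 = 0 →
      aeval (y ^ 3) h = aeval y α * aeval (y * w) α * aeval (y * w ^ 2) α) ∧
    (∀ y w : ℂ, w ^ 2 + w + 1 = 0 →
      aeval (y ^ 3) k = aeval y h * aeval (y * w) h * aeval (y * w ^ 2) h) := by
  obtain ⟨a, b, c, rfl⟩ := exists_ofSections α
  obtain ⟨m, hm⟩ := C_three_dvd_graeffe_sub a b c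
  obtain ⟨a', b', c', rfl⟩ := exists_ofSections m
  have h3 : (C (3 : ℤ)) = 3 := rfl
  have h9 : (C (9 : ℤ)) = 9 := rfl
  have he : graeffe a b c = ofSections (a + 3 * a') (b + 3 * b') (c + 3 * c') := by
    rw [h3] at hm
    simp only [ofSections, map_add, map_mul, map_ofNat] at hm ⊢
    linear_combination hm
  refine ⟨graeffe a b c, graeffe (a + 3 * a') (b + 3 * b') (c + 3 * c'), ⟨_, hm⟩, ?_,
    fun y w hw => aeval_graeffe hw a b c, fun y w hw => ?_⟩
  · rw [h9]
    refine ⟨(a ^ 2 * a' + 3 * a * a' ^ 2 + 3 * a' ^ 3) +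
      X * (b ^ 2 * b' + 3 * b * b' ^ 2 + 3 * b' ^ 3) +
      X ^ 2 * (c ^ 2 * c' + 3 * c * c' ^ 2 + 3 * c' ^ 3) -
      X * (a' * b * c + a * b' * c + a * b * c' + 3 * (a' * b' * c + a' * b * c' + a * b' * c') +
        9 * a' * b' * c'), ?_⟩
    rw [graeffe, graeffe]
    ring
  · rw [he]
    exact aeval_graeffe hw _ _ _

theorem C_dvd_expand {q : ℤ} {f : ℤ[X]} (m : ℕ) (h : C q ∣ f) : C q ∣ expand ℤ m f := by
  obtain ⟨c, rfl⟩ := h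
  exact ⟨expand ℤ m c, by rw [map_mul, expand_C]⟩

/-- If `α β ≡ 73` modulo `Φ`, then an element congruent to a power of `α` modulo `3` can be
cancelled modulo `(9, Φ)`. -/
theorem exists_of_mul_congr {Φ α β H P K : ℤ[X]} {m : ℕ} (hαβ : Φ ∣ α * β - 73)
    (hH : (3 : ℤ[X]) ∣ H - α ^ m) (hK : (9 : ℤ[X]) ∣ K - H) (hP : Φ ∣ P * H - K) :
    ∃ δ : ℤ[X], Φ ∣ (P - 1) - 9 * δ := by
  let I : Ideal ℤ[X] := Ideal.span {9, Φ}
  have h9 : (9 : ℤ[X] ⧸ I) = 0 :=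
    map_ofNat (Ideal.Quotient.mk I) 9 ▸ Ideal.Quotient.eq_zero_iff_mem.2 (Ideal.subset_span (by simp))
  have hΦ : ∀ f, Φ ∣ f → Ideal.Quotient.mk I f = 0 := fun f hf =>
    Ideal.Quotient.eq_zero_iff_mem.2 (Ideal.mem_of_dvd I hf (Ideal.subset_span (by simp)))
  obtain ⟨c, hc⟩ := hH
  obtain ⟨d, hd⟩ := hK
  have e1 := hΦ _ hαβ
  have e2 := hΦ _ hP
  have e3 := congrArg (Ideal.Quotient.mk I) hc
  have e4 := congrArg (Ideal.Quotient.mk I) hd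
  simp only [map_sub, map_mul, map_pow, map_ofNat, sub_eq_zero] at e1 e2 e3 e4
  set π := Ideal.Quotient.mk I
  have e5 : (π α * π β) ^ m = 1 := by
    rw [e1, show (73 : ℤ[X] ⧸ I) = 1 + 9 * 8 by norm_num, h9, zero_mul, add_zero, one_pow]
  have e6 : π H * (π β ^ m * (1 - 3 * π c * π β ^ m)) = 1 := by
    rw [mul_pow] at e5
    have e7 : π H = π α ^ m + 3 * π c := by linear_combination e3
    rw [e7]
    linear_combination (1 - 3 * π c * π β ^ m) * e5 - (π c ^ 2 * (π β ^ m) ^ 2) * h9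
  have e8 : π P = 1 := by
    have : π P * π H = π H := by rw [e2]; linear_combination e4 + π d * h9
    calc π P = π P * (π H * (π β ^ m * (1 - 3 * π c * π β ^ m))) := by rw [e6, mul_one]
      _ = (π P * π H) * (π β ^ m * (1 - 3 * π c * π β ^ m)) := by ring
      _ = 1 := by rw [this, e6]
  have e9 : P - 1 ∈ I := by
    rw [← Ideal.Quotient.eq_zero_iff_mem, map_sub, map_one]
    exact sub_eq_zero.2 e8
  obtain ⟨u, v, huv⟩ := Ideal.mem_span_pair.1 e9
  exact ⟨u, v, by linear_combination -huv⟩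

theorem not_gen_73 [Fact (Nat.Prime 73)] {g : ZMod 73} {α : ℤ[X]} (hα : Gen 73 g α)
    (hg : IsPrimitiveRoot g (73 - 1)) : False := by
  have D : QuadraticData 72 [1, 11, 17, 19, 25, 35, 41, 43, 49, 59, 65, 67]
      [5, 7, 13, 23, 29, 31, 37, 47, 53, 55, 61, 71] := by
    constructor <;> decide
  have hz := Complex.isPrimitiveRoot_exp 72 (by norm_num)
  set z := Complex.exp (2 * Real.pi * Complex.I / (72 : ℕ))
  have hz2 : z ^ 36 = -1 := pow_half_eq_neg_one (m := 36) (by norm_num) hz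
  obtain ⟨U, W, h1, h4, h2, h3⟩ := hα.quadratic_sq hg rfl D hz (X ^ 9 + X ^ 27) 2
    (by
      intro b hb
      have hb' : (b * 9 ≡ 9 [MOD 72] ∧ b * 27 ≡ 27 [MOD 72]) ∨
        (b * 9 ≡ 27 [MOD 72] ∧ b * 27 ≡ 9 [MOD 72]) := by revert b; decide
      simp only [map_add, map_pow, aeval_X, ← pow_mul]
      rcases hb' with h | h
      · rw [pow_eq_of_modEq hz.pow_eq_one h.1, pow_eq_of_modEq hz.pow_eq_one h.2]
      · rw [pow_eq_of_modEq hz.pow_eq_one h.1, pow_eq_of_modEq hz.pow_eq_one h.2, add_comm])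
    (by
      intro b hb
      have hb' : (b * 9 ≡ 45 [MOD 72] ∧ b * 27 ≡ 63 [MOD 72]) ∨
        (b * 9 ≡ 63 [MOD 72] ∧ b * 27 ≡ 45 [MOD 72]) := by revert b; decide
      simp only [map_add, map_pow, aeval_X, ← pow_mul]
      rcases hb' with h | h
      · rw [pow_eq_of_modEq hz.pow_eq_one h.1, pow_eq_of_modEq hz.pow_eq_one h.2]
        linear_combination (z ^ 9 + z ^ 27) * hz2
      · rw [pow_eq_of_modEq hz.pow_eq_one h.1, pow_eq_of_modEq hz.pow_eq_one h.2]
        linear_combination (z ^ 9 + z ^ 27) * hz2)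
    (by
      simp only [map_add, map_pow, aeval_X]
      push_cast
      linear_combination (z ^ 18 + 2) * hz2)
  have hU : U = 2 ∨ U = -2 := by
    have k3 : ∀ U ∈ Finset.Icc (-17 : ℤ) 17, ∀ W ∈ Finset.Icc (-25 : ℤ) 25,
        W ^ 2 = 2 * (292 - U ^ 2) → U = 2 ∨ U = -2 := by decide +kernel
    push_cast at h1 h4
    exact k3 U (Finset.mem_Icc.2 ⟨by nlinarith, by nlinarith⟩) W
      (Finset.mem_Icc.2 ⟨by nlinarith, by nlinarith⟩) (h4.trans (by ring))
  obtain ⟨h, k, hh, hk, hh', hk'⟩ := exists_graeffe_pair α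
  set P := partialNorm [1, 11, 17, 19, 25, 35, 41, 43, 49, 59, 65, 67] α with hP
  set Q := partialNorm [5, 7, 13, 23, 29, 31, 37, 47, 53, 55, 61, 71] α with hQ
  have hw : (z ^ 24) ^ 2 + z ^ 24 + 1 = 0 := by
    have h5 : (z ^ 24 - 1) * ((z ^ 24) ^ 2 + z ^ 24 + 1) = 0 := by
      linear_combination hz.pow_eq_one
    refine (mul_eq_zero.1 h5).resolve_left fun h6 => ?_
    have h7 := hz.dvd_of_pow_eq_one 24 (sub_eq_zero.1 h6)
    norm_num at h7
  have hPH : cyclotomic 72 ℤ ∣ P * (expand ℤ 9 h * expand ℤ 27 h) -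
      expand ℤ 9 k * expand ℤ 27 k := by
    refine cyclotomic_dvd_of_aeval_eq_zero (by norm_num) hz ?_
    simp only [map_sub, map_mul, expand_aeval]
    have f1 := hk' (z ^ 3) _ hw
    have f2 := hk' (z ^ 9) _ hw
    have f3 := hh' z _ hw
    have f4 := hh' (z ^ 17) _ hw
    have f5 := hh' (z ^ 11) _ hw
    have f6 := hh' (z ^ 19) _ hw
    simp only [← pow_mul, ← pow_add, ← pow_succ'] at f1 f2 f3 f4 f5 f6
    norm_num at f1 f2 f3 f4 f5 f6
    rw [f1, f2, f3, f4, f5, f6, hP, aeval_partialNorm]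
    simp only [List.map_cons, List.map_nil, List.prod_cons, List.prod_nil, pow_one]
    ring
  have hΦ : ∃ β, cyclotomic 72 ℤ ∣ α * β - 73 := by
    refine ⟨partialNorm [11, 17, 19, 25, 35, 41, 43, 49, 59, 65, 67] α * Q, ?_⟩
    have : α * (partialNorm [11, 17, 19, 25, 35, 41, 43, 49, 59, 65, 67] α * Q) = P * Q := by
      rw [← mul_assoc, hP, partialNorm, partialNorm]
      simp only [List.map_cons, List.prod_cons, expand_one]
    rw [this]
    exact h3
  obtain ⟨β, hβ⟩ := hΦ
  have hexp : ∀ m, C (3 : ℤ) ∣ expand ℤ (3 ^ m) h - α ^ 3 ^ m := by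
    intro m
    induction m with
    | zero => simpa using hh
    | succ m ih =>
      have i1 := C_dvd_pow_sub_expand Nat.prime_three (expand ℤ (3 ^ m) h)
      rw [← expand_mul, ← pow_succ'] at i1
      have i2 : C (3 : ℤ) ∣ expand ℤ (3 ^ m) h ^ 3 - (α ^ 3 ^ m) ^ 3 := ih.trans (sub_dvd_pow_sub_pow _ _ 3)
      rw [← pow_mul, ← pow_succ] at i2
      have := dvd_sub i2 i1
      convert this using 1
      ring
  have hHH : (3 : ℤ[X]) ∣ expand ℤ 9 h * expand ℤ 27 h - α ^ 36 := by
    obtain ⟨u, hu⟩ := hexp 2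
    obtain ⟨v, hv⟩ := hexp 3
    norm_num at hu hv
    exact ⟨u * expand ℤ 27 h + α ^ 9 * v, by linear_combination hu * expand ℤ 27 h + α ^ 9 * hv⟩
  have hKK : (9 : ℤ[X]) ∣ expand ℤ 9 k * expand ℤ 27 k - expand ℤ 9 h * expand ℤ 27 h := by
    obtain ⟨u, hu⟩ := C_dvd_expand 9 hk
    obtain ⟨v, hv⟩ := C_dvd_expand 27 hk
    rw [map_sub] at hu hv
    have h9 : (C (9 : ℤ)) = 9 := rfl
    rw [h9] at hu hv
    exact ⟨u * expand ℤ 27 k + expand ℤ 9 h * v,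
      by linear_combination hu * expand ℤ 27 k + expand ℤ 9 h * hv⟩
  obtain ⟨δ, hδ⟩ := exists_of_mul_congr hβ hHH hKK hPH
  have hn : 0 < 72 := by norm_num
  have ht : Nat.totient 72 = 24 := by decide +kernel
  have n1 : cycNorm 72 (P - 1) = 9 ^ 24 * cycNorm 72 δ := by
    have h9 : (C (9 : ℤ)) = 9 := rfl
    rw [cycNorm_congr hn hδ, cycNorm_mul hn, ← h9, cycNorm_C hn, ht]
  have n2 : cycNorm 72 (Q - 1) = cycNorm 72 (P - 1) := by
    rw [← cycNorm_expand hn (m := 71) (by norm_num) (P - 1)]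
    refine cycNorm_congr hn (cyclotomic_dvd_of_aeval_eq_zero hn hz ?_)
    rw [map_sub, expand_aeval, map_sub, map_sub, aeval_pow_partialNorm α hz.pow_eq_one D.map_neg,
      map_one, map_one, sub_self]
  have n3 : cycNorm 72 (P - 1) * cycNorm 72 (Q - 1) = (74 - U) ^ 24 := by
    rw [← cycNorm_mul hn, ← ht, ← cycNorm_C hn]
    refine cycNorm_congr hn ?_
    have := dvd_sub h3 h2
    convert this using 1
    rw [C_sub, show ((73 : ℕ) : ℤ) = 74 - 1 by norm_num, C_sub]
    simp only [map_one]
    ring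
  rw [n2, n1] at n3
  have n4 : (9 : ℤ) ^ 48 ∣ (74 - U) ^ 24 := ⟨cycNorm 72 δ ^ 2, by rw [← n3]; ring⟩
  rcases hU with rfl | rfl <;> norm_num at n4

theorem mem_of_gen' {p : ℕ} [hp : Fact p.Prime] {g : ZMod p} {α : ℤ[X]} (h : Gen p g α)
    (hg : IsPrimitiveRoot g (p - 1)) :
    p ∈ ({2, 3, 5, 7, 11, 13, 17, 19, 23, 29, 31, 37, 41, 43, 61, 67, 71} : Finset ℕ) := by
  rcases mem_of_gen h hg with h1 | h1
  · exact h1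
  · simp only [Finset.mem_insert, Finset.mem_singleton] at h1
    rcases h1 with rfl | rfl | rfl | rfl
    · exact (not_gen_47 h hg).elim
    · exact (not_gen_53 h hg).elim
    · exact (not_gen_73 h hg).elim
    · exact (not_gen_79 h hg).elim

section Descent

variable {Ω : Type*} [Field Ω]

theorem exists_aeval_eq_of_mem_closure (F : Subfield Ω) {w : Ω} (hw : IsAlgebraic F w) {x : Ω}
    (hx : x ∈ Subfield.closure ((F : Set Ω) ∪ {w})) : ∃ P : F[X], aeval w P = x := by
  have h1 : Subfield.closure ((F : Set Ω) ∪ {w}) ≤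
      (IntermediateField.adjoin F {w}).toSubfield := by
    rw [Subfield.closure_le]
    rintro y (hy | hy)
    · exact (IntermediateField.adjoin F {w}).algebraMap_mem ⟨y, hy⟩
    · exact IntermediateField.subset_adjoin F {w} hy
  have h2 : x ∈ (IntermediateField.adjoin F {w}).toSubalgebra := h1 hx
  rw [IntermediateField.adjoin_simple_toSubalgebra_of_isAlgebraic hw] at h2
  exact Algebra.adjoin_mem_exists_aeval F w h2

theorem mem_of_fixed_of_sum_mem [CharZero Ω] (F : Subfield Ω) (ρ : Ω →+* Ω)
    (hF : ∀ x ∈ F, ρ x = x) {w : Ω} (hw : IsAlgebraic F w) {m : ℕ} (hm : m ≠ 0)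
    (hs : ∀ k, ∑ i ∈ Finset.range m, ρ^[i] (w ^ k) ∈ F) {x : Ω}
    (hx : x ∈ Subfield.closure ((F : Set Ω) ∪ {w})) (hρ : ρ x = x) : x ∈ F := by
  obtain ⟨P, rfl⟩ := exists_aeval_eq_of_mem_closure F hw hx
  have h1 : (m : Ω) * aeval w P = ∑ i ∈ Finset.range m, ρ^[i] (aeval w P) := by
    rw [Finset.sum_congr rfl fun i _ => Function.iterate_fixed hρ i]
    simp
  have h2 : ∀ i (c : F) , ρ^[i] (c : Ω) = c := fun i c => Function.iterate_fixed (hF c c.2) i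
  have h3 : ∀ i, ρ^[i] (aeval w P) = ∑ k ∈ Finset.range (P.natDegree + 1),
      (P.coeff k : Ω) * ρ^[i] (w ^ k) := by
    intro i
    rw [aeval_eq_sum_range, ← RingHom.coe_pow, map_sum]
    refine Finset.sum_congr rfl fun k _ => ?_
    rw [Subfield.smul_def, smul_eq_mul, map_mul, RingHom.coe_pow, h2]
  have h4 : (m : Ω) * aeval w P ∈ F := by
    rw [h1, Finset.sum_congr rfl fun i _ => h3 i, Finset.sum_comm]
    refine sum_mem fun k _ => ?_
    rw [← Finset.mul_sum]
    exact mul_mem (P.coeff k).2 (hs k)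
  have h5 : aeval w P = (m : Ω)⁻¹ * ((m : Ω) * aeval w P) := by
    rw [inv_mul_cancel_left₀ (Nat.cast_ne_zero.mpr hm)]
  rw [h5]
  exact mul_mem (inv_mem (natCast_mem F m)) h4

/-- The subfield of elements fixed by an endomorphism. -/
def fixSub (τ : Ω →+* Ω) : Subfield Ω := RingHom.eqLocusField τ (RingHom.id Ω)

theorem mem_fixSub {τ : Ω →+* Ω} {x : Ω} : x ∈ fixSub τ ↔ τ x = x := Iff.rfl

/-- A semilinear action: `τ` has order dividing `p - 1` and acts on a primitive `p`-th root of
unity `ζ` by raising to a power which is a primitive root `g`. -/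
structure SemiAct (p : ℕ) (g : ZMod p) (τ : Ω →+* Ω) (ζ : Ω) : Prop where
  prim : IsPrimitiveRoot ζ p
  root : IsPrimitiveRoot g (p - 1)
  map_zeta : τ ζ = ζ ^ g.val
  iter : ∀ x, τ^[p - 1] x = x

variable {p : ℕ} [hp : Fact p.Prime] {g : ZMod p} {τ : Ω →+* Ω} {ζ : Ω}

/-- The trace of the action of `τ`. -/
def tr (p : ℕ) (τ : Ω →+* Ω) (v : Ω) : Ω := ∑ i ∈ Finset.range (p - 1), τ^[i] v

theorem iterate_mem {E : Subfield Ω} (h : ∀ x ∈ E, τ x ∈ E) (i : ℕ) {x : Ω} (hx : x ∈ E) :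
    τ^[i] x ∈ E := by
  induction i with
  | zero => exact hx
  | succ k ih => rw [Function.iterate_succ_apply']; exact h _ ih

omit hp in
theorem tr_mem {E : Subfield Ω} (h : ∀ x ∈ E, τ x ∈ E) {x : Ω} (hx : x ∈ E) : tr p τ x ∈ E :=
  sum_mem fun i _ => iterate_mem h i hx

namespace SemiAct

theorem tr_mem_fixSub (h : SemiAct p g τ ζ) (v : Ω) : tr p τ v ∈ fixSub τ := by
  obtain ⟨m, hm⟩ : ∃ m, p - 1 = m + 1 := ⟨p - 1 - 1, by have := p_sub_one_pos (p := p); omega⟩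
  have := h.iter v
  rw [mem_fixSub, tr, map_sum]
  rw [hm] at this ⊢
  rw [Finset.sum_range_succ, Finset.sum_range_succ']
  simp only [← Function.iterate_succ_apply' τ]
  rw [this]
  rfl

theorem pow_eq (h : SemiAct p g τ ζ) {a b : ℕ} (hab : (a : ZMod p) = b) : ζ ^ a = ζ ^ b :=
  pow_eq_of_modEq h.prim.pow_eq_one ((ZMod.natCast_eq_natCast_iff _ _ _).mp hab)

theorem iterate_zeta (h : SemiAct p g τ ζ) (i : ℕ) : τ^[i] ζ = ζ ^ (g ^ i).val := by
  induction i with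
  | zero =>
    have : Fact (1 < p) := ⟨hp.out.one_lt⟩
    simp [ZMod.val_one]
  | succ k ih =>
    rw [Function.iterate_succ_apply', ih, map_pow, h.map_zeta, ← pow_mul]
    refine h.pow_eq ?_
    push_cast
    simp [pow_succ']

/-- Every element is an explicit combination of fixed elements. -/
theorem eq_sum_tr [CharZero Ω] (h : SemiAct p g τ ζ) (v : Ω) :
    v = (p : Ω)⁻¹ * ∑ k ∈ Finset.range p, (ζ ^ k)⁻¹ * tr p τ (ζ ^ k * v) := by
  have hp0 : (p : Ω) ≠ 0 := Nat.cast_ne_zero.mpr hp.out.ne_zero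
  have hζ0 : ζ ≠ 0 := h.prim.ne_zero hp.out.ne_zero
  rw [eq_inv_mul_iff_mul_eq₀ hp0]
  have h1 : ∀ k, (ζ ^ k)⁻¹ * tr p τ (ζ ^ k * v) =
      ∑ i ∈ Finset.range (p - 1), (ζ ^ (g ^ i).val / ζ) ^ k * τ^[i] v := by
    intro k
    rw [tr, Finset.mul_sum]
    refine Finset.sum_congr rfl fun i _ => ?_
    rw [iterate_map_mul, iterate_map_pow, h.iterate_zeta, div_pow]
    ring
  rw [Finset.sum_congr rfl fun k _ => h1 k, Finset.sum_comm]
  simp_rw [← Finset.sum_mul]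
  rw [Finset.sum_eq_single 0]
  · have : Fact (1 < p) := ⟨hp.out.one_lt⟩
    simp [ZMod.val_one, hζ0]
  · intro i hi hi0
    rw [Finset.mem_range] at hi
    have h2 : ζ ^ (g ^ i).val / ζ ≠ 1 := by
      intro h3
      rw [div_eq_one_iff_eq hζ0] at h3
      have h4 := h.prim.pow_inj (ZMod.val_lt _) hp.out.one_lt (h3.trans (pow_one ζ).symm)
      have h5 : g ^ i = 1 := by
        rw [← ZMod.natCast_zmod_val (g ^ i), h4, Nat.cast_one]
      exact h.root.pow_ne_one_of_pos_of_lt hi0 hi h5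
    have h3 : (ζ ^ (g ^ i).val / ζ) ^ p = 1 := by
      rw [div_pow, ← pow_mul, mul_comm, pow_mul, h.prim.pow_eq_one, one_pow, div_one]
    rw [geom_sum_eq h2, h3, sub_self, zero_div, zero_mul]
  · intro h0
    exact absurd (Finset.mem_range.mpr (p_sub_one_pos (p := p))) h0

theorem isAlgebraic_zeta (h : SemiAct p g τ ζ) (F : Subfield Ω) : IsAlgebraic F ζ :=
  (h.prim.isIntegral hp.out.pos).tower_top.isAlgebraic

theorem image_pow (hg : IsPrimitiveRoot g (p - 1)) :
    (Finset.range (p - 1)).image (fun i => g ^ i) = Finset.univ.erase 0 := by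
  refine Finset.eq_of_subset_of_card_le ?_ ?_
  · intro x hx
    obtain ⟨i, -, rfl⟩ := Finset.mem_image.mp hx
    exact Finset.mem_erase.mpr
      ⟨pow_ne_zero _ (hg.ne_zero (p_sub_one_pos (p := p)).ne'), Finset.mem_univ _⟩
  · rw [Finset.card_image_of_injOn, Finset.card_erase_of_mem (Finset.mem_univ _),
      Finset.card_univ, ZMod.card, Finset.card_range]
    intro i hi j hj hij
    exact hg.pow_inj (Finset.mem_range.mp hi) (Finset.mem_range.mp hj) hij

theorem sum_pow_primitive (hg : IsPrimitiveRoot g (p - 1)) {M : Type*} [AddCommMonoid M]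
    (f : ZMod p → M) : ∑ i ∈ Finset.range (p - 1), f (g ^ i) = ∑ a ∈ Finset.univ.erase 0, f a := by
  rw [← image_pow hg, Finset.sum_image]
  intro i hi j hj hij
  exact hg.pow_inj (Finset.mem_range.mp hi) (Finset.mem_range.mp hj) hij

theorem sum_val {M : Type*} [AddCommMonoid M] (f : ℕ → M) :
    ∑ a : ZMod p, f a.val = ∑ i ∈ Finset.range p, f i := by
  refine Finset.sum_bij (fun a _ => a.val) (fun a _ => Finset.mem_range.mpr (ZMod.val_lt a))
    (fun a _ b _ hab => ZMod.val_injective p hab) (fun b hb => ?_) (fun a _ => rfl)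
  exact ⟨(b : ZMod p), Finset.mem_univ _, ZMod.val_cast_of_lt (Finset.mem_range.mp hb)⟩

theorem tr_zeta_pow_mem (h : SemiAct p g τ ζ) (F : Subfield Ω) (k : ℕ) :
    tr p τ (ζ ^ k) ∈ F := by
  have h1 : ∀ i, τ^[i] (ζ ^ k) = (ζ ^ k) ^ (g ^ i).val := by
    intro i
    rw [iterate_map_pow, h.iterate_zeta, ← pow_mul, ← pow_mul, mul_comm]
  rw [tr, Finset.sum_congr rfl fun i _ => h1 i,
    sum_pow_primitive h.root fun a => (ζ ^ k) ^ a.val]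
  by_cases hk : ζ ^ k = 1
  · simp only [hk, one_pow]
    exact sum_mem fun _ _ => one_mem F
  · have h2 := Finset.add_sum_erase Finset.univ (fun a : ZMod p => (ζ ^ k) ^ a.val)
      (Finset.mem_univ 0)
    have h3 : (ζ ^ k) ^ p = 1 := by
      rw [← pow_mul, mul_comm, pow_mul, h.prim.pow_eq_one, one_pow]
    rw [sum_val fun i => (ζ ^ k) ^ i, geom_sum_eq hk, h3, sub_self, zero_div, ZMod.val_zero,
      pow_zero] at h2
    rw [eq_neg_of_add_eq_zero_right h2]
    exact neg_mem (one_mem F)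

/-- Galois descent along `ζ`: the fixed field of `F(ζ)` is `F`. -/
theorem closure_inf_fixSub [CharZero Ω] (h : SemiAct p g τ ζ) {F : Subfield Ω}
    (hF : F ≤ fixSub τ) : Subfield.closure ((F : Set Ω) ∪ {ζ}) ⊓ fixSub τ = F := by
  refine le_antisymm ?_ (le_inf (fun x hx => Subfield.subset_closure (Or.inl hx)) hF)
  rintro x ⟨hx1, hx2⟩
  exact mem_of_fixed_of_sum_mem F τ hF (h.isAlgebraic_zeta F) (p_sub_one_pos (p := p)).ne'
    (fun k => h.tr_zeta_pow_mem F k) hx1 hx2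

theorem eq_closure [CharZero Ω] (h : SemiAct p g τ ζ) {E : Subfield Ω} (hζ : ζ ∈ E)
    (hE : ∀ x ∈ E, τ x ∈ E) : E = Subfield.closure (((E ⊓ fixSub τ : Subfield Ω) : Set Ω) ∪ {ζ}) := by
  apply le_antisymm
  · intro v hv
    rw [h.eq_sum_tr v]
    have hz : ζ ∈ Subfield.closure (((E ⊓ fixSub τ : Subfield Ω) : Set Ω) ∪ {ζ}) :=
      Subfield.subset_closure (Or.inr rfl)
    refine mul_mem (inv_mem (natCast_mem _ _)) (sum_mem fun k _ => mul_mem (inv_mem (pow_mem hz k))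
      (Subfield.subset_closure (Or.inl ⟨tr_mem hE (mul_mem (pow_mem hζ k) hv), h.tr_mem_fixSub _⟩)))
  · rw [Subfield.closure_le]
    rintro y (hy | rfl)
    exacts [hy.1, hζ]

end SemiAct

end Descent

section AlgebraicClosureOfSet

variable (K : Type*) {Ω : Type*} [Field K] [Field Ω] [Algebra K Ω]

/-- The relative algebraic closure in `Ω` of the field generated by `S` over `K`. -/
def algCl (S : Set Ω) : Subfield Ω where
  __ := (Subalgebra.algebraicClosure (Algebra.adjoin K S) Ω).toSubring
  inv_mem' := fun _ hx => IsAlgebraic.inv hx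

variable {K}

theorem subset_algCl {S : Set Ω} {x : Ω} (hx : x ∈ S) : x ∈ algCl K S :=
  isAlgebraic_algebraMap (⟨x, Algebra.subset_adjoin hx⟩ : Algebra.adjoin K S)

theorem algebraMap_mem_algCl (S : Set Ω) (c : K) : algebraMap K Ω c ∈ algCl K S :=
  isAlgebraic_algebraMap (algebraMap K (Algebra.adjoin K S) c)

theorem mem_algCl_of_pow {S : Set Ω} {x : Ω} {m : ℕ} (hm : 0 < m) (hx : x ^ m ∈ algCl K S) :
    x ∈ algCl K S :=
  IsAlgebraic.of_pow hm hx

theorem algebraicIndependent_of_mem_algCl {ι ι' : Type*} [Fintype ι] [Fintype ι'] {v : ι → Ω}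
    (hv : AlgebraicIndependent K v) {u : ι' → Ω} (hu : ∀ i, v i ∈ algCl K (Set.range u))
    (hc : Fintype.card ι' ≤ Fintype.card ι) : AlgebraicIndependent K u := by
  have h1 : Set.range v ⊆ (AlgebraicIndependent.matroid K Ω).closure (Set.range u) := by
    rw [AlgebraicIndependent.matroid_closure_eq]
    rintro _ ⟨i, rfl⟩
    exact hu i
  have h2 : (AlgebraicIndependent.matroid K Ω).Indep (Set.range v) :=
    AlgebraicIndependent.matroid_indep_iff.mpr hv.coe_range
  have h3 := h2.eRk_eq_encard
  have h4 := (AlgebraicIndependent.matroid K Ω).eRk_mono h1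
  rw [h3, Matroid.eRk_closure_eq, ← Set.image_univ, hv.injective.encard_image, Set.encard_univ,
    ENat.card_eq_coe_fintype_card] at h4
  have h5 : (Set.range u).encard ≤ Fintype.card ι' := by
    rw [← Set.image_univ, ← ENat.card_eq_coe_fintype_card, ← Set.encard_univ]
    exact Set.encard_image_le _ _
  have h6 : (Fintype.card ι' : ℕ∞) ≤ Fintype.card ι := by exact_mod_cast hc
  have h7 : (Set.range u).encard = Fintype.card ι' :=
    le_antisymm h5 (h6.trans (h4.trans (Matroid.eRk_le_encard _ _)))
  have h8 : (AlgebraicIndependent.matroid K Ω).Indep (Set.range u) := by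
    rw [Matroid.indep_iff_eRk_eq_encard_of_finite (Set.finite_range u)]
    exact le_antisymm (Matroid.eRk_le_encard _ _) (h5.trans (h6.trans h4))
  have h9 : Function.Injective u := by
    refine Set.injOn_univ.mp (Set.finite_univ.injOn_of_encard_image_eq ?_)
    rw [Set.image_univ, h7, Set.encard_univ, ENat.card_eq_coe_fintype_card]
  exact (algebraicIndependent_subtype_range h9).mp (AlgebraicIndependent.matroid_indep_iff.mp h8)

end AlgebraicClosureOfSet

section Semilinear

variable {Ω : Type*} [Field Ω] {p : ℕ} [hp : Fact p.Prime] {g : ZMod p} {τ : Ω →+* Ω} {ζ : Ω}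

open Classical in
theorem SemiAct.nonempty_ringEquiv [CharZero Ω] (h : SemiAct p g τ ζ) {EN EJ : Subfield Ω}
    (hζ : ζ ∈ EN) (hN : ∀ x ∈ EN, τ x ∈ EN) {d : ℕ} {v : Fin d → Ω}
    (hv : AlgebraicIndependent EN v)
    (hJ : EJ = Subfield.closure ((EN : Set Ω) ∪ Set.range v))
    (hτv : ∀ i, ∃ j, ∃ c ∈ EN, τ (v i) = c * v j) :
    Nonempty (↥(EJ ⊓ fixSub τ) ≃+*
      FractionRing (MvPolynomial (Fin d) ↥(EN ⊓ fixSub τ : Subfield Ω))) := by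
  let V : Submodule EN Ω := Submodule.span EN (Set.range v)
  have hmul : ∀ c ∈ EN, ∀ x ∈ V, c * x ∈ V := fun c hc x hx => V.smul_mem ⟨c, hc⟩ hx
  have hτV : ∀ x ∈ V, τ x ∈ V := by
    intro x hx
    induction hx using Submodule.span_induction with
    | mem x hx =>
      obtain ⟨i, rfl⟩ := hx
      obtain ⟨j, c, hc, hj⟩ := hτv i
      rw [hj]
      exact hmul c hc _ (Submodule.subset_span ⟨j, rfl⟩)
    | zero => rw [map_zero]; exact V.zero_mem
    | add x y _ _ hx hy => rw [map_add]; exact V.add_mem hx hy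
    | smul a x _ hx =>
      rw [Subfield.smul_def, smul_eq_mul, map_mul]
      exact hmul _ (hN _ a.2) _ hx
  have htr : ∀ x ∈ V, tr p τ x ∈ V := by
    intro x hx
    have hi : ∀ i, τ^[i] x ∈ V := by
      intro i
      induction i with
      | zero => exact hx
      | succ k ih => rw [Function.iterate_succ_apply']; exact hτV _ ih
    exact V.sum_mem fun i _ => hi i
  let S : Set Ω := {x | x ∈ V ∧ τ x = x}
  have hS : Submodule.span EN S = V := by
    refine le_antisymm (Submodule.span_le.mpr fun x hx => hx.1) ?_
    intro x hx
    rw [h.eq_sum_tr x]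
    have hm : ∀ c ∈ EN, ∀ x ∈ Submodule.span EN S, c * x ∈ Submodule.span EN S :=
      fun c hc x hx => Submodule.smul_mem _ (⟨c, hc⟩ : EN) hx
    refine hm _ (inv_mem (natCast_mem _ _)) _ (Submodule.sum_mem _ fun k _ =>
      hm _ (inv_mem (pow_mem hζ k)) _ (Submodule.subset_span
        ⟨htr _ (hmul _ (pow_mem hζ k) _ hx), h.tr_mem_fixSub _⟩))
  obtain ⟨b, hbS, hb, hbi⟩ := exists_linearIndependent EN S
  rw [hS] at hb
  have hfin : Module.finrank EN V = d := by
    rw [finrank_span_eq_card hv.linearIndependent, Fintype.card_fin]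
  have : Module.Finite EN V := Module.Finite.span_of_finite EN (Set.finite_range v)
  have hbfin : b.Finite := by
    have h1 : ∀ x : b, (x : Ω) ∈ V := fun x => (hbS x.2).1
    have h2 : LinearIndependent EN (fun x : b => (⟨x, h1 x⟩ : V)) :=
      LinearIndependent.of_comp V.subtype hbi
    have := h2.finite
    exact b.toFinite
  have := hbfin.fintype
  have hcard : Fintype.card b = d := by
    rw [← hfin, ← hb, ← finrank_span_eq_card hbi, Subtype.range_coe]
  let e : Fin d ≃ b := (Fintype.equivFinOfCardEq hcard).symm
  let u : Fin d → Ω := fun i => e i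
  have hur : Set.range u = b := by
    ext x
    constructor
    · rintro ⟨i, rfl⟩
      exact (e i).2
    · intro hx
      exact ⟨e.symm ⟨x, hx⟩, by simp [u]⟩
  have hvu : ∀ (E : Subfield Ω), EN ≤ E → (∀ i, u i ∈ E) → ∀ i, v i ∈ E := by
    intro E hE hu i
    have h1 : v i ∈ Submodule.span EN b := hb ▸ Submodule.subset_span ⟨i, rfl⟩
    generalize v i = y at h1
    induction h1 using Submodule.span_induction with
    | mem x hx => rw [← hur] at hx; obtain ⟨i, rfl⟩ := hx; exact hu i
    | zero => exact zero_mem _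
    | add x y _ _ hx hy => exact add_mem hx hy
    | smul a x _ hx => exact mul_mem (hE a.2) hx
  have huv : ∀ (E : Subfield Ω), EN ≤ E → (∀ i, v i ∈ E) → ∀ i, u i ∈ E := by
    intro E hE hu i
    have h1 : u i ∈ V := (hbS (e i).2).1
    generalize u i = y at h1
    induction h1 using Submodule.span_induction with
    | mem x hx => obtain ⟨i, rfl⟩ := hx; exact hu i
    | zero => exact zero_mem _
    | add x y _ _ hx hy => exact add_mem hx hy
    | smul a x _ hx => exact mul_mem (hE a.2) hx
  have hui : AlgebraicIndependent EN u :=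
    algebraicIndependent_of_mem_algCl hv (hvu _ (fun x hx => algebraMap_mem_algCl _ (⟨x, hx⟩ : EN))
      fun i => subset_algCl ⟨i, rfl⟩) le_rfl
  let kN : Subfield Ω := EN ⊓ fixSub τ
  let : Algebra kN EN := (Subfield.inclusion (inf_le_left : kN ≤ EN)).toAlgebra
  have : IsScalarTower kN EN Ω := IsScalarTower.of_algebraMap_eq (congrFun rfl)
  have huk : AlgebraicIndependent kN u := hui.restrictScalars (RingHom.injective _)
  have hfix : (IntermediateField.adjoin kN (Set.range u)).toSubfield ≤ fixSub τ := by
    change Subfield.closure _ ≤ _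
    rw [Subfield.closure_le]
    rintro x (⟨y, rfl⟩ | ⟨i, rfl⟩)
    · exact y.2.2
    · exact (hbS (e i).2).2
  have hEJ : EJ ⊓ fixSub τ = (IntermediateField.adjoin kN (Set.range u)).toSubfield := by
    rw [← h.closure_inf_fixSub hfix]
    congr 1
    have hNk := h.eq_closure hζ hN
    apply le_antisymm
    · rw [hJ, Subfield.closure_le]
      have h1 : EN ≤ Subfield.closure
          (((IntermediateField.adjoin kN (Set.range u)).toSubfield : Set Ω) ∪ {ζ}) := by
        conv_lhs => rw [hNk]
        refine Subfield.closure_mono (Set.union_subset_union_left _ fun x hx => ?_)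
        exact (IntermediateField.adjoin kN (Set.range u)).algebraMap_mem ⟨x, hx⟩
      rintro x (hx | ⟨i, rfl⟩)
      · exact h1 hx
      · exact hvu _ h1 (fun i => Subfield.subset_closure
          (Or.inl (IntermediateField.subset_adjoin _ _ ⟨i, rfl⟩))) i
    · have h1 : EN ≤ EJ := fun x hx => hJ ▸ Subfield.subset_closure (Or.inl hx)
      rw [Subfield.closure_le]
      rintro x (hx | rfl)
      · revert x
        change Subfield.closure _ ≤ _
        rw [Subfield.closure_le]
        rintro x (⟨y, rfl⟩ | ⟨i, rfl⟩)
        · exact h1 y.2.1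
        · exact huv _ h1 (fun i => hJ ▸ Subfield.subset_closure (Or.inr ⟨i, rfl⟩)) i
      · exact h1 hζ
  rw [hEJ]
  exact ⟨huk.aevalEquivField.symm.toRingEquiv⟩

end Semilinear

section Action

variable {Ω : Type*} [Field Ω]

/-- The `ℤ`-linear endomorphism of the additively written group `Ωˣ` induced by `τ`. -/
def unitsEnd (τ : Ω →+* Ω) : Module.End ℤ (Additive Ωˣ) :=
  (MonoidHom.toAdditive (Units.map (τ : Ω →* Ω))).toIntLinearMap

/-- The exponential action of `ℤ[X]` on `Ωˣ` in which `X` acts as `τ`. -/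
noncomputable def act (τ : Ω →+* Ω) (f : ℤ[X]) (u : Ωˣ) : Ωˣ :=
  (aeval (unitsEnd τ) f (Additive.ofMul u)).toMul

variable (τ : Ω →+* Ω) (f f' : ℤ[X]) (u v : Ωˣ)

theorem act_add : act τ (f + f') u = act τ f u * act τ f' u := by simp [act]

theorem act_neg : act τ (-f) u = (act τ f u)⁻¹ := by simp [act]

theorem act_sub : act τ (f - f') u = act τ f u / act τ f' u := by simp [act]

theorem act_zero : act τ 0 u = 1 := by simp [act]

theorem act_one : act τ 1 u = u := by simp [act]

theorem act_mul : act τ (f * f') u = act τ f (act τ f' u) := by simp [act]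

theorem act_X : (act τ X u : Ω) = τ u := by simp [act, unitsEnd]

theorem act_C (a : ℤ) : act τ (C a) u = u ^ a := by simp [act]

theorem act_mem {E : Subfield Ω} (hE : ∀ x ∈ E, τ x ∈ E) {u : Ωˣ} (hu : (u : Ω) ∈ E) :
    (act τ f u : Ω) ∈ E := by
  induction f using Polynomial.induction_on' generalizing u with
  | add f f' hf hf' => rw [act_add, Units.val_mul]; exact mul_mem (hf hu) (hf' hu)
  | monomial k a =>
    rw [← C_mul_X_pow_eq_monomial, act_mul, act_C, Units.val_zpow_eq_zpow_val]
    refine zpow_mem ?_ a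
    induction k with
    | zero => rwa [pow_zero, act_one]
    | succ k ih => rw [pow_succ', act_mul, act_X]; exact hE _ ih

theorem act_X_pow (k : ℕ) : (act τ (X ^ k) u : Ω) = τ^[k] u := by
  induction k with
  | zero => rw [pow_zero, act_one]; rfl
  | succ k ih => rw [pow_succ', act_mul, act_X, ih, Function.iterate_succ_apply']

theorem map_act : τ (act τ f u : Ω) = act τ (X * f) u := by
  rw [act_mul, act_X]

theorem act_congr_of_dvd {h : ℤ[X]} (hu : act τ h u = 1) (hd : h ∣ f - f') :
    act τ f u = act τ f' u := by
  obtain ⟨c, hc⟩ := hd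
  have h1 : act τ (f - f') u = 1 := by
    rw [hc, mul_comm, act_mul, hu]
    simp [act]
  rwa [act_sub, div_eq_one] at h1

end Action

/-- The rational function field in the variables `y_j` over `L`, together with the diagonal
action of `σ` and the semilinear action of `τ`. -/
structure Model (p : ℕ) (g : ZMod p) (L : Type*) {Ω : Type*} [Field L] [Field Ω] [Algebra L Ω]
    (τ σ : Ω →+* Ω) (ζ : Ω) (y : ZMod p → Ω) : Prop where
  semi : SemiAct p g τ ζ
  exists_zeta : ∃ c, algebraMap L Ω c = ζ
  ind : AlgebraicIndependent L y
  algebraMap_mem : ∀ E : Subfield Ω, ζ ∈ E → ∀ c, algebraMap L Ω c ∈ E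
  mem : ∀ E : Subfield Ω, ζ ∈ E → (∀ j, y j ∈ E) → ∀ x, x ∈ E
  map_y : ∀ j, τ (y j) = y (g * j)
  sigma_zeta : σ ζ = ζ
  sigma_y : ∀ j, σ (y j) = ζ ^ j.val * y j

section Construction

theorem hom_ext_of_mem {Ω Ω' : Type*} [Field Ω] [Field Ω'] {ζ : Ω} {ι : Type*} {y : ι → Ω}
    (hm : ∀ E : Subfield Ω, ζ ∈ E → (∀ j, y j ∈ E) → ∀ x, x ∈ E) {φ ψ : Ω →+* Ω'}
    (h1 : φ ζ = ψ ζ) (h2 : ∀ j, φ (y j) = ψ (y j)) (x : Ω) : φ x = ψ x :=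
  hm (RingHom.eqLocusField φ ψ) h1 h2 x

variable {p : ℕ} [hp : Fact p.Prime]

theorem exists_model (p : ℕ) [hp : Fact p.Prime] {g : ZMod p} (hg : IsPrimitiveRoot g (p - 1)) :
    ∃ (L Ω : Type) (_ : Field L) (_ : Field Ω) (_ : Algebra L Ω) (_ : CharZero Ω)
      (τ σ : Ω →+* Ω) (ζ : Ω) (y : ZMod p → Ω), Model p g L τ σ ζ y := by
  classical
  have hp0 : p ≠ 0 := hp.out.ne_zero
  have : NeZero p := ⟨hp0⟩
  have : NeZero ((p : ℕ) : ℚ) := ⟨Nat.cast_ne_zero.mpr hp0⟩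
  let L := CyclotomicField p ℚ
  have : IsCyclotomicExtension {p} ℚ L := CyclotomicField.isCyclotomicExtension p ℚ
  let z : L := IsCyclotomicExtension.zeta p ℚ L
  have hz : IsPrimitiveRoot z p := IsCyclotomicExtension.zeta_spec p ℚ L
  have hadj : ∀ E : Subfield L, z ∈ E → ∀ c, c ∈ E := by
    intro E hE c
    have h1 := IsCyclotomicExtension.adjoin_primitive_root_eq_top (A := ℚ) (B := L) hz
    have h2 : c ∈ Algebra.adjoin ℚ {z} := h1 ▸ Algebra.mem_top
    induction h2 using Algebra.adjoin_induction with
    | mem x hx => rwa [Set.mem_singleton_iff.mp hx]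
    | algebraMap r => exact SubfieldClass.ratCast_mem E r
    | add x y _ _ hx hy => exact add_mem hx hy
    | mul x y _ _ hx hy => exact mul_mem hx hy
  have hg0 : g ≠ 0 := hg.ne_zero (p_sub_one_pos (p := p)).ne'
  have hcop : g.val.Coprime p := by
    rw [Nat.coprime_comm, hp.out.coprime_iff_not_dvd]
    intro h
    exact hg0 (by rw [← ZMod.natCast_zmod_val g, (ZMod.natCast_eq_zero_iff _ _).mpr h])
  have hz' : IsPrimitiveRoot (z ^ g.val) p := hz.pow_of_coprime _ hcop
  let τ₀ : L →+* L := ((IsCyclotomicExtension.fromZetaAut hz'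
    (cyclotomic.irreducible_rat hp.out.pos)).toRingEquiv : L →+* L)
  have hτ₀ : τ₀ z = z ^ g.val := IsCyclotomicExtension.fromZetaAut_spec hz'
    (cyclotomic.irreducible_rat hp.out.pos)
  let Ω := FractionRing (MvPolynomial (ZMod p) L)
  let ι := algebraMap (MvPolynomial (ZMod p) L) Ω
  let y : ZMod p → Ω := fun j => ι (MvPolynomial.X j)
  have hind : AlgebraicIndependent L y := by
    have h1 := (MvPolynomial.algebraicIndependent_X (ZMod p) L).map' (f := IsScalarTower.toAlgHom L
      (MvPolynomial (ZMod p) L) Ω) (IsFractionRing.injective _ _)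
    exact h1
  let ζ : Ω := algebraMap L Ω z
  have hζ : IsPrimitiveRoot ζ p := hz.map_of_injective (algebraMap L Ω).injective
  have hLE : ∀ E : Subfield Ω, ζ ∈ E → ∀ c, algebraMap L Ω c ∈ E := fun E hE c =>
    hadj (E.comap (algebraMap L Ω)) hE c
  have hmem : ∀ E : Subfield Ω, ζ ∈ E → (∀ j, y j ∈ E) → ∀ x, x ∈ E := by
    intro E hE hy x
    have h1 : ∀ q : MvPolynomial (ZMod p) L, ι q ∈ E := by
      intro q
      induction q using MvPolynomial.induction_on with
      | C a => exact hLE E hE a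
      | add a b ha hb => rw [map_add]; exact add_mem ha hb
      | mul_X a j ha => rw [map_mul]; exact mul_mem ha (hy j)
    obtain ⟨a, b, -, rfl⟩ := IsFractionRing.div_surjective (A := MvPolynomial (ZMod p) L) x
    exact div_mem (h1 a) (h1 b)
  let τ₁ : MvPolynomial (ZMod p) L →+* Ω :=
    (MvPolynomial.aeval fun j => y (g * j)).toRingHom.comp (MvPolynomial.map τ₀)
  have hτ₁ : Function.Injective τ₁ := by
    have h1 : Function.Injective (MvPolynomial.aeval (R := L) fun j => y (g * j)) :=
      hind.comp (fun j => g * j) (mul_right_injective₀ hg0)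
    exact h1.comp (MvPolynomial.map_injective τ₀ τ₀.injective)
  let τ : Ω →+* Ω := IsFractionRing.lift hτ₁
  have hτL : ∀ c, τ (algebraMap L Ω c) = algebraMap L Ω (τ₀ c) := by
    intro c
    have h1 : algebraMap L Ω c = ι (MvPolynomial.C c) := rfl
    rw [h1, IsFractionRing.lift_algebraMap]
    simp [τ₁]
  have hτy : ∀ j, τ (y j) = y (g * j) := by
    intro j
    change IsFractionRing.lift hτ₁ (ι _) = _
    rw [IsFractionRing.lift_algebraMap]
    simp [τ₁]
  let σ₁ : MvPolynomial (ZMod p) L →+* Ω :=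
    (MvPolynomial.aeval fun j => ζ ^ j.val * y j).toRingHom
  have hσ₁ : Function.Injective σ₁ := by
    have h1 : AlgebraicIndependent L fun j => ζ ^ j.val * y j := by
      refine algebraicIndependent_of_mem_algCl hind (fun j => ?_) le_rfl
      have h2 : ζ ^ j.val ≠ 0 := pow_ne_zero _ (hζ.ne_zero hp0)
      rw [← inv_mul_cancel_left₀ h2 (y j)]
      exact mul_mem (inv_mem (pow_mem (algebraMap_mem_algCl _ _) _)) (subset_algCl ⟨j, rfl⟩)
    exact h1
  let σ : Ω →+* Ω := IsFractionRing.lift hσ₁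
  have hσL : ∀ c, σ (algebraMap L Ω c) = algebraMap L Ω c := by
    intro c
    have h1 : algebraMap L Ω c = ι (MvPolynomial.C c) := rfl
    rw [h1, IsFractionRing.lift_algebraMap]
    simp [σ₁, ι, h1]
  have hσy : ∀ j, σ (y j) = ζ ^ j.val * y j := by
    intro j
    change IsFractionRing.lift hσ₁ (ι _) = _
    rw [IsFractionRing.lift_algebraMap]
    simp [σ₁]
  have hτζ : τ ζ = ζ ^ g.val := by rw [hτL, hτ₀, map_pow]
  refine ⟨L, Ω, inferInstance, inferInstance, inferInstance, charZero_of_injective_algebraMap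
    (algebraMap L Ω).injective, τ, σ, ζ, y, ?_⟩
  refine ⟨⟨hζ, hg, hτζ, ?_⟩, ⟨z, rfl⟩, hind, hLE, hmem, hτy, hσL z, hσy⟩
  have hit : ∀ i, τ^[i] ζ = ζ ^ (g ^ i).val := by
    intro i
    induction i with
    | zero =>
      have : Fact (1 < p) := ⟨hp.out.one_lt⟩
      simp [ZMod.val_one]
    | succ k ih =>
      rw [Function.iterate_succ_apply', ih, map_pow, hτζ, ← pow_mul]
      refine pow_eq_of_modEq hζ.pow_eq_one ((ZMod.natCast_eq_natCast_iff _ _ _).mp ?_)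
      push_cast
      simp [pow_succ']
  have hity : ∀ i j, τ^[i] (y j) = y (g ^ i * j) := by
    intro i j
    induction i with
    | zero => simp
    | succ k ih => rw [Function.iterate_succ_apply', ih, hτy, pow_succ', mul_assoc]
  intro x
  rw [← RingHom.coe_pow]
  refine hom_ext_of_mem hmem (φ := τ ^ (p - 1)) (ψ := RingHom.id Ω) ?_ (fun j => ?_) x
  · rw [RingHom.coe_pow, hit, hg.pow_eq_one]
    have : Fact (1 < p) := ⟨hp.out.one_lt⟩
    simp [ZMod.val_one]
  · rw [RingHom.coe_pow, hity, hg.pow_eq_one, one_mul]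
    rfl

end Construction

namespace Model

variable {p : ℕ} [hp : Fact p.Prime] {g : ZMod p} {L Ω : Type*} [Field L] [Field Ω]
  [Algebra L Ω] {τ σ : Ω →+* Ω} {ζ : Ω} {y : ZMod p → Ω}

/-- The permuted variables `x_i`, as discrete Fourier transforms of the diagonal ones. -/
def dft (ζ : Ω) (y : ZMod p → Ω) (i : ℕ) : Ω := ∑ j, ζ ^ (i * j.val) * y j

theorem sigma_dft (M : Model p g L τ σ ζ y) (i : ℕ) :
    σ (dft ζ y i) = dft ζ y (i + 1) := by
  rw [dft, dft, map_sum]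
  refine Finset.sum_congr rfl fun j _ => ?_
  rw [map_mul, map_pow, M.sigma_zeta, M.sigma_y]
  ring

theorem dft_congr (M : Model p g L τ σ ζ y) {i k : ℕ} (h : (i : ZMod p) = k) :
    dft ζ y i = dft ζ y k := by
  refine Finset.sum_congr rfl fun j _ => ?_
  rw [M.semi.pow_eq (a := i * j.val) (b := k * j.val) (by push_cast; rw [h])]

theorem g_ne_zero (M : Model p g L τ σ ζ y) : g ≠ 0 :=
  M.semi.root.ne_zero (p_sub_one_pos (p := p)).ne'

theorem tau_dft (M : Model p g L τ σ ζ y) (i : ℕ) : τ (dft ζ y i) = dft ζ y i := by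
  rw [dft, map_sum]
  refine Fintype.sum_bijective (fun j => g * j) (mulLeft_bijective₀ g M.g_ne_zero) _ _ fun j => ?_
  rw [map_mul, map_pow, M.semi.map_zeta, M.map_y, ← pow_mul,
    M.semi.pow_eq (a := g.val * (i * j.val)) (b := i * (g * j).val)]
  push_cast
  simp
  ring

theorem y_mem (M : Model p g L τ σ ζ y) [CharZero Ω] {E : Subfield Ω} (hζ : ζ ∈ E)
    (hx : ∀ i < p, dft ζ y i ∈ E) (j : ZMod p) : y j ∈ E := by
  have hp0 : (p : Ω) ≠ 0 := Nat.cast_ne_zero.mpr hp.out.ne_zero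
  have hζ0 : ζ ≠ 0 := M.semi.prim.ne_zero hp.out.ne_zero
  have h1 : ∑ i ∈ Finset.range p, (ζ ^ (i * j.val))⁻¹ * dft ζ y i = p * y j := by
    have h2 : ∀ i, (ζ ^ (i * j.val))⁻¹ * dft ζ y i =
        ∑ k : ZMod p, (ζ ^ k.val / ζ ^ j.val) ^ i * y k := by
      intro i
      rw [dft, Finset.mul_sum]
      refine Finset.sum_congr rfl fun k _ => ?_
      rw [div_pow, ← pow_mul, ← pow_mul]
      ring
    rw [Finset.sum_congr rfl fun i _ => h2 i, Finset.sum_comm]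
    simp_rw [← Finset.sum_mul]
    rw [Finset.sum_eq_single j]
    · simp [hζ0]
    · intro k _ hk
      have h3 : ζ ^ k.val / ζ ^ j.val ≠ 1 := by
        intro h4
        rw [div_eq_one_iff_eq (pow_ne_zero _ hζ0)] at h4
        exact hk (ZMod.val_injective p
          (M.semi.prim.pow_inj (ZMod.val_lt _) (ZMod.val_lt _) h4))
      have h4 : (ζ ^ k.val / ζ ^ j.val) ^ p = 1 := by
        rw [div_pow, ← pow_mul, ← pow_mul, mul_comm, pow_mul, mul_comm, pow_mul,
          M.semi.prim.pow_eq_one, one_pow, one_pow, div_one]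
      rw [geom_sum_eq h3, h4, sub_self, zero_div, zero_mul]
    · intro h0
      exact absurd (Finset.mem_univ j) h0
  rw [← inv_mul_cancel_left₀ hp0 (y j), ← h1]
  exact mul_mem (inv_mem (natCast_mem _ _)) (sum_mem fun i hi =>
    mul_mem (inv_mem (pow_mem hζ _)) (hx i (Finset.mem_range.mp hi)))

omit hp in
theorem zeta_mem_algCl (M : Model p g L τ σ ζ y) (S : Set Ω) : ζ ∈ algCl L S := by
  obtain ⟨c, rfl⟩ := M.exists_zeta
  exact algebraMap_mem_algCl S c

theorem algebraicIndependent_dft (M : Model p g L τ σ ζ y) [CharZero Ω] :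
    AlgebraicIndependent L fun i : Fin p => dft ζ y i :=
  algebraicIndependent_of_mem_algCl M.ind
    (M.y_mem (M.zeta_mem_algCl _) fun i hi => subset_algCl ⟨⟨i, hi⟩, rfl⟩)
    (by rw [ZMod.card, Fintype.card_fin])

theorem exists_embedding (M : Model p g L τ σ ζ y) [CharZero Ω] :
    ∃ φ : FractionRing (MvPolynomial (Fin p) ℚ) →+* Ω, φ.fieldRange = fixSub τ ∧
      ∀ i : Fin p, φ (algebraMap (MvPolynomial (Fin p) ℚ) _ (MvPolynomial.X i)) = dft ζ y i := by
  have : CharZero L := (algebraMap L Ω).charZero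
  have h1 : AlgebraicIndependent ℚ fun i : Fin p => dft ζ y i :=
    M.algebraicIndependent_dft.restrictScalars (algebraMap ℚ L).injective
  let φ₁ : MvPolynomial (Fin p) ℚ →+* Ω :=
    (MvPolynomial.aeval fun i : Fin p => dft ζ y i).toRingHom
  have h2 : Function.Injective φ₁ := h1
  let φ : FractionRing (MvPolynomial (Fin p) ℚ) →+* Ω := IsFractionRing.lift h2
  have hφ : ∀ q, φ (algebraMap _ _ q) = φ₁ q := IsFractionRing.lift_algebraMap h2
  have hφX : ∀ i : Fin p,
      φ (algebraMap (MvPolynomial (Fin p) ℚ) _ (MvPolynomial.X i)) = dft ζ y i := by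
    intro i
    rw [hφ]
    simp [φ₁]
  have hle : φ.fieldRange ≤ fixSub τ := by
    rintro _ ⟨x, rfl⟩
    obtain ⟨a, b, -, rfl⟩ := IsFractionRing.div_surjective (A := MvPolynomial (Fin p) ℚ) x
    have h3 : ∀ q : MvPolynomial (Fin p) ℚ, φ (algebraMap _ _ q) ∈ fixSub τ := by
      intro q
      rw [hφ]
      induction q using MvPolynomial.induction_on with
      | C a => simp [φ₁]
      | add a b ha hb => rw [map_add]; exact add_mem ha hb
      | mul_X a j ha =>
        rw [map_mul]
        refine mul_mem ha ?_
        rw [← hφ, hφX]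
        exact M.tau_dft j
    rw [map_div₀]
    exact div_mem (h3 a) (h3 b)
  refine ⟨φ, ?_, hφX⟩
  have h4 := M.semi.closure_inf_fixSub hle
  rw [← h4, inf_eq_right]
  intro x _
  have hζ : ζ ∈ Subfield.closure ((φ.fieldRange : Set Ω) ∪ {ζ}) :=
    Subfield.subset_closure (Or.inr rfl)
  refine M.mem _ hζ (M.y_mem hζ fun i hi => Subfield.subset_closure (Or.inl ?_)) x
  exact ⟨_, hφX ⟨i, hi⟩⟩

theorem nonempty_fixSub_equiv (M : Model p g L τ σ ζ y) [CharZero Ω] :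
    Nonempty (fixSub τ ≃+* FractionRing (MvPolynomial (Fin p) ℚ)) := by
  obtain ⟨φ, hφ, -⟩ := M.exists_embedding
  rw [← hφ]
  exact ⟨φ.rangeRestrictFieldEquiv.symm⟩

theorem nonempty_fixedField_equiv (M : Model p g L τ σ ζ y) [CharZero Ω]
    (σ' : FractionRing (MvPolynomial (Fin p) ℚ) ≃ₐ[ℚ] FractionRing (MvPolynomial (Fin p) ℚ))
    (hσ' : ∀ i : Fin p,
      σ' (algebraMap (MvPolynomial (Fin p) ℚ) (FractionRing (MvPolynomial (Fin p) ℚ))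
          (MvPolynomial.X i)) =
        algebraMap (MvPolynomial (Fin p) ℚ) (FractionRing (MvPolynomial (Fin p) ℚ))
          (MvPolynomial.X (finRotate p i))) :
    Nonempty (IntermediateField.fixedField (Subgroup.zpowers σ') ≃+*
      ↥(fixSub σ ⊓ fixSub τ)) := by
  obtain ⟨φ, hφ, hφX⟩ := M.exists_embedding
  have hcomm : ∀ x, σ (φ x) = φ (σ' x) := by
    intro x
    have h1 : ∀ q : MvPolynomial (Fin p) ℚ,
        σ (φ (algebraMap _ _ q)) = φ (σ' (algebraMap _ _ q)) := by
      intro q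
      induction q using MvPolynomial.induction_on with
      | C a =>
        have h2 : algebraMap (MvPolynomial (Fin p) ℚ) (FractionRing (MvPolynomial (Fin p) ℚ))
          (MvPolynomial.C a) = algebraMap ℚ _ a :=
          (IsScalarTower.algebraMap_apply ℚ (MvPolynomial (Fin p) ℚ) _ a).symm
        rw [h2, AlgEquiv.commutes]
        simp
      | add a b ha hb => simp only [map_add, ha, hb]
      | mul_X a j ha =>
        simp only [map_mul, ha]
        congr 1
        rw [hφX, hσ', hφX, M.sigma_dft]
        apply M.dft_congr
        obtain ⟨m, rfl⟩ : ∃ m, p = m + 1 := ⟨p - 1, by have := hp.out.pos; omega⟩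
        rw [coe_finRotate]
        split_ifs with h
        · rw [h, Fin.val_last]
          exact_mod_cast CharP.cast_eq_zero (ZMod (m + 1)) (m + 1)
        · rfl
    obtain ⟨a, b, -, rfl⟩ := IsFractionRing.div_surjective (A := MvPolynomial (Fin p) ℚ) x
    simp only [map_div₀, h1]
  have hmem : ∀ x, x ∈ IntermediateField.fixedField (Subgroup.zpowers σ') ↔ σ' x = x := by
    intro x
    rw [IntermediateField.mem_fixedField_iff]
    constructor
    · intro h
      exact h σ' (Subgroup.mem_zpowers σ')
    · intro h f hf
      have h1 : σ' ∈ MulAction.stabilizer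
        (FractionRing (MvPolynomial (Fin p) ℚ) ≃ₐ[ℚ] FractionRing (MvPolynomial (Fin p) ℚ)) x := h
      exact (Subgroup.zpowers_le.mpr h1) hf
  let K := IntermediateField.fixedField (Subgroup.zpowers σ')
  let ψ : K →+* ↥(fixSub σ ⊓ fixSub τ) := (φ.comp (algebraMap K _)).codRestrict _ (by
    intro x
    refine ⟨?_, hφ ▸ ⟨_, rfl⟩⟩
    change σ (φ x) = φ x
    rw [hcomm, (hmem x).mp x.2])
  refine ⟨RingEquiv.ofBijective ψ ⟨ψ.injective, ?_⟩⟩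
  rintro ⟨x, hx1, hx2⟩
  rw [SetLike.mem_coe, ← hφ] at hx2
  obtain ⟨z, rfl⟩ := hx2
  have hz : σ' z = z := φ.injective (by rw [← hcomm]; exact hx1)
  exact ⟨⟨z, (hmem z).mpr hz⟩, rfl⟩

end Model

/-- The subfield generated by `ζ`, the invariant variable and the monomials with exponents in the
ideal `J`. -/
noncomputable def fld {Ω : Type*} [Field Ω] (τ : Ω →+* Ω) (ζ y₀ : Ω) (u : Ωˣ) (J : Ideal ℤ[X]) :
    Subfield Ω :=
  Subfield.closure ({ζ, y₀} ∪ (fun f => (act τ f u : Ω)) '' J)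

namespace Model

variable {p : ℕ} [hp : Fact p.Prime] {g : ZMod p} {L Ω : Type*} [Field L] [Field Ω]
  [Algebra L Ω] {τ σ : Ω →+* Ω} {ζ : Ω} {y : ZMod p → Ω} {u : Ωˣ} {J J' : Ideal ℤ[X]}

omit hp in
theorem y_ne_zero (M : Model p g L τ σ ζ y) (j : ZMod p) : y j ≠ 0 := M.ind.ne_zero j

theorem act_X_pow_eq (M : Model p g L τ σ ζ y) (hu : (u : Ω) = y 1) (i : ℕ) :
    (act τ (X ^ i) u : Ω) = y (g ^ i) := by
  induction i with
  | zero => rw [pow_zero, act_one, hu, pow_zero]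
  | succ k ih => rw [pow_succ', act_mul, act_X, ih, M.map_y, pow_succ']

theorem act_X_pow_sub_one (M : Model p g L τ σ ζ y) (hu : (u : Ω) = y 1) :
    act τ (X ^ (p - 1) - 1) u = 1 := by
  rw [act_sub, div_eq_one, act_one]
  ext
  rw [M.act_X_pow_eq hu, M.semi.root.pow_eq_one, hu]

theorem map_y_zero (M : Model p g L τ σ ζ y) : τ (y 0) = y 0 := by
  rw [M.map_y, mul_zero]

theorem zeta_mem_fld {y₀ : Ω} : ζ ∈ fld τ ζ y₀ u J :=
  Subfield.subset_closure (Or.inl (Or.inl rfl))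

theorem y_mem_fld {y₀ : Ω} : y₀ ∈ fld τ ζ y₀ u J :=
  Subfield.subset_closure (Or.inl (Or.inr rfl))

theorem act_mem_fld {y₀ : Ω} {f : ℤ[X]} (hf : f ∈ J) : (act τ f u : Ω) ∈ fld τ ζ y₀ u J :=
  Subfield.subset_closure (Or.inr ⟨f, hf, rfl⟩)

theorem fld_le {y₀ : Ω} {E : Subfield Ω} (h1 : ζ ∈ E) (h2 : y₀ ∈ E)
    (h3 : ∀ f ∈ J, (act τ f u : Ω) ∈ E) : fld τ ζ y₀ u J ≤ E := by
  refine Subfield.closure_le.mpr ?_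
  rintro x ((rfl | rfl) | ⟨f, hf, rfl⟩)
  exacts [h1, h2, h3 f hf]

theorem fld_mono {y₀ : Ω} (h : J ≤ J') : fld τ ζ y₀ u J ≤ fld τ ζ y₀ u J' :=
  fld_le zeta_mem_fld y_mem_fld fun _ hf => act_mem_fld (h hf)

theorem map_mem_fld (M : Model p g L τ σ ζ y) {x : Ω} (hx : x ∈ fld τ ζ (y 0) u J) :
    τ x ∈ fld τ ζ (y 0) u J := by
  have h : fld τ ζ (y 0) u J ≤ (fld τ ζ (y 0) u J).comap τ := by
    refine fld_le ?_ ?_ fun f hf => ?_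
    · rw [Subfield.mem_comap, M.semi.map_zeta]
      exact pow_mem zeta_mem_fld _
    · rw [Subfield.mem_comap, M.map_y_zero]
      exact y_mem_fld
    · rw [Subfield.mem_comap, map_act]
      exact act_mem_fld (J.mul_mem_left X hf)
  exact h hx

theorem exists_pow_eq (M : Model p g L τ σ ζ y) {j : ZMod p} (hj : j ≠ 0) :
    ∃ i < p - 1, g ^ i = j := by
  have h : j ∈ (Finset.range (p - 1)).image (fun i => g ^ i) := by
    rw [SemiAct.image_pow M.semi.root]
    exact Finset.mem_erase.mpr ⟨hj, Finset.mem_univ j⟩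
  obtain ⟨i, hi, rfl⟩ := Finset.mem_image.mp h
  exact ⟨i, Finset.mem_range.mp hi, rfl⟩

theorem mem_of_act_mem (M : Model p g L τ σ ζ y) (hu : (u : Ω) = y 1) (E : Subfield Ω)
    (h1 : ζ ∈ E) (h2 : y 0 ∈ E) (h3 : ∀ i < p - 1, (act τ (X ^ i) u : Ω) ∈ E) (x : Ω) : x ∈ E := by
  refine M.mem E h1 (fun j => ?_) x
  by_cases hj : j = 0
  · rwa [hj]
  · obtain ⟨i, hi, rfl⟩ := M.exists_pow_eq hj
    rw [← M.act_X_pow_eq hu]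
    exact h3 i hi

theorem fld_top (M : Model p g L τ σ ζ y) (hu : (u : Ω) = y 1) : fld τ ζ (y 0) u ⊤ = ⊤ :=
  top_le_iff.mp fun x _ => M.mem_of_act_mem hu _ zeta_mem_fld y_mem_fld
    (fun _ _ => act_mem_fld Submodule.mem_top) x

theorem sigma_act (M : Model p g L τ σ ζ y) (hu : (u : Ω) = y 1) (f : ℤ[X]) :
    σ (act τ f u) = ζ ^ (aeval g f).val * act τ f u := by
  have hζ0 : ζ ≠ 0 := M.semi.prim.ne_zero hp.out.ne_zero
  have hval : ∀ a b : ZMod p, ζ ^ (a + b).val = ζ ^ a.val * ζ ^ b.val := by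
    intro a b
    rw [← pow_add]
    apply M.semi.pow_eq
    push_cast
    simp
  let S : AddSubgroup ℤ[X] :=
    { carrier := {f | σ (act τ f u) = ζ ^ (aeval g f).val * act τ f u}
      zero_mem' := by simp [act_zero]
      add_mem' := by
        intro a b ha hb
        rw [Set.mem_ofPred_eq] at ha hb ⊢
        rw [act_add, Units.val_mul, map_mul, ha, hb, map_add, hval]
        ring
      neg_mem' := by
        intro a ha
        rw [Set.mem_ofPred_eq] at ha ⊢
        rw [act_neg, Units.val_inv_eq_inv_val, map_inv₀, ha, mul_inv, map_neg]
        have h2 : ζ ^ (aeval g a).val * ζ ^ (-aeval g a).val = 1 := by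
          rw [← hval, add_neg_cancel, ZMod.val_zero, pow_zero]
        rw [eq_inv_of_mul_eq_one_right h2] }
  have h1 : ∀ f, f ∈ S := by
    intro f
    induction f using Polynomial.induction_on' with
    | add a b ha hb => exact add_mem ha hb
    | monomial k a =>
      have h2 : (X ^ k : ℤ[X]) ∈ S := by
        change σ _ = _
        rw [M.act_X_pow_eq hu, M.sigma_y, map_pow, aeval_X]
      have h3 := zsmul_mem h2 a
      rwa [← C_mul_X_pow_eq_monomial, ← smul_eq_C_mul]
  exact h1 f

/-- The fixed field of `σ` is generated by the monomials of weight zero. -/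
theorem fld_eq_fixSub (M : Model p g L τ σ ζ y) [CharZero Ω] (hu : (u : Ω) = y 1)
    (hJ : ∀ f, f ∈ J ↔ aeval g f = 0) : fld τ ζ (y 0) u J = fixSub σ := by
  have hle : fld τ ζ (y 0) u J ≤ fixSub σ := by
    refine fld_le M.sigma_zeta ?_ fun f hf => ?_
    · rw [mem_fixSub, M.sigma_y, ZMod.val_zero, pow_zero, one_mul]
    · rw [mem_fixSub, M.sigma_act hu, (hJ f).mp hf, ZMod.val_zero, pow_zero, one_mul]
  refine le_antisymm hle fun x hx => ?_
  have hCJ : (C (p : ℤ)) ∈ J := by rw [hJ]; simp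
  have hyp : y 1 ^ p ∈ fld τ ζ (y 0) u J := by
    have h1 := act_mem_fld (τ := τ) (ζ := ζ) (u := u) (y₀ := y 0) hCJ
    rw [act_C] at h1
    rw [← hu]
    exact_mod_cast h1
  have hal : IsAlgebraic (fld τ ζ (y 0) u J) (y 1) := by
    refine IsAlgebraic.of_pow hp.out.pos ?_
    exact isAlgebraic_algebraMap (⟨_, hyp⟩ : fld τ ζ (y 0) u J)
  have hsig : ∀ i k, σ^[i] (y 1 ^ k) = (ζ ^ k) ^ i * y 1 ^ k := by
    intro i k
    induction i with
    | zero => simp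
    | succ m ih =>
      have : Fact (1 < p) := ⟨hp.out.one_lt⟩
      rw [Function.iterate_succ_apply', ih, map_mul, map_pow, map_pow, map_pow, M.sigma_zeta,
        M.sigma_y, ZMod.val_one]
      ring
  refine mem_of_fixed_of_sum_mem (w := y 1) (fld τ ζ (y 0) u J) σ hle hal hp.out.ne_zero (fun k => ?_) ?_ hx
  · simp_rw [hsig, ← Finset.sum_mul]
    by_cases hk : ζ ^ k = 1
    · obtain ⟨c, rfl⟩ := (M.semi.prim.pow_eq_one_iff_dvd k).mp hk
      rw [pow_mul (y 1)]
      refine mul_mem (sum_mem fun i _ => ?_) (pow_mem hyp c)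
      exact pow_mem (pow_mem zeta_mem_fld _) _
    · have h3 : (ζ ^ k) ^ p = 1 := by
        rw [← pow_mul, mul_comm, pow_mul, M.semi.prim.pow_eq_one, one_pow]
      rw [geom_sum_eq hk, h3, sub_self, zero_div, zero_mul]
      exact zero_mem _
  · refine M.mem_of_act_mem hu _ (Subfield.subset_closure (Or.inl zeta_mem_fld))
      (Subfield.subset_closure (Or.inl y_mem_fld)) (fun i _ => ?_) x
    have h1 : X ^ i - C (((g ^ i).val : ℕ) : ℤ) ∈ J := by
      rw [hJ, map_sub, map_pow, aeval_X, map_natCast, map_natCast,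
        ZMod.natCast_zmod_val, sub_self]
    have h2 : (X ^ i : ℤ[X]) = (X ^ i - C (((g ^ i).val : ℕ) : ℤ)) + C (((g ^ i).val : ℕ) : ℤ) := by
      ring
    rw [h2, act_add, act_C, Units.val_mul, Units.val_zpow_eq_zpow_val, hu]
    have h3 : y 1 ∈ Subfield.closure ((fld τ ζ (y 0) u J : Set Ω) ∪ {y 1}) :=
      Subfield.subset_closure (Or.inr rfl)
    exact mul_mem (Subfield.subset_closure (Or.inl (act_mem_fld h1))) (zpow_mem h3 _)

end Model

theorem act_mem_of_degree_lt {Ω : Type*} [Field Ω] {τ : Ω →+* Ω} {E : Subfield Ω} {w : Ωˣ} {m : ℕ}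
    (h : ∀ i < m, (act τ (X ^ i) w : Ω) ∈ E) {r : ℤ[X]} (hr : r.degree < m) :
    (act τ r w : Ω) ∈ E := by
  rw [r.as_sum_range_C_mul_X_pow]
  have h1 : ∀ s ⊆ Finset.range (r.natDegree + 1),
      (act τ (∑ i ∈ s, C (r.coeff i) * X ^ i) w : Ω) ∈ E := by
    intro s
    induction s using Finset.induction_on with
    | empty => intro _; simp [act_zero, one_mem]
    | insert i s hi ih =>
      intro hs
      rw [Finset.sum_insert hi, act_add, act_mul, act_C, Units.val_mul, Units.val_zpow_eq_zpow_val]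
      refine mul_mem ?_ (ih ((Finset.subset_insert _ _).trans hs))
      by_cases hc : r.coeff i = 0
      · simp [hc, one_mem]
      · refine zpow_mem (h i ?_) _
        have := (le_degree_of_ne_zero hc).trans_lt hr
        exact_mod_cast this
  exact h1 _ subset_rfl

namespace Model

variable {p : ℕ} [hp : Fact p.Prime] {g : ZMod p} {L Ω : Type*} [Field L] [Field Ω]
  [Algebra L Ω] {τ σ : Ω →+* Ω} {ζ : Ω} {y : ZMod p → Ω} {u : Ωˣ}

theorem act_sub_one_mul_mem (M : Model p g L τ σ ζ y) (hu : (u : Ω) = y 1) {d : ℕ}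
    (hd : d ∣ p - 1) (hd0 : 0 < d) {E : Subfield Ω}
    (h : ∀ i < p - 1 - d, (act τ (X ^ i) (act τ (X ^ d - 1) u) : Ω) ∈ E) (q : ℤ[X]) :
    (act τ (q * (X ^ d - 1)) u : Ω) ∈ E := by
  obtain ⟨c, hc⟩ := hd
  have hn := p_sub_one_pos (p := p)
  obtain ⟨Φ, hΦ⟩ : (X ^ d - 1 : ℤ[X]) ∣ X ^ (p - 1) - 1 := by
    rw [hc, pow_mul]
    exact sub_one_dvd_pow_sub_one _ _
  have hm1 : (X ^ d - 1 : ℤ[X]).Monic := monic_X_pow_sub_C 1 hd0.ne'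
  have hm2 : (X ^ (p - 1) - 1 : ℤ[X]).Monic := monic_X_pow_sub_C 1 hn.ne'
  have hΦm : Φ.Monic := hm1.of_mul_monic_left (hΦ ▸ hm2)
  have hdeg : Φ.natDegree = p - 1 - d := by
    have h1 := congrArg natDegree hΦ
    rw [hm1.natDegree_mul hΦm, ← C_1, natDegree_X_pow_sub_C, natDegree_X_pow_sub_C] at h1
    omega
  have h1 : act τ (q * (X ^ d - 1)) u = act τ ((q %ₘ Φ) * (X ^ d - 1)) u := by
    refine act_congr_of_dvd τ _ _ u (M.act_X_pow_sub_one hu) ?_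
    rw [← sub_mul, hΦ, mul_comm]
    refine mul_dvd_mul_right ?_ _
    exact ⟨q /ₘ Φ, by linear_combination -(modByMonic_add_div q Φ)⟩
  rw [h1, act_mul]
  refine act_mem_of_degree_lt h ?_
  rw [← hdeg]
  exact (degree_modByMonic_lt q hΦm).trans_le degree_le_natDegree

/-- One step of the descent chain: adjoining the monomials with exponents in `J` to those with
exponents in `J ⊓ (X ^ d - 1)` is a purely transcendental extension on the fixed fields. -/
theorem nonempty_step (M : Model p g L τ σ ζ y) [CharZero Ω] (hu : (u : Ω) = y 1) {d : ℕ}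
    (hd : d ∣ p - 1) (hd0 : 0 < d) {J : Ideal ℤ[X]} {e : ℤ[X]} (he : e ∈ J)
    (hJ : ∀ f ∈ J, ∃ a, f - a * e ∈ J ⊓ Ideal.span {X ^ d - 1})
    (hc : ∃ b c : ℤ[X], ∃ m : ℤ, m ≠ 0 ∧ b * e = C m + c * (X ^ d - 1)) :
    Nonempty (↥(fld τ ζ (y 0) u J ⊓ fixSub τ) ≃+* FractionRing (MvPolynomial (Fin d)
      ↥(fld τ ζ (y 0) u (J ⊓ Ideal.span {X ^ d - 1}) ⊓ fixSub τ : Subfield Ω))) := by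
  set N := J ⊓ Ideal.span {(X ^ d - 1 : ℤ[X])} with hN
  let v : Fin d → Ω := fun i => act τ (X ^ (i : ℕ)) (act τ e u)
  have hτv : ∀ i, ∃ j, ∃ c ∈ fld τ ζ (y 0) u N, τ (v i) = c * v j := by
    intro i
    by_cases hi : (i : ℕ) + 1 < d
    · refine ⟨⟨i + 1, hi⟩, 1, one_mem _, ?_⟩
      simp only [v, one_mul]
      rw [map_act, pow_succ']
    · refine ⟨⟨0, hd0⟩, act τ ((X ^ d - 1) * e) u, act_mem_fld ⟨J.mul_mem_left _ he,
        Ideal.mul_mem_right _ _ (Ideal.mem_span_singleton_self _)⟩, ?_⟩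
      have hi' : (i : ℕ) + 1 = d := by have := i.2; omega
      simp only [v]
      rw [map_act, ← pow_succ', hi', pow_zero, act_one, act_mul, act_sub, act_one, Units.val_div_eq_div_val]
      rw [div_mul_cancel₀ _ (Units.ne_zero _)]
  let x : Option (Fin (p - 1 - d)) → Ω := fun o =>
    o.elim (y 0) fun i => act τ (X ^ (i : ℕ)) (act τ (X ^ d - 1) u)
  have hx : ∀ (E : Subfield Ω), (∀ o, x o ∈ E) → ∀ q, (act τ (q * (X ^ d - 1)) u : Ω) ∈ E :=
    fun E hE q => M.act_sub_one_mul_mem hu hd hd0 (fun i hi => hE (some ⟨i, hi⟩)) q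
  have hind : AlgebraicIndependent L (Sum.elim v x) := by
    refine algebraicIndependent_of_mem_algCl M.ind ?_ ?_
    · have hE : ∀ s, Sum.elim v x s ∈ algCl L (Set.range (Sum.elim v x)) :=
        fun s => subset_algCl ⟨s, rfl⟩
      set E := algCl L (Set.range (Sum.elim v x)) with hEdef
      have h1 := hx E fun o => hE (Sum.inr o)
      have h2 : ∀ a, (act τ (a * e) u : Ω) ∈ E := by
        intro a
        have hm1 : (X ^ d - 1 : ℤ[X]).Monic := monic_X_pow_sub_C 1 hd0.ne'
        have h3 : a * e = (a %ₘ (X ^ d - 1)) * e + (a /ₘ (X ^ d - 1) * e) * (X ^ d - 1) := by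
          nth_rw 1 [← modByMonic_add_div a (X ^ d - 1)]
          ring
        rw [h3, act_add, Units.val_mul]
        refine mul_mem ?_ (h1 _)
        rw [act_mul]
        refine act_mem_of_degree_lt (m := d) (fun i hi => hE (Sum.inl ⟨i, hi⟩)) ?_
        refine (degree_modByMonic_lt a hm1).trans_le ?_
        rw [← C_1, degree_X_pow_sub_C hd0]
      obtain ⟨b, c, m, hm, hbc⟩ := hc
      refine fun j => M.mem_of_act_mem hu E (M.zeta_mem_algCl _) (hE (Sum.inr none)) ?_ (y j)
      intro i _
      have h3 : C m * X ^ i = (X ^ i * b) * e - (X ^ i * c) * (X ^ d - 1) := by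
        linear_combination (X ^ i : ℤ[X]) * (-hbc)
      have h4 : ((act τ (X ^ i) u : Ω)) ^ m ∈ E := by
        rw [← Units.val_zpow_eq_zpow_val, ← act_C τ, ← act_mul, h3, act_sub,
          Units.val_div_eq_div_val]
        exact div_mem (h2 _) (h1 _)
      refine mem_algCl_of_pow (Int.natAbs_pos.mpr hm) ?_
      rcases Int.natAbs_eq m with hm' | hm'
      · rw [hm', zpow_natCast] at h4
        exact h4
      · rw [hm', zpow_neg, zpow_natCast] at h4
        exact inv_mem_iff.mp h4
    · rw [ZMod.card, Fintype.card_sum, Fintype.card_option, Fintype.card_fin, Fintype.card_fin]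
      have := Nat.le_of_dvd (p_sub_one_pos (p := p)) hd
      have := p_sub_one_pos (p := p)
      omega
  have hv1 := (AlgebraicIndependent.sumElim_iff.mp hind).2
  have hv : AlgebraicIndependent (fld τ ζ (y 0) u N) v := by
    let K := algCl L (Set.range x)
    let : Algebra (Algebra.adjoin L (Set.range x)) K :=
      (Subring.inclusion (S := (Algebra.adjoin L (Set.range x)).toSubring) (T := K.toSubring)
        fun z hz => isAlgebraic_algebraMap (⟨z, hz⟩ : Algebra.adjoin L (Set.range x))).toAlgebra
    have : IsScalarTower (Algebra.adjoin L (Set.range x)) K Ω :=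
      IsScalarTower.of_algebraMap_eq (congrFun rfl)
    have : Algebra.IsAlgebraic (Algebra.adjoin L (Set.range x)) K := by
      refine ⟨fun z => ?_⟩
      exact (isAlgebraic_algebraMap_iff (A := Ω) Subtype.val_injective).mp z.2
    have hv2 : AlgebraicIndependent K v := hv1.extendScalars K
    have hle : fld τ ζ (y 0) u N ≤ K := by
      refine fld_le (M.zeta_mem_algCl _) (subset_algCl ⟨none, rfl⟩) fun f hf => ?_
      obtain ⟨q, rfl⟩ := Ideal.mem_span_singleton'.mp hf.2
      exact hx K (fun o => subset_algCl ⟨o, rfl⟩) q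
    let : Algebra (fld τ ζ (y 0) u N) K := (Subfield.inclusion hle).toAlgebra
    have : IsScalarTower (fld τ ζ (y 0) u N) K Ω :=
      IsScalarTower.of_algebraMap_eq (congrFun rfl)
    exact hv2.restrictScalars (RingHom.injective _)
  refine M.semi.nonempty_ringEquiv zeta_mem_fld (fun x hx => M.map_mem_fld hx) hv ?_ hτv
  apply le_antisymm
  · have hsub : fld τ ζ (y 0) u N ≤
        Subfield.closure ((fld τ ζ (y 0) u N : Set Ω) ∪ Set.range v) :=
      fun z hz => Subfield.subset_closure (Or.inl hz)
    have hstab : Subfield.closure ((fld τ ζ (y 0) u N : Set Ω) ∪ Set.range v) ≤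
        (Subfield.closure ((fld τ ζ (y 0) u N : Set Ω) ∪ Set.range v)).comap τ := by
      rw [Subfield.closure_le]
      rintro z (hz | ⟨i, rfl⟩)
      · exact hsub (M.map_mem_fld hz)
      · obtain ⟨j, c, hc, hj⟩ := hτv i
        rw [SetLike.mem_coe, Subfield.mem_comap, hj]
        exact mul_mem (hsub hc) (Subfield.subset_closure (Or.inr ⟨j, rfl⟩))
    have hv0 : (act τ e u : Ω) ∈ Subfield.closure ((fld τ ζ (y 0) u N : Set Ω) ∪ Set.range v) := by
      refine Subfield.subset_closure (Or.inr ⟨⟨0, hd0⟩, ?_⟩)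
      simp only [v, pow_zero, act_one]
    refine fld_le (hsub zeta_mem_fld) (hsub y_mem_fld) fun f hf => ?_
    obtain ⟨a, ha⟩ := hJ f hf
    rw [← sub_add_cancel f (a * e), act_add, Units.val_mul, act_mul]
    exact mul_mem (hsub (act_mem_fld ha)) (act_mem τ a (fun z hz => Subfield.mem_comap.mp (hstab hz)) hv0)
  · rw [Subfield.closure_le]
    rintro z (hz | ⟨i, rfl⟩)
    · exact fld_mono inf_le_left hz
    · simp only [v]
      rw [← act_mul]
      exact act_mem_fld (J.mul_mem_left _ he)

end Model

theorem exists_bezout_of_dvd {n : ℕ} (hn : 0 < n) {α β γ A B : ℤ[X]} {m : ℤ}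
    (h : α * β = C m + γ * (X ^ n - 1)) (hm : IsCoprime m n) (hAB : A * B ∣ X ^ n - 1) :
    ∃ a b c, a * α + b * A + c * B = 1 := by
  obtain ⟨E, hE⟩ := hAB
  obtain ⟨s, t, hst⟩ := hm
  have hder := congrArg derivative hE
  simp only [derivative_sub, derivative_X_pow, derivative_one, sub_zero, derivative_mul] at hder
  have hX : (X : ℤ[X]) * X ^ (n - 1) = X ^ n := by
    rw [← pow_succ', Nat.sub_add_cancel hn]
  have hst' : (C s * C m + C t * (n : ℤ[X]) : ℤ[X]) = 1 := by
    rw [← map_natCast (C : ℤ →+* ℤ[X]), ← C_mul, ← C_mul, ← C_add, hst, C_1]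
  refine ⟨C s * β, - (C s * γ * B * E) - (C t * (n : ℤ[X]) * B * E) +
    C t * X * (derivative B * E + B * derivative E),
    C t * X * derivative A * E, ?_⟩
  have hder' : (n : ℤ[X]) * X ^ (n - 1) = (derivative A * B + A * derivative B) * E +
      A * B * derivative E := by
    rw [← hder]
    simp
  linear_combination C s * h + hst' + (C s * γ + C t * (n : ℤ[X])) * hE - C t * X * hder' +
    C t * (n : ℤ[X]) * hX

theorem rel_span_cyclotomic {n : ℕ} (hn : 0 < n) {α : ℤ[X]} {r : Ideal ℤ[X] → Ideal ℤ[X] → Prop}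
    (hr : Equivalence r) (h : ∀ A d, d ∣ n → A * (X ^ d - 1) ∣ X ^ n - 1 →
      r (Ideal.span {α, A}) (Ideal.span {α, A * (X ^ d - 1)})) :
    r ⊤ (Ideal.span {α, cyclotomic n ℤ}) := by
  have key : ∀ d, d ∣ n → ∀ A, A * (X ^ d - 1) ∣ X ^ n - 1 →
      r (Ideal.span {α, A}) (Ideal.span {α, A * cyclotomic d ℤ}) := by
    intro d
    induction d using Nat.strong_induction_on with
    | _ d ih =>
      intro hd A hA
      have hd0 : 0 < d := Nat.pos_of_dvd_of_pos hd hn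
      have hX : (X ^ d - 1 : ℤ[X]) = cyclotomic d ℤ * ∏ i ∈ d.properDivisors, cyclotomic i ℤ := by
        rw [← prod_cyclotomic_eq_X_pow_sub_one hd0, ← Nat.cons_self_properDivisors hd0.ne',
          Finset.prod_cons]
      have h1 : ∀ s ⊆ d.properDivisors, r (Ideal.span {α, A * cyclotomic d ℤ})
          (Ideal.span {α, A * cyclotomic d ℤ * ∏ i ∈ s, cyclotomic i ℤ}) := by
        intro s
        induction s using Finset.induction_on_min with
        | empty => intro _; rw [Finset.prod_empty, mul_one]; exact hr.refl _
        | insert a s ha ih' =>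
          intro hs
          have hs' := (Finset.subset_insert a s).trans hs
          have had := Nat.mem_properDivisors.mp (hs (Finset.mem_insert_self a s))
          have ha0 : 0 < a := Nat.pos_of_dvd_of_pos had.1 hd0
          refine hr.trans (ih' hs') ?_
          rw [Finset.prod_insert (fun h => (ha a h).false), mul_comm (cyclotomic a ℤ), ← mul_assoc]
          refine ih a had.2 (had.1.trans hd) _ (dvd_trans ?_ hA)
          rw [hX, mul_assoc, mul_assoc]
          refine mul_dvd_mul_left _ (mul_dvd_mul_left _ ?_)
          have hdisj : Disjoint s a.divisors := by
            rw [Finset.disjoint_left]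
            intro x hx hx'
            exact (ha x hx).not_ge (Nat.divisor_le hx')
          rw [← prod_cyclotomic_eq_X_pow_sub_one ha0, ← Finset.prod_union hdisj]
          refine Finset.prod_dvd_prod_of_subset _ _ _ (Finset.union_subset hs' fun x hx => ?_)
          rw [Nat.mem_divisors] at hx
          rw [Nat.mem_properDivisors]
          exact ⟨hx.1.trans had.1, (Nat.le_of_dvd ha0 hx.1).trans_lt had.2⟩
      have h2 := h A d hd hA
      rw [hX, ← mul_assoc] at h2
      exact hr.trans h2 (hr.symm (h1 _ subset_rfl))
  have h1 := key n dvd_rfl 1 (by rw [one_mul])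
  rw [one_mul, Ideal.span_pair_comm, Ideal.span_insert, Ideal.span_singleton_one, top_sup_eq] at h1
  exact h1

namespace Model

variable {p : ℕ} [hp : Fact p.Prime] {g : ZMod p} {L Ω : Type*} [Field L] [Field Ω]
  [Algebra L Ω] {τ σ : Ω →+* Ω} {ζ : Ω} {y : ZMod p → Ω} {u : Ωˣ}

theorem nonempty_equiv_of_step (M : Model p g L τ σ ζ y) [CharZero Ω] (hu : (u : Ω) = y 1)
    {α β γ A : ℤ[X]} {m : ℤ} (h : α * β = C m + γ * (X ^ (p - 1) - 1))
    (hm : IsCoprime m (p - 1 : ℕ)) (hm0 : m ≠ 0) {d : ℕ} (hd : d ∣ p - 1)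
    (hA : A * (X ^ d - 1) ∣ X ^ (p - 1) - 1) :
    Nonempty (↥(fld τ ζ (y 0) u (Ideal.span {α, A}) ⊓ fixSub τ) ≃+*
      ↥(fld τ ζ (y 0) u (Ideal.span {α, A * (X ^ d - 1)}) ⊓ fixSub τ)) := by
  have hd0 : 0 < d := Nat.pos_of_dvd_of_pos hd p_sub_one_pos
  obtain ⟨a, b, v, hv⟩ := exists_bezout_of_dvd p_sub_one_pos h hm hA
  have hle : Ideal.span {α, A * (X ^ d - 1)} ≤ Ideal.span {α, A} := by
    rw [Ideal.span_le]
    rintro f (rfl | rfl)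
    · exact Ideal.subset_span (by simp)
    · exact Ideal.mul_mem_right _ _ (Ideal.subset_span (by simp))
  have hN : Ideal.span {α, A} ⊓ Ideal.span {X ^ d - 1} =
      Ideal.span {α, A * (X ^ d - 1)} ⊓ Ideal.span {X ^ d - 1} := by
    refine le_antisymm (le_inf ?_ inf_le_right) (inf_le_inf_right _ hle)
    rintro f ⟨hf1, hf2⟩
    obtain ⟨s, t, hst⟩ := Ideal.mem_span_pair.mp hf1
    obtain ⟨c, hc⟩ := Ideal.mem_span_singleton'.mp hf2
    rw [Ideal.mem_span_pair]
    refine ⟨f * a + s * v * (X ^ d - 1), c * b + t * v, ?_⟩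
    linear_combination f * hv + v * (X ^ d - 1) * hst + b * A * hc
  obtain ⟨w, hw⟩ : (X ^ d - 1 : ℤ[X]) ∣ X ^ (p - 1) - 1 := (Dvd.intro_left _ rfl).trans hA
  have h1 := M.nonempty_step hu hd hd0 (J := Ideal.span {α, A}) (e := 1 - v * (X ^ d - 1))
    (Ideal.mem_span_pair.mpr ⟨a, b, by linear_combination hv⟩)
    (fun f hf => ⟨f, by
      have h2 : f - f * (1 - v * (X ^ d - 1)) = (f * v) * (X ^ d - 1) := by ring
      refine ⟨?_, h2 ▸ Ideal.mul_mem_left _ _ (Ideal.mem_span_singleton_self _)⟩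
      rw [h2, mul_assoc]
      exact Ideal.mul_mem_right _ _ hf⟩)
    ⟨1, -v, 1, one_ne_zero, by rw [C_1]; ring⟩
  have h2 := M.nonempty_step hu hd hd0 (J := Ideal.span {α, A * (X ^ d - 1)}) (e := α)
    (Ideal.subset_span (by simp))
    (fun f hf => by
      obtain ⟨s, t, hst⟩ := Ideal.mem_span_pair.mp hf
      have h2 : f - s * α = (t * A) * (X ^ d - 1) := by linear_combination -hst
      refine ⟨s, ?_, h2 ▸ Ideal.mul_mem_left _ _ (Ideal.mem_span_singleton_self _)⟩
      rw [h2, mul_assoc]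
      exact Ideal.mul_mem_left _ _ (Ideal.subset_span (by simp)))
    ⟨β, γ * w, m, hm0, by linear_combination h + γ * hw⟩
  rw [hN] at h1
  obtain ⟨φ⟩ := h1
  obtain ⟨ψ⟩ := h2
  exact ⟨φ.trans ψ.symm⟩

theorem nonempty_equiv_of_certificate (M : Model p g L τ σ ζ y) [CharZero Ω] (hu : (u : Ω) = y 1)
    {α β γ : ℤ[X]} {m : ℤ} (h : α * β = C m + γ * (X ^ (p - 1) - 1))
    (hm : IsCoprime m (p - 1 : ℕ)) (hm0 : m ≠ 0) (hg : Gen p g α) :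
    Nonempty (↥(fixSub σ ⊓ fixSub τ) ≃+* fixSub τ) := by
  have h1 := rel_span_cyclotomic (α := α) p_sub_one_pos (r := fun J J' =>
      Nonempty (↥(fld τ ζ (y 0) u J ⊓ fixSub τ) ≃+* ↥(fld τ ζ (y 0) u J' ⊓ fixSub τ)))
    ⟨fun _ => ⟨RingEquiv.refl _⟩, fun ⟨φ⟩ => ⟨φ.symm⟩, fun ⟨φ⟩ ⟨ψ⟩ => ⟨φ.trans ψ⟩⟩
    (fun A d hd hA => M.nonempty_equiv_of_step hu h hm hm0 hd hA)
  rw [fld_top M hu, top_inf_eq, M.fld_eq_fixSub hu fun f => (hg.mem_iff f).symm] at h1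
  obtain ⟨φ⟩ := h1
  exact ⟨φ.symm⟩

end Model

theorem nonempty_algEquiv_of_certificate {p : ℕ} [hp : Fact p.Prime] {g : ZMod p}
    (hg : IsPrimitiveRoot g (p - 1)) {α β γ : ℤ[X]} {m : ℤ}
    (h : α * β = C m + γ * (X ^ (p - 1) - 1)) (hm : IsCoprime m (p - 1 : ℕ)) (hm0 : m ≠ 0)
    (hα : Gen p g α)
    (σ : FractionRing (MvPolynomial (Fin p) ℚ) ≃ₐ[ℚ] FractionRing (MvPolynomial (Fin p) ℚ))
    (hσ : ∀ i : Fin p,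
      σ (algebraMap (MvPolynomial (Fin p) ℚ) (FractionRing (MvPolynomial (Fin p) ℚ))
          (MvPolynomial.X i)) =
        algebraMap (MvPolynomial (Fin p) ℚ) (FractionRing (MvPolynomial (Fin p) ℚ))
          (MvPolynomial.X (finRotate p i))) :
    Nonempty ((IntermediateField.fixedField (Subgroup.zpowers σ)) ≃ₐ[ℚ]
        FractionRing (MvPolynomial (Fin p) ℚ)) := by
  obtain ⟨L, Ω, _, _, _, _, τ, σ', ζ, y, M⟩ := exists_model p hg
  obtain ⟨φ₁⟩ := M.nonempty_fixedField_equiv σ hσ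
  obtain ⟨φ₂⟩ := M.nonempty_equiv_of_certificate (u := Units.mk0 (y 1) (M.y_ne_zero 1)) rfl h hm
    hm0 hα
  obtain ⟨φ₃⟩ := M.nonempty_fixSub_equiv
  let φ := (φ₁.trans φ₂).trans φ₃
  exact ⟨AlgEquiv.ofRingEquiv (f := φ) fun q => by
    rw [eq_ratCast, eq_ratCast, map_ratCast]⟩

section ListPolynomials

variable {R : Type*} [CommRing R]

/-- The value at `z` of the polynomial with the given list of coefficients. -/
def listEval (z : R) : List ℤ → R
  | [] => 0
  | a :: l => a + z * listEval z l

/-- Sum of coefficient lists. -/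
def listAdd : List ℤ → List ℤ → List ℤ
  | [], l => l
  | l, [] => l
  | a :: l, b :: m => (a + b) :: listAdd l m

/-- Product of coefficient lists. -/
def listMul : List ℤ → List ℤ → List ℤ
  | [], _ => []
  | a :: l, l' => listAdd (l'.map (a * ·)) (0 :: listMul l l')

/-- Reduction of a coefficient list modulo `X ^ n - 1`, for lists of length at most `2 * n`. -/
def listFold (n : ℕ) (l : List ℤ) : List ℤ := listAdd (l.take n) (l.drop n)

/-- Multiplication by `X ^ k - 1`. -/
def listShiftSub (k : ℕ) (l : List ℤ) : List ℤ :=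
  listAdd (List.replicate k 0 ++ l) (l.map (-1 * ·))

theorem listEval_add (z : R) : ∀ l l', listEval z (listAdd l l') = listEval z l + listEval z l'
  | [], l => by simp [listAdd, listEval]
  | a :: l, [] => by simp [listAdd, listEval]
  | a :: l, b :: l' => by
    rw [listAdd, listEval, listEval, listEval, listEval_add z l l', Int.cast_add]
    ring

theorem listEval_map (z : R) (c : ℤ) : ∀ l, listEval z (l.map (c * ·)) = c * listEval z l
  | [] => by simp [listEval]
  | a :: l => by
    rw [List.map_cons, listEval, listEval, listEval_map z c l, Int.cast_mul]
    ring

theorem listEval_mul (z : R) : ∀ l l', listEval z (listMul l l') = listEval z l * listEval z l'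
  | [], l => by simp [listMul, listEval]
  | a :: l, l' => by
    rw [listMul, listEval_add, listEval_map, listEval, listEval, listEval_mul z l l', Int.cast_zero]
    ring

theorem listEval_append (z : R) :
    ∀ l l', listEval z (l ++ l') = listEval z l + z ^ l.length * listEval z l'
  | [], l' => by simp [listEval]
  | a :: l, l' => by
    rw [List.cons_append, listEval, listEval, listEval_append z l l', List.length_cons]
    ring

theorem listEval_fold {z : R} {n : ℕ} (hz : z ^ n = 1) (l : List ℤ) :
    listEval z (listFold n l) = listEval z l := by
  rw [listFold, listEval_add]
  rcases le_total n l.length with h | h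
  · conv_rhs => rw [← List.take_append_drop n l, listEval_append, List.length_take_of_le h, hz,
      one_mul]
  · rw [List.take_of_length_le h, List.drop_of_length_le h, listEval, add_zero]

theorem listEval_replicate_zero (z : R) : ∀ k, listEval z (List.replicate k 0) = 0
  | 0 => rfl
  | k + 1 => by
    rw [List.replicate_succ, listEval, listEval_replicate_zero z k, Int.cast_zero, mul_zero,
      add_zero]

theorem listEval_shiftSub (z : R) (k : ℕ) (l : List ℤ) :
    listEval z (listShiftSub k l) = (z ^ k - 1) * listEval z l := by
  rw [listShiftSub, listEval_add, listEval_map, listEval_append, listEval_replicate_zero,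
    List.length_replicate]
  push_cast
  ring

theorem listEval_eq_zero (z : R) : ∀ l : List ℤ, l.all (· == 0) = true → listEval z l = 0
  | [], _ => rfl
  | a :: l, h => by
    rw [List.all_cons, Bool.and_eq_true, beq_iff_eq] at h
    rw [listEval, listEval_eq_zero z l h.2, h.1, Int.cast_zero, mul_zero, add_zero]

theorem map_listEval {S F : Type*} [CommRing S] [FunLike F R S] [RingHomClass F R S] (φ : F) (z : R) :
    ∀ l, φ (listEval z l) = listEval (φ z) l
  | [] => map_zero φ
  | a :: l => by rw [listEval, map_add, map_mul, map_intCast, map_listEval φ z l, listEval]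

end ListPolynomials

/-- Whether the polynomial with coefficients `l` vanishes at the primitive `n`-th roots of unity,
tested after multiplication by all `X ^ k - 1` with `k ∈ ks`. -/
def vanishes (n : ℕ) (ks : List ℕ) (l : List ℤ) : Bool :=
  (ks.foldr (fun k l => listFold n (listShiftSub k l)) (listFold n l)).all (· == 0)

theorem listEval_eq_zero_of_vanishes {n : ℕ} {ks : List ℕ} (hks : ∀ k ∈ ks, 0 < k ∧ k < n)
    {l : List ℤ} (h : vanishes n ks l = true) {ζ : ℂ} (hζ : IsPrimitiveRoot ζ n) :
    listEval ζ l = 0 := by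
  have h1 := listEval_eq_zero ζ _ h
  have h2 : ∀ ks : List ℕ, (∀ k ∈ ks, 0 < k ∧ k < n) →
      listEval ζ (ks.foldr (fun k l => listFold n (listShiftSub k l)) (listFold n l)) = 0 →
      listEval ζ l = 0 := by
    intro ks
    induction ks with
    | nil => intro _ h; rwa [List.foldr_nil, listEval_fold hζ.pow_eq_one] at h
    | cons k ks ih =>
      intro hks h
      rw [List.foldr_cons, listEval_fold hζ.pow_eq_one, listEval_shiftSub] at h
      refine ih (fun k hk => hks k (List.mem_cons_of_mem _ hk)) ((mul_eq_zero.mp h).resolve_left ?_)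
      have h3 := hks k List.mem_cons_self
      exact sub_ne_zero.mpr (hζ.pow_ne_one_of_pos_of_lt h3.1.ne' h3.2)
  exact h2 ks hks h1

/-- A certificate that the polynomial with coefficients `α` generates, together with the
cyclotomic polynomial, the ideal of polynomials vanishing at `g`, and is invertible modulo
`X ^ (p - 1) - 1` up to the factor `m`. -/
def Certificate (p g m : ℕ) (α β u w : List ℤ) (ks : List ℕ) : Prop :=
  (∀ k < p - 1, 0 < k → g ^ k % p ≠ 1) ∧ g ^ (p - 1) % p = 1 % p ∧ m ≠ 0 ∧ Nat.gcd m (p - 1) = 1 ∧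
  (listFold (p - 1) (listAdd (listMul α β) [-m])).all (· == 0) = true ∧
  listEval (g : ℤ) α % p = 0 ∧ (∀ k ∈ ks, 0 < k ∧ k < p - 1) ∧
  vanishes (p - 1) ks (listAdd (listMul α u) [-p]) = true ∧
  vanishes (p - 1) ks (listAdd (listMul α w) [g, -1]) = true

instance (p g m : ℕ) (α β u w : List ℤ) (ks : List ℕ) :
    Decidable (Certificate p g m α β u w ks) := by
  unfold Certificate
  infer_instance

theorem natCast_pow_eq_one_iff {p g k : ℕ} (h : 1 < p) : (g : ZMod p) ^ k = 1 ↔ g ^ k % p = 1 := by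
  rw [← Nat.cast_pow, ← Nat.cast_one, ZMod.natCast_eq_natCast_iff', Nat.mod_eq_of_lt h]

theorem gen_of_certificate {p g m : ℕ} [hp : Fact p.Prime] {α β u w : List ℤ} {ks : List ℕ}
    (h : Certificate p g m α β u w ks) : IsPrimitiveRoot (g : ZMod p) (p - 1) ∧
      Gen p (g : ZMod p) (listEval (X : ℤ[X]) α) := by
  obtain ⟨h1, h2, -, -, -, h3, h4, h5, h6⟩ := h
  have hn := p_sub_one_pos (p := p)
  rw [Nat.mod_eq_of_lt hp.out.one_lt] at h2
  have hg : IsPrimitiveRoot (g : ZMod p) (p - 1) :=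
    IsPrimitiveRoot.mk_of_lt _ hn ((natCast_pow_eq_one_iff hp.out.one_lt).mpr h2)
      fun k hk hk' => mt (natCast_pow_eq_one_iff hp.out.one_lt).mp (h1 k hk' hk)
  have hζ := Complex.isPrimitiveRoot_exp (p - 1) hn.ne'
  set I := Ideal.span {listEval (X : ℤ[X]) α, cyclotomic (p - 1) ℤ} with hI
  have hmem : ∀ v c : List ℤ, vanishes (p - 1) ks (listAdd (listMul α v) c) = true →
      listEval (X : ℤ[X]) c ∈ I := by
    intro v c hv
    have h7 : aeval (Complex.exp (2 * Real.pi * Complex.I / (p - 1 : ℕ)))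
        (listEval (X : ℤ[X]) (listAdd (listMul α v) c)) = 0 := by
      rw [map_listEval, aeval_X]
      exact listEval_eq_zero_of_vanishes h4 hv hζ
    have h8 : listEval (X : ℤ[X]) (listAdd (listMul α v) c) ∈ I :=
      I.mem_of_dvd (cyclotomic_dvd_of_aeval_eq_zero hn hζ h7) (Ideal.subset_span (by simp))
    rw [listEval_add, listEval_mul] at h8
    exact (I.add_mem_iff_right (I.mul_mem_right _ (Ideal.subset_span (by simp)))).mp h8
  have hp' := hmem u _ h5
  have hX := hmem w _ h6
  refine ⟨hg, ⟨fun f => ⟨fun hf => ?_, fun hf => ?_⟩⟩⟩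
  · have h7 : (X - C (g : ℤ) : ℤ[X]) ∣ f - C (f.eval (g : ℤ)) := X_sub_C_dvd_sub_C_eval
    obtain ⟨q, hq⟩ := h7
    have h8 : ((f.eval (g : ℤ) : ℤ) : ZMod p) = 0 := by
      rw [← hf, aeval_def, eval₂_at_natCast]
      simp
    rw [ZMod.intCast_zmod_eq_zero_iff_dvd] at h8
    obtain ⟨c, hc⟩ := h8
    have h9 : f = (-q) * listEval X [(g : ℤ), -1] + (-C c) * listEval X [-(p : ℤ)] := by
      rw [sub_eq_iff_eq_add.mp hq, hc]
      simp [listEval]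
      ring
    rw [h9]
    exact I.add_mem (I.mul_mem_left _ hX) (I.mul_mem_left _ hp')
  · have hle : I ≤ RingHom.ker (aeval (R := ℤ) (g : ZMod p)) := by
      rw [hI, Ideal.span_le]
      rintro q (rfl | rfl)
      · rw [SetLike.mem_coe, RingHom.mem_ker, map_listEval, aeval_X]
        have h7 := congrArg (Int.cast : ℤ → ZMod p) (Int.emod_add_mul_ediv (listEval (g : ℤ) α) p)
        rw [h3] at h7
        have h8 : ((listEval (g : ℤ) α : ℤ) : ZMod p) = listEval ((Int.castRingHom (ZMod p)) g) α :=
          map_listEval (Int.castRingHom (ZMod p)) _ _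
        rw [← h7] at h8
        simpa using h8.symm
      · rw [SetLike.mem_coe, RingHom.mem_ker, aeval_def, eval₂_eq_eval_map, map_cyclotomic]
        exact hg.isRoot_cyclotomic hn
    exact hle hf

theorem nonempty_algEquiv_of_certificate' {p : ℕ} (hp : p.Prime) {g m : ℕ} {α β u w : List ℤ}
    {ks : List ℕ} (h : Certificate p g m α β u w ks)
    (σ : FractionRing (MvPolynomial (Fin p) ℚ) ≃ₐ[ℚ] FractionRing (MvPolynomial (Fin p) ℚ))
    (hσ : ∀ i : Fin p,
      σ (algebraMap (MvPolynomial (Fin p) ℚ) (FractionRing (MvPolynomial (Fin p) ℚ))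
          (MvPolynomial.X i)) =
        algebraMap (MvPolynomial (Fin p) ℚ) (FractionRing (MvPolynomial (Fin p) ℚ))
          (MvPolynomial.X (finRotate p i))) :
    Nonempty ((IntermediateField.fixedField (Subgroup.zpowers σ)) ≃ₐ[ℚ]
        FractionRing (MvPolynomial (Fin p) ℚ)) := by
  have : Fact p.Prime := ⟨hp⟩
  obtain ⟨hg, hα⟩ := gen_of_certificate h
  obtain ⟨-, -, hm0, hm, hβ, -⟩ := h
  obtain ⟨γ, hγ⟩ : (X ^ (p - 1) - 1 : ℤ[X]) ∣ listEval X α * listEval X β - C (m : ℤ) := by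
    rw [← Ideal.mem_span_singleton, ← Ideal.Quotient.eq_zero_iff_mem]
    set π := Ideal.Quotient.mk (Ideal.span {(X ^ (p - 1) - 1 : ℤ[X])})
    have hz : π X ^ (p - 1) = 1 := by
      rw [← sub_eq_zero, ← map_pow, ← map_one π, ← map_sub, Ideal.Quotient.eq_zero_iff_mem]
      exact Ideal.mem_span_singleton_self _
    have h1 := listEval_eq_zero (π X) _ hβ
    rw [listEval_fold hz, ← map_listEval, listEval_add, listEval_mul] at h1
    rw [← h1]
    congr 1
    simp [listEval, sub_eq_add_neg]
  exact nonempty_algEquiv_of_certificate hg (β := listEval X β) (γ := γ) (m := m)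
    (by linear_combination hγ) (Nat.isCoprime_iff_coprime.mpr hm) (Nat.cast_ne_zero.mpr hm0) hα σ hσ

theorem exists_certificate {p : ℕ}
    (hp : p ∈ ({2, 3, 5, 7, 11, 13, 17, 19, 23, 29, 31, 37, 41, 43, 61, 67, 71} : Finset ℕ)) :
    ∃ g m α β u w ks, Certificate p g m α β u w ks := by
  simp only [Finset.mem_insert, Finset.mem_singleton] at hp
  obtain rfl | rfl | rfl | rfl | rfl | rfl | rfl | rfl | rfl | rfl | rfl | rfl | rfl | rfl | rfl |
    rfl | rfl := hp
  · refine ⟨1, 2, [2], [1], [1], [], [], ?_⟩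
    decide +kernel
  · refine ⟨2, 3, [1, -2], [-1, -2], [1], [-1], [1], ?_⟩
    decide +kernel
  · refine ⟨3, 15, [1, -2], [-1, -2, -4, -8], [1, 2], [-1, -1], [2], ?_⟩
    decide +kernel
  · refine ⟨5, 7, [1, 0, -2], [-1, 0, -2, 0, -4], [1, 2], [-1, -1], [3, 2], ?_⟩
    decide +kernel
  · refine ⟨6, 1023, [1, -2], [-1, -2, -4, -8, -16, -32, -64, -128, -256, -512], [-5, 6, -4, 8],
      [2, -3, 2, -4], [5, 2], ?_⟩
    decide +kernel
  · refine ⟨11, 65, [1, -2, 2], [1, 2, 2, 0, -4, -8, -8, 0, 16, 32, 32], [9, 2, -10, -8], [-7,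
      -1, 8, 6], [6, 4], ?_⟩
    decide +kernel
  · refine ⟨6, 51, [1, -1, 0, -1], [19, 6, -16, 3, 9, -7, -4, 5, -2, -6, -1, -3, -9, -10, -13,
      -22], [7, 4, -5, 2, 6, 1, 3, 9], [-3, -1, 2, -1, -2, 0, -1, -3], [8], ?_⟩
    decide +kernel
  · refine ⟨13, 19, [1, 0, -2, 0, 0, 0, 0, 0, 0, 0, 0, 0, 2], [-5, 0, 6, 0, 12, 0, 4, 0, -8, 0,
      0, 0, 10, 0, 8, 0, -8], [-9, -8, 14, -6, 20, -16], [7, 5, -10, 4, -14, 12], [9, 6], ?_⟩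
    decide +kernel
  · refine ⟨19, 4623, [1, -1, 0, -1], [1769, 472, -1429, 340, 812, -617, -277, 535, -82, -359,
      176, 94, -265, -89, 5, -260, -349, -344, -604, -953, -1297, -1901], [-2, 14, -17, 12, -5, 9,
      -10, 16, -6, 15], [1, -11, 14, -10, 4, -7, 8, -13, 5, -12], [11, 2], ?_⟩
    decide +kernel
  · refine ⟨8, 435, [1, -1, 0, 0, 1], [121, -22, -56, 77, -44, -22, 34, -43, 1, 23, -11, 32, 31,
      8, 19, -13, -44, -52, -71, -58, -14, 38, 109, 167, 181, 143, 34, -133], [7, -10, -1, 18, 2,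
      -7, 3, 4, -7, -19, -13, 2], [-2, 3, 0, -5, 0, 2, -1, -1, 2, 5, 3, -1], [14, 4], ?_⟩
    decide +kernel
  · refine ⟨13, 2177442883, [2, -1, 0, 0, -2], [698212040, 633226968, -139696954, -1014759712,
      190832184, 728643060, 224624576, -902447424, -260391528, 598447296, 523848224, -640523312,
      -580653184, 308120704, 677908576, -301569024, -731437696, -57598144, 649109504, 22985728,
      -719944832, -417570560, 440324224, 243147840, -598370912, -716756016, 81946216, 284120948,
      -456310438, -944911235], [33, 26, -29, -71, -17, 42, 39, 5], [-14, -10, 13, 29, 5, -18, -15,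
      -1], [15, 10, 6], ?_⟩
    decide +kernel
  · refine ⟨24, 24605, [1, -1, 0, 1], [4247, -3466, 2313, -1934, 1532, -781, 1153, -379, 402,
      -751, -372, -774, -23, 349, 1123, 1146, 797, -326, -1472, -2269, -1943, -471, 1798, 3741,
      4212, 2414, -1327, -5539, -7953, -6626, -1087, 6866, 13492, 14579, 7713, -5779], [7, 8, 25,
      18, 10, -15, -3, -14, -16, -13, 1, 17], [-5, -5, -16, -11, -6, 10, 2, 9, 10, 8, -1, -11],
      [18, 12], ?_⟩
    decide +kernel
  · refine ⟨19, 467687, [1, -1, 0, 0, -1], [199720, 101305, -15248, -192074, 7646, 108951,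
      93703, -98371, -90725, 18226, 111929, 13558, -77167, -58941, 52988, 66546, -10621, -69562,
      -16574, 49972, 39351, -30211, -46785, 3187, 42538, 12327, -34458, -31271, 11267, 23594,
      -10864, -42135, -30868, -7274, -18138, -60273, -91141, -98415, -116553, -176826], [7, 9, -6,
      -37, 4, 11, 20, 14, -16, -3, 2, -15, 3, -2, 15, 31], [-4, -4, 3, 17, -2, -5, -9, -6, 7, 1,
      -1, 7, -1, 1, -7, -14], [20, 8], ?_⟩
    decide +kernel
  · refine ⟨3, 577361, [1, -1, 0, 0, 0, 0, -1], [107231, -26764, 682, 94383, 94886, -129263,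
      -22032, -48796, -48114, 46269, 141155, 11892, -10140, -58936, -107050, -60781, 80374, 92266,
      82126, 23190, -83860, -144641, -64267, 27999, 110125, 133315, 49455, -95186, -159453,
      -131454, -21329, 111986, 161441, 66255, -93198, -224652, -245981, -133995, 27446, 93701,
      503, -224149], [27, -7, -31, -23, -6, -2, 12, 4, 3, 17, 20, 5], [-2, 1, 2, 1, 0, 0, -1, 0,
      0, -1, -1], [21, 14, 6], ?_⟩
    decide +kernel
  · refine ⟨6, 1065353471, [1, -1, 0, 0, 0, 0, 0, 0, 0, 0, 0, 0, 0, 0, 0, 0, -1], [264249535,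
      -4194049, -4226689, -97793, 8192766, 16451066, 16256496, -909348, -35372104, -71006344,
      -75430144, -17170928, 99871776, 200792096, 135254016, -264249408, 127, -4193922, -8420611,
      -8518404, -325638, 16125428, 32381924, 31472576, -3899528, -74905872, -150336016,
      -167506944, -67635168, 133156928, 268410944, 4161536, 4161663, -32259, -8452870, -16971274,
      -17296912, -1171484, 31210440, 62683016, 58783488, -16122384, -166458400, -333965344,
      -401600512, -268443584, -32640, 4128896, 8290559, 8258300, -194570, -17165844, -34462756,
      -35634240, -4423800, 58259216, 117042704, 100920320, -65538080, -399503424], [14, 43, 11,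
      12, 2, -20, 3, -30, -19, -54, -23, -14, 18, 64, 45, 38], [-2, -4, -1, -1, 0, 2, 0, 3, 2, 5,
      2, 1, -2, -6, -4, -3], [30, 20, 12], ?_⟩
    decide +kernel
  · refine ⟨7, 4994381, [1, 1, 0, -1], [884510, 666972, 503819, 380691, 286281, 217538, 163153,
      123128, 94410, 68743, 54385, 40025, 28718, 25667, 14358, 14360, 11307, 3051, 11309, -2,
      3053, 8256, -8258, 11311, -3055, -5203, 16514, -19569, 14366, 2148, -21717, 36083, -33935,
      12218, 23865, -57800, 70018, -46153, -11647, 81665, -127818, 116171, -34506, -93312, 209483,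
      -243989, 150677, 58806, -302795, 453472, -394666, 91871, 361601, -756267, 848138, -486537,
      -269730, 1117868, -1604405, 1334675, -216807, -1387598, 2722273, -2939080, 1551482,
      1170791], [-12, 15, 50, 0, 12, -27, -35, 50, -12, 39, 8, -6, -20, -34, 31, 14, 14, 14, -65,
      17], [1, -2, -5, 1, -1, 3, 3, -6, 2, -4, 0, 1, 2, 3, -4, -1, -1, -1, 7, -3], [33, 22, 6],
      ?_⟩
    decide +kernel
  · refine ⟨31, 11656357053, [1, -1, 0, 0, 0, 0, 0, 0, 0, 0, 0, 0, 0, 0, 0, -1], [4668576914,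
      896353717, -1431385051, -883982213, 197012594, 366419833, -28216216, -278012507, -196729441,
      76241728, 442298726, 815412043, 844112426, -285238562, -3772206814, 896370100, 1792723817,
      361338766, -522643447, -325630853, 40788980, 12572764, -265439743, -462169184, -385927456,
      56371270, 871783313, 1715895739, 1430657177, -2341549637, -1445179537, 347544280, 708883046,
      186239599, -139391254, -98602274, -86029510, -351469253, -813638437, -1199565893,
      -1143194623, -271411310, 1444484429, 2875141606, 533591969, -911587568, -564043288,
      144839758, 331079357, 191688103, 93085829, 7056319, -344412934, -1158051371, -2357617264,
      -3500811887, -3772223197, -2327738768, 547402838, 1080994807, 169407239, -394636049,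
      -249796291, 81283066, 272971169, 366056998, 373113317, 28700383, -1129350988, -3486968252],
      [50, 31, 1, -16, -28, -28, -28, -28, -28, 22, 53, 54, 38, 10, -39, -15, -23, -37, -26, 11,
      37, 47, 29, 12], [-22, -13, 0, 7, 12, 12, 12, 12, 12, -10, -23, -23, -16, -4, 17, 6, 10, 16,
      11, -5, -16, -20, -12, -5], [35, 14, 10], ?_⟩
    decide +kernel

/-- `V / W` is presented by the generators `t i` and the relations `(X ^ d i - 1) • t i = 0`, that is,
it is a permutation module for the cyclic group of order `n`. -/
structure PermPres (n : ℕ) {V ι : Type*} [AddCommGroup V] [Module ℤ[X] V] [Fintype ι]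
    (W : Submodule ℤ[X] V) (t : ι → V) (d : ι → ℕ) : Prop where
  dvd : ∀ i, d i ∣ n
  exists_sub_mem : ∀ v, ∃ f : ι → ℤ[X], v - ∑ i, f i • t i ∈ W
  sum_mem_iff : ∀ f : ι → ℤ[X], ∑ i, f i • t i ∈ W ↔ ∀ i, X ^ d i - 1 ∣ f i

/-- The quotient of `X ^ n - 1` by the `n`-th cyclotomic polynomial. -/
noncomputable def coCyclotomic (n : ℕ) : ℤ[X] := ∏ i ∈ n.properDivisors, cyclotomic i ℤ

theorem cyclotomic_mul_coCyclotomic {n : ℕ} (hn : 0 < n) :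
    cyclotomic n ℤ * coCyclotomic n = X ^ n - 1 := by
  rw [coCyclotomic, ← prod_cyclotomic_eq_X_pow_sub_one hn, ← Nat.cons_self_properDivisors hn.ne',
    Finset.prod_cons]

theorem X_pow_sub_one_dvd_coCyclotomic {n d : ℕ} (hn : 0 < n) (hd : d ∣ n) (h : d ≠ n) :
    X ^ d - 1 ∣ coCyclotomic n := by
  have hd0 := Nat.pos_of_dvd_of_pos hd hn
  rw [← prod_cyclotomic_eq_X_pow_sub_one hd0, coCyclotomic]
  refine Finset.prod_dvd_prod_of_subset _ _ _ fun x hx => ?_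
  rw [Nat.mem_divisors] at hx
  rw [Nat.mem_properDivisors]
  exact ⟨hx.1.trans hd, (Nat.le_of_dvd hd0 hx.1).trans_lt ((Nat.le_of_dvd hn hd).lt_of_ne h)⟩

theorem coCyclotomic_ne_zero {K : Type*} [Field K] {n : ℕ} (hn : 0 < n) {g : K}
    (hg : IsPrimitiveRoot g n) : aeval g (coCyclotomic n) ≠ 0 := by
  rw [coCyclotomic, map_prod]
  refine Finset.prod_ne_zero_iff.mpr fun i hi h0 => ?_
  rw [Nat.mem_properDivisors] at hi
  have hi0 := Nat.pos_of_dvd_of_pos hi.1 hn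
  have h1 : aeval g (X ^ i - 1 : ℤ[X]) = 0 := by
    obtain ⟨q, hq⟩ := cyclotomic.dvd_X_pow_sub_one i ℤ
    rw [hq, map_mul, h0, zero_mul]
  rw [map_sub, map_pow, aeval_X, map_one, sub_eq_zero] at h1
  exact hg.pow_ne_one_of_pos_of_lt hi0.ne' hi.2 h1

section

variable {n : ℕ} {V R ι : Type*} [AddCommGroup V] [Module ℤ[X] V] [Fintype ι] [CommRing R]
  {W : Submodule ℤ[X] V} {t : ι → V} {d : ι → ℕ}

theorem PermPres.exists_coordinates (h : PermPres n W t d) (hn : 0 < n) {π : ℤ[X] →+* R}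
    (hπ : ∀ f, π f = 0 ↔ cyclotomic n ℤ ∣ f) :
    ∃ lam : V →ₛₗ[π] ({i // d i = n} → R), (∀ w ∈ W, lam w = 0) ∧
      (∀ j k : {i // d i = n}, (k = j → lam (t j) k = 1) ∧ (k ≠ j → lam (t j) k = 0)) ∧
      ∀ v, lam v = 0 → coCyclotomic n • v ∈ W := by
  classical
  choose f hf using h.exists_sub_mem
  have key : ∀ v (f' : ι → ℤ[X]), v - ∑ i, f' i • t i ∈ W → ∀ j : {i // d i = n},
      π (f v j) = π (f' j) := by
    intro v f' hf' j
    have h1 := W.sub_mem hf' (hf v)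
    rw [sub_sub_sub_cancel_left, ← Finset.sum_sub_distrib] at h1
    simp_rw [← sub_smul] at h1
    have h2 := (h.sum_mem_iff _).mp h1 j
    rw [j.2] at h2
    rw [← sub_eq_zero, ← map_sub, hπ]
    exact (cyclotomic.dvd_X_pow_sub_one n ℤ).trans h2
  refine ⟨{ toFun := fun v j => π (f v j), map_add' := fun v v' => ?_, map_smul' := fun c v => ?_ },
    fun w hw => ?_, fun j k => ?_, fun v hv => ?_⟩
  · ext j
    rw [Pi.add_apply, ← map_add]
    refine key (v + v') (fun i => f v i + f v' i) ?_ j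
    simp_rw [add_smul]
    rw [Finset.sum_add_distrib, add_sub_add_comm]
    exact W.add_mem (hf v) (hf v')
  · ext j
    rw [Pi.smul_apply, smul_eq_mul, ← map_mul]
    refine key (c • v) (fun i => c * f v i) ?_ j
    simp_rw [mul_smul]
    rw [← Finset.smul_sum, ← smul_sub]
    exact W.smul_mem c (hf v)
  · ext j
    have h1 := key w 0 (by simpa using hw) j
    simpa using h1
  · have h1 : π (f (t j) k) = _ := key (t j) (Pi.single j 1) (by simp [Pi.single_apply, ite_smul]) k
    refine ⟨fun h2 => ?_, fun h2 => ?_⟩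
    · refine h1.trans ?_
      rw [h2, Pi.single_eq_same, map_one]
    · refine h1.trans ?_
      rw [Pi.single_eq_of_ne (fun h3 => h2 (Subtype.ext h3)), map_zero]
  · have h1 : ∀ i, (X ^ d i - 1 : ℤ[X]) ∣ coCyclotomic n * f v i := by
      intro i
      by_cases hi : d i = n
      · have h2 : π (f v i) = 0 := congrFun hv ⟨i, hi⟩
        rw [hi, ← cyclotomic_mul_coCyclotomic hn, mul_comm]
        exact mul_dvd_mul_left _ ((hπ _).mp h2)
      · exact Dvd.dvd.mul_right (X_pow_sub_one_dvd_coCyclotomic hn (h.dvd i) hi) _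
    have h2 := W.add_mem (W.smul_mem (coCyclotomic n) (hf v)) ((h.sum_mem_iff _).mpr h1)
    simp_rw [mul_smul] at h2
    rwa [← Finset.smul_sum, ← smul_add, sub_add_cancel] at h2

end

theorem smul_eq_C_eval_one_smul {V : Type*} [AddCommGroup V] [Module ℤ[X] V] {y : V}
    (hy : (X : ℤ[X]) • y = y) (f : ℤ[X]) : f • y = (C (f.eval 1) : ℤ[X]) • y := by
  obtain ⟨q, hq⟩ : (X - C 1 : ℤ[X]) ∣ f - C (f.eval 1) := X_sub_C_dvd_sub_C_eval
  rw [← sub_eq_zero, ← sub_smul, hq, mul_comm, mul_smul, C_1, sub_smul, hy, one_smul, sub_self,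
    smul_zero]

theorem exists_gen_of_permPres {p : ℕ} [hp : Fact p.Prime] {g : ZMod p}
    (hg : IsPrimitiveRoot g (p - 1)) (hn : 2 ≤ p - 1) {V ι κ : Type*} [AddCommGroup V]
    [Module ℤ[X] V] [Fintype ι] [Fintype κ] {W A : Submodule ℤ[X] V} {t : ι → V} {d : ι → ℕ}
    {s : κ → V} {e : κ → ℕ} (hW : PermPres (p - 1) W t d) (hA : PermPres (p - 1) A s e)
    (hV : ∀ v : V, (X ^ (p - 1) - 1 : ℤ[X]) • v = 0) {y : V} (hy : (X : ℤ[X]) • y = y)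
    {Y : RingHom.ker (aeval (R := ℤ) g) →ₗ[ℤ[X]] V}
    (hmem : ∀ v, v ∈ A ↔ ∃ w ∈ W, ∃ (a : ℤ) (x : _), v = w + (C a : ℤ[X]) • y + Y x)
    (hind : ∀ (a : ℤ) x, (C a : ℤ[X]) • y + Y x ∈ W → a = 0 ∧ X ^ (p - 1) - 1 ∣ (x : ℤ[X])) :
    ∃ α, Gen p g α := by
  classical
  set n := p - 1 with hndef
  have hn0 : 0 < n := by omega
  have hΦprime : Prime (cyclotomic n ℤ) := (cyclotomic.irreducible hn0).prime
  have : (Ideal.span {cyclotomic n ℤ}).IsPrime :=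
    (Ideal.span_singleton_prime hΦprime.ne_zero).mpr hΦprime
  let R := ℤ[X] ⧸ Ideal.span {cyclotomic n ℤ}
  let π : ℤ[X] →+* R := Ideal.Quotient.mk _
  have hπ : ∀ f, π f = 0 ↔ cyclotomic n ℤ ∣ f := fun f => by
    rw [Ideal.Quotient.eq_zero_iff_mem, Ideal.mem_span_singleton]
  have hπs : Function.Surjective π := Ideal.Quotient.mk_surjective
  have hψ := cyclotomic_mul_coCyclotomic hn0
  set ψ := coCyclotomic n
  have hψ0 : π ψ ≠ 0 := by
    rw [Ne, hπ]
    rintro ⟨q, hq⟩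
    have h1 := coCyclotomic_ne_zero hn0 (Complex.isPrimitiveRoot_exp n hn0.ne')
    refine h1 ?_
    change aeval _ ψ = 0
    rw [hq, map_mul, aeval_def, eval₂_eq_eval_map, map_cyclotomic,
      (Complex.isPrimitiveRoot_exp n hn0.ne').isRoot_cyclotomic hn0, zero_mul]
  have hψg : aeval g ψ ≠ 0 := coCyclotomic_ne_zero hn0 hg
  have hp0 : π (p : ℤ[X]) ≠ 0 := by
    rw [Ne, hπ]
    intro h
    have h1 := natDegree_le_of_dvd h (Nat.cast_ne_zero.mpr hp.out.ne_zero)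
    rw [natDegree_natCast, natDegree_cyclotomic] at h1
    exact (Nat.totient_pos.mpr hn0).not_ge h1
  have hdvd : ∀ f, X ^ n - 1 ∣ ψ * f ↔ cyclotomic n ℤ ∣ f := fun f => by
    rw [← hψ, mul_comm]
    exact mul_dvd_mul_iff_left fun h => hψ0 (by rw [h, map_zero])
  have hdvd' : ∀ f, X ^ n - 1 ∣ cyclotomic n ℤ * f ↔ ψ ∣ f := fun f => by
    rw [← hψ]
    exact mul_dvd_mul_iff_left hΦprime.ne_zero
  have hΦg : aeval g (cyclotomic n ℤ) = 0 := by
    rw [aeval_def, eval₂_eq_eval_map, map_cyclotomic]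
    exact hg.isRoot_cyclotomic hn0
  obtain ⟨lam, hlamW, hlamt, hlam⟩ := hW.exists_coordinates hn0 hπ
  have hlamy : lam y = 0 := by
    have h1 : lam ((X - 1 : ℤ[X]) • y) = 0 := by rw [sub_smul, hy, one_smul, sub_self, map_zero]
    rw [map_smulₛₗ] at h1
    refine (smul_eq_zero.mp h1).resolve_left ?_
    rw [hπ]
    intro h
    have h2 := eval_dvd (x := (Complex.exp (2 * Real.pi * Complex.I / n)))
      (Polynomial.map_dvd (Int.castRingHom ℂ) h)
    have h3 := (Complex.isPrimitiveRoot_exp n hn0.ne')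
    rw [map_cyclotomic, h3.isRoot_cyclotomic hn0, zero_dvd_iff] at h2
    simp only [Polynomial.map_sub, map_X, Polynomial.map_one, eval_sub, eval_X, eval_one] at h2
    rw [sub_eq_zero.mp h2] at h3
    have h4 := h3.unique IsPrimitiveRoot.one
    omega
  let pI : RingHom.ker (aeval (R := ℤ) g) := ⟨p, by rw [RingHom.mem_ker, map_natCast, CharP.cast_eq_zero]⟩
  have hYp : ∀ x, (p : ℤ[X]) • Y x = (x : ℤ[X]) • Y pI := by
    intro x
    rw [← map_smul, ← map_smul]
    congr 1
    exact Subtype.ext (mul_comm _ _)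
  have hYA : ∀ x, Y x ∈ A := fun x =>
    (hmem _).mpr ⟨0, W.zero_mem, 0, x, by rw [C_0, zero_smul, zero_add, zero_add]⟩
  have hWA : W ≤ A := fun w hw =>
    (hmem _).mpr ⟨w, hw, 0, 0, by rw [C_0, zero_smul, map_zero, add_zero, add_zero]⟩
  let c : Option {i // e i = n} → V := fun o => o.elim (Y pI) fun i => s i
  have hexpand : ∀ j : {i // d i = n}, ∃ (x : RingHom.ker (aeval (R := ℤ) g))
      (f : {i // e i = n} → ℤ[X]), lam (t j) = lam (Y x) + ∑ i, π (f i) • lam (s i) := by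
    intro j
    obtain ⟨f, hf⟩ := hA.exists_sub_mem (t j)
    set z := t j - ∑ i : {i // e i = n}, f i • s i with hz
    have hzA : ψ • z ∈ A := by
      have h1 : z = (t j - ∑ i, f i • s i) + ∑ i : {i // e i ≠ n}, f i • s i := by
        rw [hz, ← Fintype.sum_subtype_add_sum_subtype (fun i => e i = n)]
        abel
      rw [h1, smul_add]
      refine A.add_mem (A.smul_mem _ hf) ?_
      rw [Finset.smul_sum]
      refine A.sum_mem fun i _ => ?_
      rw [smul_comm]
      refine A.smul_mem _ ?_
      obtain ⟨q, hq⟩ := X_pow_sub_one_dvd_coCyclotomic hn0 (hA.dvd i) i.2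
      have h2 : ∑ k, (Pi.single (i : κ) ψ : κ → ℤ[X]) k • s k ∈ A := by
        rw [hA.sum_mem_iff]
        intro k
        by_cases hk : k = i
        · rw [hk, Pi.single_eq_same]
          exact ⟨q, hq⟩
        · rw [Pi.single_eq_of_ne hk]
          exact dvd_zero _
      simpa [Pi.single_apply, ite_smul] using h2
    obtain ⟨w, hw, a, x, hx⟩ := (hmem _).mp hzA
    have h1 : cyclotomic n ℤ • ψ • z = 0 := by rw [← mul_smul, hψ, hV]
    rw [hx, smul_add, smul_add, add_assoc, ← mul_smul, smul_eq_C_eval_one_smul hy,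
      ← map_smul] at h1
    have h2 := hind _ _ ((W.add_mem_iff_right (W.smul_mem _ hw)).mp (h1 ▸ W.zero_mem))
    obtain ⟨x', hx'⟩ := (hdvd' _).mp h2.2
    have hx'I : x' ∈ RingHom.ker (aeval (R := ℤ) g) := by
      have h3 : aeval g (x : ℤ[X]) = 0 := x.2
      rw [hx', map_mul] at h3
      exact (mul_eq_zero.mp h3).resolve_left hψg
    refine ⟨⟨x', hx'I⟩, fun i => f i, ?_⟩
    have h4 : Y x = ψ • Y ⟨x', hx'I⟩ := by
      rw [← map_smul]
      congr 1
      exact Subtype.ext hx'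
    have h5 : π ψ • lam z = π ψ • lam (Y ⟨x', hx'I⟩) := by
      rw [← map_smulₛₗ, ← map_smulₛₗ, ← h4, hx, map_add, map_add, hlamW w hw, map_smulₛₗ, hlamy,
        smul_zero, zero_add, zero_add]
    have h6 := smul_right_injective _ hψ0 h5
    rw [← h6, hz, map_sub, map_sum]
    simp_rw [map_smulₛₗ]
    rw [sub_add_cancel]
  choose x f hxf using hexpand
  let M₁ : Matrix {i // d i = n} (Option {i // e i = n}) R := Matrix.of fun j o => lam (c o) j
  let D : Option {i // e i = n} → R := fun o => o.elim 1 fun _ => π p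
  let M₂ : Matrix (Option {i // e i = n}) {i // d i = n} R :=
    Matrix.of fun o j => o.elim (π (x j)) fun i => π (f j i)
  have hmul : M₁ * (Matrix.diagonal D * M₂) = π p • (1 : Matrix _ _ R) := by
    ext k j
    rw [Matrix.mul_apply, Fintype.sum_option, Matrix.smul_apply, Matrix.one_apply]
    have h1 := congrFun (hxf j) k
    have h2 : π p * lam (Y (x j)) k = π (x j) * lam (Y pI) k := by
      have h3 := congrFun (congrArg lam (hYp (x j))) k
      rw [map_smulₛₗ, map_smulₛₗ] at h3
      exact h3
    have h3 : lam (t j) k = if k = j then 1 else 0 := by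
      split_ifs with h4
      · exact (hlamt j k).1 h4
      · exact (hlamt j k).2 h4
    rw [smul_eq_mul, ← h3, h1, Pi.add_apply, mul_add, h2, Finset.sum_apply, Finset.mul_sum]
    congr 1
    · rw [Matrix.diagonal_mul]
      change lam (Y pI) k * (1 * π (x j)) = _
      ring
    · refine Finset.sum_congr rfl fun i _ => ?_
      rw [Matrix.diagonal_mul]
      change lam (s i) k * (π p * π (f j i)) = π p * (π (f j i) * lam (s i) k)
      ring
  have hinj : Function.Injective M₁.mulVecLin := by
    rw [injective_iff_map_eq_zero]
    intro r hr
    choose r' hr' using fun o => hπs (r o)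
    have h1 : lam (∑ o, r' o • c o) = 0 := by
      rw [map_sum]
      ext k
      have h2 := congrFun hr k
      rw [Matrix.mulVecLin_apply, Matrix.mulVec, dotProduct] at h2
      rw [Finset.sum_apply, ← h2]
      refine Finset.sum_congr rfl fun o _ => ?_
      rw [map_smulₛₗ, Pi.smul_apply, smul_eq_mul, hr', mul_comm]
      rfl
    have h2 := hlam _ h1
    rw [Fintype.sum_option, smul_add] at h2
    simp only [c, Option.elim_none, Option.elim_some] at h2
    have h3 : ∀ i : {i // e i = n}, cyclotomic n ℤ ∣ r' (some i) := by
      have h4 : ψ • ∑ i : {i // e i = n}, r' (some i) • s i ∈ A := by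
        refine (A.add_mem_iff_right ?_).mp (hWA h2)
        exact A.smul_mem _ (A.smul_mem _ (hYA pI))
      have h5 : ∑ i, (if h : e i = n then ψ * r' (some ⟨i, h⟩) else 0) • s i ∈ A := by
        rw [← Fintype.sum_subtype_add_sum_subtype (fun i => e i = n)]
        convert h4 using 1
        rw [Finset.smul_sum, add_eq_left.mpr]
        · refine Finset.sum_congr rfl fun i _ => ?_
          rw [dif_pos i.2, mul_smul]
        · refine Finset.sum_eq_zero fun i _ => ?_
          rw [dif_neg i.2, zero_smul]
      intro i
      have h6 := (hA.sum_mem_iff _).mp h5 i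
      rw [dif_pos i.2, i.2, hdvd] at h6
      exact h6
    have h4 : ψ • r' none • Y pI ∈ W := by
      refine (W.add_mem_iff_left ?_).mp h2
      rw [Finset.smul_sum]
      refine W.sum_mem fun i _ => ?_
      obtain ⟨q, hq⟩ := h3 i
      rw [hq, ← mul_smul, ← mul_assoc, mul_comm ψ, hψ, mul_comm, mul_smul, hV, smul_zero]
      exact W.zero_mem
    rw [← mul_smul, ← map_smul] at h4
    have h5 := (hind 0 _ (by rw [C_0, zero_smul, zero_add]; exact h4)).2
    have h6 : cyclotomic n ℤ ∣ r' none * p := by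
      rw [← hdvd, ← mul_assoc]
      exact h5
    funext o
    rw [Pi.zero_apply, ← hr' o]
    cases o with
    | none =>
      have h7 := (hπ _).mpr h6
      rw [map_mul] at h7
      exact (mul_eq_zero.mp h7).resolve_right hp0
    | some i => exact (hπ _).mpr (h3 i)
  have hinj' : Function.Injective (Matrix.diagonal D * M₂).mulVecLin := by
    rw [injective_iff_map_eq_zero]
    intro r hr
    have h1 : (M₁ * (Matrix.diagonal D * M₂)).mulVec r = 0 := by
      rw [← Matrix.mulVec_mulVec]
      rw [Matrix.mulVecLin_apply] at hr
      rw [hr, Matrix.mulVec_zero]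
    rw [hmul, Matrix.smul_mulVec, Matrix.one_mulVec] at h1
    exact (smul_eq_zero.mp h1).resolve_left hp0
  have hcard : Fintype.card (Option {i // e i = n}) = Fintype.card {i // d i = n} :=
    le_antisymm (card_le_of_injective R M₁.mulVecLin hinj) (card_le_of_injective R _ hinj')
  let E := Fintype.equivOfCardEq hcard
  let N₁ := M₁.submatrix id E.symm
  let N₂ := M₂.submatrix E.symm id
  have hdet : N₁.det * N₂.det = π p := by
    have h1 : N₁ * (Matrix.diagonal (D ∘ E.symm) * N₂) = π p • (1 : Matrix _ _ R) := by
      rw [← hmul]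
      ext k j
      rw [Matrix.mul_apply, Matrix.mul_apply, ← E.symm.sum_comp]
      refine Finset.sum_congr rfl fun i _ => ?_
      rw [Matrix.diagonal_mul, Matrix.diagonal_mul]
      rfl
    have h2 := congrArg Matrix.det h1
    have h3 : ∏ i, (D ∘ E.symm) i = π p ^ Fintype.card {i // e i = n} := by
      change ∏ i, D (E.symm i) = _
      rw [E.symm.prod_comp, Fintype.prod_option]
      simp [D]
    rw [Matrix.det_mul, Matrix.det_mul, Matrix.det_diagonal, h3, Matrix.det_smul, Matrix.det_one,
      mul_one, ← hcard, Fintype.card_option, pow_succ] at h2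
    have h4 : π p ^ Fintype.card {i // e i = n} ≠ 0 := pow_ne_zero _ hp0
    refine mul_left_cancel₀ h4 ?_
    rw [← h2]
    ring
  obtain ⟨α, hα⟩ := hπs N₂.det
  have hN₁ : N₁.det ≠ 0 := left_ne_zero_of_mul (hdet ▸ hp0)
  have hker : ∀ f, π f = 0 → aeval g f = 0 := by
    intro f hf
    obtain ⟨q, rfl⟩ := (hπ f).mp hf
    rw [map_mul, hΦg, zero_mul]
  have hα0 : aeval g α = 0 := by
    let φ : R →+* ZMod p := Ideal.Quotient.lift _ (aeval (R := ℤ) g).toRingHom fun f hf =>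
      hker f (Ideal.Quotient.eq_zero_iff_mem.mpr hf)
    have h1 : φ N₂.det = 0 := by
      rw [RingHom.map_det]
      refine Matrix.det_eq_zero_of_row_eq_zero (E none) fun j => ?_
      change φ (M₂ (E.symm (E none)) j) = 0
      rw [E.symm_apply_apply]
      exact (x j).2
    rw [← hα] at h1
    exact h1
  refine ⟨α, ⟨fun q => ⟨fun hq => ?_, fun hq => ?_⟩⟩⟩
  · have h1 : π q * N₁.det = π p * (N₁.updateCol (E none) (lam (Y ⟨q, hq⟩))).det := by
      rw [← Matrix.det_updateCol_smul, ← map_smulₛₗ, hYp,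
        map_smulₛₗ, Matrix.det_updateCol_smul]
      congr 2
      ext k j
      rw [Matrix.updateCol_apply]
      split_ifs with hj
      · rw [hj]
        change M₁ k (E.symm (E none)) = _
        rw [E.symm_apply_apply]
        rfl
      · rfl
    rw [← hdet, mul_comm, mul_assoc] at h1
    have h2 := mul_left_cancel₀ hN₁ h1
    obtain ⟨r, hr⟩ := hπs (N₁.updateCol (E none) (lam (Y ⟨q, hq⟩))).det
    rw [← hr, ← hα, ← map_mul, ← sub_eq_zero, ← map_sub, hπ] at h2
    obtain ⟨b, hb⟩ := h2
    exact Ideal.mem_span_pair.mpr ⟨r, b, by linear_combination -hb⟩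
  · obtain ⟨a, b, rfl⟩ := Ideal.mem_span_pair.mp hq
    rw [map_add, map_mul, map_mul, hα0, hΦg, mul_zero, mul_zero, add_zero]

/-- A basis of `V / W` permuted by `X` gives a permutation presentation. -/
theorem exists_permPres_of_perm.{u, v} {n : ℕ} (hn : 0 < n) {V : Type v} {S : Type u} [AddCommGroup V]
    [Module ℤ[X] V] [Fintype S] {W : Submodule ℤ[X] V} {q : S → V} {π : Equiv.Perm S}
    (hV : ∀ v : V, (X ^ n - 1 : ℤ[X]) • v = 0) (hq : ∀ s, (X : ℤ[X]) • q s - q (π s) ∈ W)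
    (hspan : ∀ v, ∃ m : S → ℤ, v - ∑ s, (C (m s) : ℤ[X]) • q s ∈ W)
    (hind : ∀ m : S → ℤ, ∑ s, (C (m s) : ℤ[X]) • q s ∈ W → ∀ s, m s = 0) :
    ∃ (ι : Type u) (_ : Fintype ι) (t : ι → V) (d : ι → ℕ), PermPres n W t d := by
  classical
  have hpow : ∀ (k : ℕ) s, (X ^ k : ℤ[X]) • q s - q (π^[k] s) ∈ W := by
    intro k
    induction k with
    | zero => intro s; simp
    | succ k ih =>
      intro s
      have h1 := W.add_mem (W.smul_mem (X ^ k) (hq s)) (ih (π s))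
      rwa [smul_sub, sub_add_sub_cancel, ← mul_smul, ← pow_succ, ← Function.iterate_succ_apply] at h1
  have hper : ∀ s, π^[n] s = s := by
    intro s
    by_contra hs
    have h1 : q s - q (π^[n] s) ∈ W := by
      have h2 := hpow n s
      rwa [sub_eq_zero.mp ((sub_smul _ _ _).symm.trans (hV (q s))), one_smul] at h2
    have h2 := hind (Pi.single s 1 - Pi.single (π^[n] s) 1) (by
      simpa [sub_smul, Finset.sum_sub_distrib, Pi.single_apply, apply_ite C, ite_smul] using h1) s
    rw [Pi.sub_apply, Pi.single_eq_same, Pi.single_eq_of_ne (Ne.symm hs)] at h2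
    omega
  let ι := Quotient (Equiv.Perm.SameCycle.setoid π)
  let r : ι → S := Quotient.out
  let d : ι → ℕ := fun i => Function.minimalPeriod π (r i)
  have hd0 : ∀ i, 0 < d i := fun i =>
    Function.minimalPeriod_pos_of_mem_periodicPts ⟨n, hn, hper (r i)⟩
  have hcl : ∀ i k, (Quotient.mk (Equiv.Perm.SameCycle.setoid π) (π^[k] (r i)) : ι) = i := by
    intro i k
    rw [← Quotient.out_eq i]
    refine Quotient.sound ?_
    change π.SameCycle _ _
    rw [← Equiv.Perm.coe_pow, Equiv.Perm.sameCycle_pow_left]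
    exact Quotient.mk_out (s := Equiv.Perm.SameCycle.setoid π) _
  have hbij : Function.Bijective (fun x : Σ i, Fin (d i) => π^[(x.2 : ℕ)] (r x.1)) := by
    constructor
    · rintro ⟨i, j⟩ ⟨i', j'⟩ h
      obtain rfl : i = i' := by rw [← hcl i j, ← hcl i' j']; exact congrArg _ h
      have h1 := Function.iterate_injOn_Iio_minimalPeriod (f := π) (x := r i) j.2 j'.2 h
      rw [Fin.ext h1]
    · intro s
      let i : ι := Quotient.mk _ s
      have h1 : π.SameCycle (r i) s := Quotient.mk_out (s := Equiv.Perm.SameCycle.setoid π) s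
      obtain ⟨k, -, hk⟩ := h1.exists_pow_eq'
      refine ⟨⟨i, ⟨k % d i, Nat.mod_lt _ (hd0 i)⟩⟩, ?_⟩
      change π^[k % d i] (r i) = s
      rw [Function.iterate_mod_minimalPeriod_eq, ← hk, Equiv.Perm.coe_pow]
  let θ := Equiv.ofBijective _ hbij
  have hexp : ∀ m : S → ℤ, ∑ i, (∑ j : Fin (d i), C (m (θ ⟨i, j⟩)) * X ^ (j : ℕ) : ℤ[X]) • q (r i) -
      ∑ s, (C (m s) : ℤ[X]) • q s ∈ W := by
    intro m
    rw [← θ.sum_comp, Fintype.sum_sigma, ← Finset.sum_sub_distrib]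
    refine W.sum_mem fun i _ => ?_
    rw [Finset.sum_smul, ← Finset.sum_sub_distrib]
    refine W.sum_mem fun j _ => ?_
    rw [mul_smul, ← smul_sub]
    exact W.smul_mem _ (hpow j (r i))
  have hker : ∀ i f, (X ^ d i - 1 : ℤ[X]) ∣ f → f • q (r i) ∈ W := by
    rintro i _ ⟨c, rfl⟩
    rw [mul_comm, mul_smul, sub_smul, one_smul]
    refine W.smul_mem _ ?_
    have h1 := hpow (d i) (r i)
    rwa [Function.iterate_minimalPeriod] at h1
  refine ⟨ι, inferInstance, fun i => q (r i), d, ⟨fun i => ?_, fun v => ?_, fun f => ⟨fun hf => ?_,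
    fun hf => W.sum_mem fun i _ => hker i _ (hf i)⟩⟩⟩
  · exact Function.IsPeriodicPt.minimalPeriod_dvd (hper (r i))
  · obtain ⟨m, hm⟩ := hspan v
    refine ⟨fun i => ∑ j : Fin (d i), C (m (θ ⟨i, j⟩)) * X ^ (j : ℕ), ?_⟩
    have h1 := W.sub_mem hm (hexp m)
    rwa [sub_sub_sub_cancel_right] at h1
  · have hmon : ∀ i, (X ^ d i - 1 : ℤ[X]).Monic := fun i => monic_X_pow_sub_C 1 (hd0 i).ne'
    let ρ : ι → ℤ[X] := fun i => f i %ₘ (X ^ d i - 1)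
    have hρ : ∑ i, ρ i • q (r i) ∈ W := by
      have h1 : ∑ i, (f i - ρ i) • q (r i) ∈ W := W.sum_mem fun i _ => hker i _
        ⟨f i /ₘ (X ^ d i - 1), by linear_combination -(modByMonic_add_div (f i) (X ^ d i - 1))⟩
      simp_rw [sub_smul] at h1
      rw [Finset.sum_sub_distrib] at h1
      exact (W.sub_mem_iff_right hf).mp h1
    have hρ' : ∀ i, ρ i = ∑ j : Fin (d i), C ((ρ i).coeff j) * X ^ (j : ℕ) := by
      intro i
      rw [← Finset.sum_range (fun j => C ((ρ i).coeff j) * X ^ j)]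
      refine as_sum_range_C_mul_X_pow' _ ?_
      have h1 : (X ^ d i - 1 : ℤ[X]).natDegree = d i := by rw [← C_1, natDegree_X_pow_sub_C]
      conv_rhs => rw [← h1]
      refine natDegree_modByMonic_lt _ (hmon i) fun h2 => ?_
      rw [h2, natDegree_one] at h1
      exact (hd0 i).ne h1
    let m : S → ℤ := fun s => (ρ (θ.symm s).1).coeff (θ.symm s).2
    have hm : ∀ i j, m (θ ⟨i, j⟩) = (ρ i).coeff j := by
      intro i j
      simp only [m]
      rw [Equiv.symm_apply_apply]
    have h1 := hexp m
    simp_rw [hm, ← hρ'] at h1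
    have h2 := hind m ((W.sub_mem_iff_right hρ).mp h1)
    intro i
    rw [← modByMonic_eq_zero_iff_dvd (hmon i)]
    change ρ i = 0
    rw [hρ' i]
    refine Finset.sum_eq_zero fun j _ => ?_
    rw [← hm, h2, C_0, zero_mul]

/-- The multiplicative group of `Ω`, written additively, as a `ℤ[X]`-module on which `X` acts
as `τ`. -/
def UnitsMod {Ω : Type*} [Field Ω] (_ : Ω →+* Ω) : Type _ := Additive Ωˣ

namespace UnitsMod

variable {Ω : Type*} [Field Ω] {τ : Ω →+* Ω}

instance : AddCommGroup (UnitsMod τ) := inferInstanceAs (AddCommGroup (Additive Ωˣ))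

noncomputable instance : Module ℤ[X] (UnitsMod τ) :=
  let _ : Module (Module.End ℤ (Additive Ωˣ)) (UnitsMod τ) :=
    inferInstanceAs (Module (Module.End ℤ (Additive Ωˣ)) (Additive Ωˣ))
  Module.compHom (UnitsMod τ) (aeval (unitsEnd τ) : ℤ[X] →ₐ[ℤ] _).toRingHom

/-- An element of `Ωˣ` as an element of the `ℤ[X]`-module. -/
def of (τ : Ω →+* Ω) (u : Ωˣ) : UnitsMod τ := Additive.ofMul u

/-- The element of `Ω` underlying an element of the `ℤ[X]`-module of units. -/
def val (v : UnitsMod τ) : Ω := (Additive.toMul (show Additive Ωˣ from v) : Ωˣ)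

theorem val_ne_zero (v : UnitsMod τ) : v.val ≠ 0 := Units.ne_zero _

theorem ext_val {v w : UnitsMod τ} (h : v.val = w.val) : v = w :=
  Additive.toMul.injective (Units.ext h)

@[simp] theorem val_zero : (0 : UnitsMod τ).val = 1 := rfl

@[simp] theorem val_add (v w : UnitsMod τ) : (v + w).val = v.val * w.val := rfl

@[simp] theorem val_neg (v : UnitsMod τ) : (-v).val = v.val⁻¹ := Units.val_inv_eq_inv_val _

@[simp] theorem val_sub (v w : UnitsMod τ) : (v - w).val = v.val / w.val := by
  rw [sub_eq_add_neg, val_add, val_neg, div_eq_mul_inv]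

@[simp] theorem val_X_smul (v : UnitsMod τ) : ((X : ℤ[X]) • v).val = τ v.val :=
  act_X τ _

theorem val_X_pow_smul (v : UnitsMod τ) (k : ℕ) : ((X ^ k : ℤ[X]) • v).val = τ^[k] v.val :=
  act_X_pow τ _ k

@[simp] theorem val_C_smul (v : UnitsMod τ) (m : ℤ) : ((C m : ℤ[X]) • v).val = v.val ^ m := by
  refine (congrArg Units.val (act_C τ _ m)).trans ?_
  exact Units.val_zpow_eq_zpow_val _ _

theorem val_sum {ι : Type*} (s : Finset ι) (v : ι → UnitsMod τ) :
    (∑ i ∈ s, v i).val = ∏ i ∈ s, (v i).val := by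
  classical
  induction s using Finset.induction_on with
  | empty => rfl
  | insert i s hi ih => rw [Finset.sum_insert hi, Finset.prod_insert hi, val_add, ih]

end UnitsMod

/-- An additive subgroup stable under `X` is a `ℤ[X]`-submodule. -/
def submoduleOfStable {V : Type*} [AddCommGroup V] [Module ℤ[X] V] (A : AddSubgroup V)
    (h : ∀ v ∈ A, (X : ℤ[X]) • v ∈ A) : Submodule ℤ[X] V where
  __ := A
  smul_mem' f v hv := by
    change f • v ∈ A
    change v ∈ A at hv
    induction f using Polynomial.induction_on' with
    | add f f' hf hf' => rw [add_smul]; exact A.add_mem hf hf'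
    | monomial k a =>
      have h1 : ∀ k, (X ^ k : ℤ[X]) • v ∈ A := by
        intro k
        induction k with
        | zero => simpa using hv
        | succ k ih => rw [pow_succ', mul_smul]; exact h _ ih
      rw [← C_mul_X_pow_eq_monomial, mul_smul, ← Int.cast_id (n := a), map_intCast, Int.cast_smul_eq_zsmul]
      exact A.zsmul_mem (h1 k) a

/-- The units of a `τ`-stable subring of `Ω`. -/
noncomputable def stableUnits {Ω : Type*} [Field Ω] {τ : Ω →+* Ω} (D : Subring Ω)
    (hD : ∀ x ∈ D, τ x ∈ D) : Submodule ℤ[X] (UnitsMod τ) :=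
  submoduleOfStable
    { carrier := {v | v.val ∈ D ∧ v.val⁻¹ ∈ D}
      add_mem' := by
        rintro v w ⟨hv, hv'⟩ ⟨hw, hw'⟩
        refine ⟨mul_mem hv hw, ?_⟩
        rw [UnitsMod.val_add, mul_inv]
        exact mul_mem hv' hw'
      zero_mem' := ⟨D.one_mem, by simp [one_mem]⟩
      neg_mem' := by
        rintro v ⟨hv, hv'⟩
        exact ⟨by rwa [UnitsMod.val_neg], by rwa [UnitsMod.val_neg, inv_inv]⟩ }
    (by
      rintro v ⟨hv, hv'⟩
      refine ⟨?_, ?_⟩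
      · rw [UnitsMod.val_X_smul]; exact hD _ hv
      · rw [UnitsMod.val_X_smul, ← map_inv₀]; exact hD _ hv')

section LocSub

variable {Ω : Type*} [Field Ω] {D : Subring Ω} {c : Ω}

/-- The subring `D[1 / c]` of `Ω`. -/
def locSub (D : Subring Ω) {c : Ω} (hc : c ∈ D) : Subring Ω where
  carrier := {x | ∃ k : ℕ, c ^ k * x ∈ D}
  mul_mem' := by
    rintro x y ⟨k, hk⟩ ⟨l, hl⟩
    refine ⟨k + l, ?_⟩
    rw [pow_add, mul_mul_mul_comm]
    exact mul_mem hk hl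
  one_mem' := ⟨0, by simp [one_mem]⟩
  add_mem' := by
    rintro x y ⟨k, hk⟩ ⟨l, hl⟩
    refine ⟨k + l, ?_⟩
    have h1 : c ^ (k + l) * (x + y) = c ^ l * (c ^ k * x) + c ^ k * (c ^ l * y) := by ring
    rw [h1]
    exact add_mem (mul_mem (pow_mem hc l) hk) (mul_mem (pow_mem hc k) hl)
  zero_mem' := ⟨0, by simp [zero_mem]⟩
  neg_mem' := by
    rintro x ⟨k, hk⟩
    exact ⟨k, by rw [mul_neg]; exact neg_mem hk⟩

theorem le_locSub (hc : c ∈ D) : D ≤ locSub D hc := fun x hx => ⟨0, by simpa using hx⟩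

theorem inv_mem_locSub (hc : c ∈ D) (h0 : c ≠ 0) : c⁻¹ ∈ locSub D hc :=
  ⟨1, by rw [pow_one, mul_inv_cancel₀ h0]; exact D.one_mem⟩

theorem locSub_le {hc : c ∈ D} (h0 : c ≠ 0) {E : Subring Ω} (h1 : D ≤ E) (h2 : c⁻¹ ∈ E) :
    locSub D hc ≤ E := by
  rintro x ⟨k, hk⟩
  have h3 := mul_mem (pow_mem h2 k) (h1 hk)
  rwa [← mul_assoc, ← mul_pow, inv_mul_cancel₀ h0, one_pow, one_mul] at h3

theorem map_mem_locSub {τ : Ω →+* Ω} (hD : ∀ x ∈ D, τ x ∈ D) {hc : c ∈ D} (hτ : τ c = c)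
    (x : Ω) (hx : x ∈ locSub D hc) : τ x ∈ locSub D hc := by
  obtain ⟨k, hk⟩ := hx
  refine ⟨k, ?_⟩
  have h1 := hD _ hk
  rwa [map_mul, map_pow, hτ] at h1

theorem isLocalization_locSub (hc : c ∈ D) (h0 : c ≠ 0) :
    let _ := (Subring.inclusion (le_locSub hc)).toAlgebra
    IsLocalization.Away (⟨c, hc⟩ : D) (locSub D hc) := by
  let _ := (Subring.inclusion (le_locSub hc)).toAlgebra
  refine ⟨?_, ?_, ?_⟩
  · rintro ⟨_, k, rfl⟩
    refine IsUnit.of_mul_eq_one ⟨(c⁻¹) ^ k, pow_mem (inv_mem_locSub hc h0) k⟩ (Subtype.ext ?_)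
    change c ^ k * c⁻¹ ^ k = 1
    rw [← mul_pow, mul_inv_cancel₀ h0, one_pow]
  · rintro ⟨x, k, hk⟩
    refine ⟨⟨⟨_, hk⟩, ⟨_, k, rfl⟩⟩, Subtype.ext ?_⟩
    change x * c ^ k = c ^ k * x
    exact mul_comm _ _
  · intro x y h
    refine ⟨1, ?_⟩
    have h1 : (x : Ω) = y := congrArg (fun z : locSub D hc => (z : Ω)) h
    rw [Subtype.ext h1]

theorem ufm_locSub [UniqueFactorizationMonoid D] (hc : c ∈ D) (h0 : c ≠ 0) :
    UniqueFactorizationMonoid (locSub D hc) := by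
  let _ := (Subring.inclusion (le_locSub hc)).toAlgebra
  have h1 := isLocalization_locSub hc h0
  exact UniqueFactorizationMonoid.of_isLocalization (Submonoid.powers (⟨c, hc⟩ : D)) _

end LocSub

end NoetherCyclic

namespace NoetherCyclic

open Polynomial UniqueFactorizationMonoid

/-- The primes of `D` dividing `c`, one from each class of associates. -/
theorem exists_prime_divisors {D : Type*} [CommRing D] [IsDomain D] [UniqueFactorizationMonoid D]
    {c : D} (hc : c ≠ 0) : ∃ (S : Finset D), (∀ q ∈ S, Prime q ∧ q ∣ c) ∧
      (∀ q ∈ S, ∀ q' ∈ S, q ∣ q' → q = q') ∧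
      ∀ r : D, Prime r → r ∣ c → ∃ q ∈ S, Associated r q := by
  classical
  let _ : StrongNormalizationMonoid D := UniqueFactorizationMonoid.strongNormalizationMonoid
  refine ⟨(normalizedFactors c).toFinset, ?_, ?_, ?_⟩
  · intro q hq
    rw [Multiset.mem_toFinset] at hq
    exact ⟨prime_of_normalized_factor q hq, dvd_of_mem_normalizedFactors hq⟩
  · intro q hq q' hq' h
    rw [Multiset.mem_toFinset] at hq hq'
    have h1 := (irreducible_of_normalized_factor q hq).associated_of_dvd
      (irreducible_of_normalized_factor q' hq') h
    rw [← normalize_normalized_factor q hq, ← normalize_normalized_factor q' hq']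
    exact normalize_eq_normalize_iff_associated.mpr h1
  · intro r hr hrc
    obtain ⟨q, hq, h⟩ := exists_mem_normalizedFactors_of_dvd hc hr.irreducible hrc
    exact ⟨q, Multiset.mem_toFinset.mpr hq, h⟩

theorem exists_associated_prod {D : Type*} [CommRing D] [IsDomain D] [UniqueFactorizationMonoid D]
    {c : D} (hc : c ≠ 0) {S : Finset D} (hS : ∀ r : D, Prime r → r ∣ c → ∃ q ∈ S, Associated r q)
    {N : ℕ} (x : D) (hx : x ∣ c ^ N) : ∃ m : S → ℕ, Associated x (∏ s : S, (s : D) ^ m s) := by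
  classical
  induction x using induction_on_prime with
  | h₁ => exact absurd (zero_dvd_iff.mp hx) (pow_ne_zero N hc)
  | h₂ x h =>
    refine ⟨0, ?_⟩
    simpa using associated_one_iff_isUnit.mpr h
  | h₃ a r ha hr ih =>
    obtain ⟨m, hm⟩ := ih (dvd_of_mul_left_dvd hx)
    obtain ⟨q, hq, h⟩ := hS r hr (hr.dvd_of_dvd_pow (dvd_of_mul_right_dvd hx))
    refine ⟨m + Pi.single (⟨q, hq⟩ : S) 1, ?_⟩
    have h1 : ∏ s : S, (s : D) ^ (m + Pi.single (⟨q, hq⟩ : S) 1 : S → ℕ) s = q * ∏ s : S, (s : D) ^ m s := by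
      simp_rw [Pi.add_apply, pow_add]
      rw [Finset.prod_mul_distrib, mul_comm, Finset.prod_eq_single_of_mem (⟨q, hq⟩ : S)
        (Finset.mem_univ _)]
      · simp
      · intro s _ hs
        rw [Pi.single_eq_of_ne hs, pow_zero]
    rw [h1]
    exact h.mul_mul hm

universe u

variable {Ω : Type u} [Field Ω] {τ : Ω →+* Ω}

theorem bijective_of_iterate {D : Subring Ω} (hD : ∀ x ∈ D, τ x ∈ D) {n : ℕ} (hn : 0 < n)
    (hτ : ∀ x, τ^[n] x = x) : Function.Bijective (τ.restrict D D hD) := by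
  refine ⟨fun x y h => Subtype.ext (τ.injective (congrArg Subtype.val h)), fun x => ?_⟩
  have h1 : ∀ k, τ^[k] (x : Ω) ∈ D := by
    intro k
    induction k with
    | zero => exact x.2
    | succ k ih => rw [Function.iterate_succ_apply']; exact hD _ ih
  refine ⟨⟨_, h1 (n - 1)⟩, Subtype.ext ?_⟩
  change τ (τ^[n - 1] x) = x
  rw [← Function.iterate_succ_apply' (f := τ), Nat.succ_eq_add_one, Nat.sub_add_cancel hn, hτ]

theorem stableUnits_X_pow_sub_one {R : Subring Ω} (hR : ∀ x ∈ R, τ x ∈ R) {n : ℕ}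
    (hτ : ∀ x, τ^[n] x = x) (v : stableUnits R hR) : (X ^ n - 1 : ℤ[X]) • v = 0 := by
  refine Subtype.ext (UnitsMod.ext_val ?_)
  change ((X ^ n - 1 : ℤ[X]) • v.1).val = 1
  rw [sub_smul, one_smul, UnitsMod.val_sub, UnitsMod.val_X_pow_smul, hτ, div_self v.1.val_ne_zero]

/-- The units of `D[1 / c]` modulo those of `D` form a permutation module, for a factorial ring
`D`. -/
theorem exists_permPres_units {D R : Subring Ω} [UniqueFactorizationMonoid D]
    (hD : ∀ x ∈ D, τ x ∈ D) (hR : ∀ x ∈ R, τ x ∈ R) {n : ℕ} (hn : 0 < n)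
    (hτ : ∀ x, τ^[n] x = x) {c : Ω} (hc : c ∈ D) (h0 : c ≠ 0) (hτc : τ c = c)
    (h : R = locSub D hc) :
    ∃ (ι : Type u) (_ : Fintype ι) (t : ι → stableUnits R hR) (d : ι → ℕ),
      PermPres n ((stableUnits D hD).comap (stableUnits R hR).subtype) t d := by
  classical
  have hDR : D ≤ R := h ▸ le_locSub hc
  have hcR : c⁻¹ ∈ R := h ▸ inv_mem_locSub hc h0
  let c' : D := ⟨c, hc⟩
  have hc' : c' ≠ 0 := fun h => h0 (congrArg Subtype.val h)
  obtain ⟨S, hS1, hS2, hS3⟩ := exists_prime_divisors hc'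
  have hval : ∀ x y : D, ∀ N : ℕ, x * y = c' ^ N → ∃ v : stableUnits R hR, v.1.val = x := by
    intro x y N hxy
    have hxy' : (x : Ω) * y = c ^ N := congrArg Subtype.val hxy
    have hx : (x : Ω) ≠ 0 := left_ne_zero_of_mul (hxy' ▸ pow_ne_zero N h0)
    refine ⟨⟨UnitsMod.of τ (Units.mk0 x hx), hDR x.2, ?_⟩, rfl⟩
    have h2 : (x : Ω)⁻¹ = y * c⁻¹ ^ N := by
      rw [inv_pow, ← hxy']
      field_simp [right_ne_zero_of_mul (hxy' ▸ pow_ne_zero N h0)]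
    change (x : Ω)⁻¹ ∈ R
    rw [h2]
    exact mul_mem (hDR y.2) (pow_mem hcR N)
  have hq0 : ∀ s : S, ∃ v : stableUnits R hR, v.1.val = s.1 := by
    intro s
    obtain ⟨e, he⟩ := (hS1 s.1 s.2).2
    exact hval s.1 e 1 (by rw [pow_one, he])
  choose q hq using hq0
  have hW : ∀ (x y : D), Associated x y → ∀ v : stableUnits R hR, v.1.val * y = x → (y : Ω) ≠ 0 →
      v ∈ (stableUnits D hD).comap (stableUnits R hR).subtype := by
    rintro x y ⟨e, he⟩ v hv hy
    have hx : (x : Ω) * (e : D) = y := congrArg Subtype.val he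
    have he1 : ((e : D) : Ω) * ((e⁻¹ : Dˣ) : D) = 1 := congrArg Subtype.val e.mul_inv
    have h1 : v.1.val * (e : D) = 1 := by
      rw [← mul_right_inj' hy]
      linear_combination (e : D) * hv + hx
    refine ⟨?_, ?_⟩
    · change v.1.val ∈ D
      rw [eq_inv_of_mul_eq_one_left h1, ← eq_inv_of_mul_eq_one_right he1]
      exact Subtype.property _
    · change v.1.val⁻¹ ∈ D
      rw [← eq_inv_of_mul_eq_one_right h1]
      exact Subtype.property _
  let T : D →+* D := τ.restrict D D hD
  have hT : Function.Bijective T := bijective_of_iterate hD hn hτ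
  let Te : D ≃+* D := RingEquiv.ofBijective T hT
  have hπ : ∀ s : S, ∃ s' : S, Associated (Te s.1) s'.1 := by
    intro s
    have h1 : Prime (Te s.1) := (MulEquiv.prime_iff Te.toMulEquiv).mpr (hS1 s.1 s.2).1
    have h2 : Te s.1 ∣ c' := by
      have h3 := map_dvd Te (hS1 s.1 s.2).2
      have h4 : Te c' = c' := Subtype.ext hτc
      rwa [h4] at h3
    obtain ⟨q, hq, h⟩ := hS3 _ h1 h2
    exact ⟨⟨q, hq⟩, h⟩
  choose π hπ using hπ
  have hπi : Function.Injective π := by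
    intro s s' hss
    have h1 := (hπ s).trans (hss ▸ (hπ s').symm)
    have h2 : s.1 ∣ s'.1 := (map_dvd_iff Te).mp h1.dvd
    exact Subtype.ext (hS2 _ s.2 _ s'.2 h2)
  have hsum : ∀ m : S → ℤ, (∑ s, (C (m s) : ℤ[X]) • q s).1.val = ∏ s : S, (s.1 : Ω) ^ m s := by
    intro m
    have h1 : (∑ s, (C (m s) : ℤ[X]) • q s).1 = ∑ s, (C (m s) : ℤ[X]) • (q s).1 := by
      rw [AddSubmonoidClass.coe_finsetSum]
      rfl
    rw [h1, UnitsMod.val_sum]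
    exact Finset.prod_congr rfl fun s _ => by rw [UnitsMod.val_C_smul, hq]
  have hprod : ∀ m : S → ℕ, (∑ s, (C (m s : ℤ) : ℤ[X]) • q s).1.val
      = ((∏ s : S, (s : D) ^ m s : D) : Ω) := by
    intro m
    rw [hsum]
    simp
  have hprime : ∀ m : S → ℤ, ∑ s, (C (m s) : ℤ[X]) • q s ∈
      (stableUnits D hD).comap (stableUnits R hR).subtype → ∀ s, m s ≤ 0 := by
    intro m hm s₀
    have hm1 : ∏ s : S, (s.1 : Ω) ^ m s ∈ D := by rw [← hsum]; exact hm.1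
    have hm1' : (∏ s : S, (s.1 : Ω) ^ m s)⁻¹ ∈ D := by rw [← hsum]; exact hm.2
    have hm2 : (∏ s : S, s.1 ^ (m s).toNat : D) =
        ⟨_, hm1⟩ * (∏ s : S, s.1 ^ (- m s).toNat : D) := by
      refine Subtype.ext ?_
      push_cast
      rw [← Finset.prod_mul_distrib]
      refine Finset.prod_congr rfl fun s _ => ?_
      have hs : (s.1 : Ω) ≠ 0 := by
        rw [← hq]
        exact UnitsMod.val_ne_zero _
      rw [← zpow_natCast, ← zpow_natCast, ← zpow_add₀ hs]
      congr 1
      omega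
    have hne : ∏ s : S, (s.1 : Ω) ^ m s ≠ 0 := by rw [← hsum]; exact UnitsMod.val_ne_zero _
    have hu : IsUnit (⟨_, hm1⟩ : D) := IsUnit.of_mul_eq_one ⟨_, hm1'⟩
      (Subtype.ext (mul_inv_cancel₀ hne))
    by_contra! hlt
    have hp := (hS1 s₀.1 s₀.2).1
    have h1 : s₀.1 ∣ ∏ s : S, s.1 ^ (m s).toNat :=
      (dvd_pow_self _ (by omega)).trans (Finset.dvd_prod_of_mem (fun s : S => s.1 ^ (m s).toNat)
        (Finset.mem_univ s₀))
    rw [hm2] at h1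
    obtain h2 | h2 := hp.dvd_or_dvd h1
    · exact hp.not_isUnit (isUnit_of_dvd_unit h2 hu)
    · obtain ⟨s, -, h3⟩ := hp.exists_mem_finset_dvd h2
      have h4 : s₀ = s := Subtype.ext (hS2 _ s₀.2 _ s.2 (hp.dvd_of_dvd_pow h3))
      rw [← h4, show (- m s₀).toNat = 0 by omega, pow_zero] at h3
      exact hp.not_isUnit (isUnit_of_dvd_one h3)
  have hgood : ∀ x y : D, ∀ N : ℕ, x * y = c' ^ N → ∃ m : S → ℤ, ∀ v : stableUnits R hR,
      v.1.val = x → v - ∑ s, (C (m s) : ℤ[X]) • q s ∈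
        (stableUnits D hD).comap (stableUnits R hR).subtype := by
    intro x y N hxy
    obtain ⟨m, hm⟩ := exists_associated_prod hc' hS3 (N := N) x ⟨y, hxy.symm⟩
    refine ⟨fun s => m s, fun v hv => hW _ _ hm _ ?_ ?_⟩
    swap
    · rw [← hprod]
      exact UnitsMod.val_ne_zero _
    change (v.1 - (∑ s, (C (m s : ℤ) : ℤ[X]) • q s).1).val * _ = _
    rw [UnitsMod.val_sub, hv, ← hprod m, div_mul_cancel₀ _ (UnitsMod.val_ne_zero _)]
  refine exists_permPres_of_perm (q := q)
    (π := Equiv.ofBijective π (Finite.injective_iff_bijective.mp hπi)) hn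
    (stableUnits_X_pow_sub_one hR hτ) ?_ ?_ ?_
  · intro s
    have hne : ((π s).1 : Ω) ≠ 0 := by
      rw [← hq]
      exact UnitsMod.val_ne_zero _
    refine hW _ _ (hπ s) _ ?_ hne
    change ((X : ℤ[X]) • (q s).1 - (q (π s)).1).val * _ = τ s.1
    rw [UnitsMod.val_sub, UnitsMod.val_X_smul, hq, hq, div_mul_cancel₀ _ hne]
  · intro v
    obtain ⟨k, hk⟩ := h.le v.2.1
    obtain ⟨l, hl⟩ := h.le v.2.2
    have h1 : (⟨_, hk⟩ * ⟨_, hl⟩ : D) = c' ^ (k + l) := by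
      refine Subtype.ext ?_
      change c ^ k * v.1.val * (c ^ l * v.1.val⁻¹) = c ^ (k + l)
      rw [pow_add]
      field_simp [v.1.val_ne_zero]
    have h2 : c' ^ k * 1 = c' ^ k := mul_one _
    obtain ⟨x, hx⟩ := hval _ _ _ h1
    obtain ⟨y, hy⟩ := hval _ _ _ h2
    obtain ⟨m, hm⟩ := hgood _ _ _ h1
    obtain ⟨m', hm'⟩ := hgood _ _ _ h2
    have h3 : v = x - y := by
      refine Subtype.ext (UnitsMod.ext_val ?_)
      change v.1.val = (x.1 - y.1).val
      rw [UnitsMod.val_sub, hx, hy]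
      change v.1.val = c ^ k * v.1.val / c ^ k
      rw [mul_div_cancel_left₀ _ (pow_ne_zero k h0)]
    refine ⟨fun s => m s - m' s, ?_⟩
    have h4 := sub_mem (hm x hx) (hm' y hy)
    rw [h3]
    convert h4 using 1
    simp_rw [map_sub, sub_smul]
    rw [Finset.sum_sub_distrib]
    abel
  · intro m hm s
    refine le_antisymm (hprime m hm s) ?_
    have h1 := hprime (fun s => - m s) ?_ s
    · simpa using h1
    · have h2 := neg_mem hm
      rw [← Finset.sum_neg_distrib] at h2
      simpa using h2

end NoetherCyclic

namespace NoetherCyclic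

section PolySub

variable {L Ω ι : Type*} [Field L] [Field Ω] [Algebra L Ω]

variable (L) in
/-- The subring `L[v]` of `Ω` generated by `L` and the family `v`. -/
noncomputable def polySub (v : ι → Ω) : Subring Ω :=
  (MvPolynomial.aeval v : MvPolynomial ι L →ₐ[L] Ω).toRingHom.range

variable {v : ι → Ω}

theorem mem_polySub {x : Ω} : x ∈ polySub L v ↔ ∃ f : MvPolynomial ι L, MvPolynomial.aeval v f = x :=
  Iff.rfl

theorem algebraMap_mem_polySub (v : ι → Ω) (c : L) : algebraMap L Ω c ∈ polySub L v :=
  ⟨MvPolynomial.C c, MvPolynomial.aeval_C _ _⟩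

variable (L) in
theorem self_mem_polySub (v : ι → Ω) (i : ι) : v i ∈ polySub L v :=
  ⟨MvPolynomial.X i, MvPolynomial.aeval_X _ _⟩

theorem polySub_le {E : Subring Ω} (h1 : ∀ c, algebraMap L Ω c ∈ E) (h2 : ∀ i, v i ∈ E) :
    polySub L v ≤ E := by
  rintro x ⟨f, rfl⟩
  change MvPolynomial.aeval v f ∈ E
  induction f using MvPolynomial.induction_on with
  | C a => rw [MvPolynomial.aeval_C]; exact h1 a
  | add f f' hf hf' => rw [map_add]; exact add_mem hf hf'
  | mul_X f i hf => rw [map_mul, MvPolynomial.aeval_X]; exact mul_mem hf (h2 i)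

variable (hv : AlgebraicIndependent L v)

include hv

theorem ufm_polySub : UniqueFactorizationMonoid (polySub L v) :=
  (RingEquiv.ofBijective (MvPolynomial.aeval v : MvPolynomial ι L →ₐ[L] Ω).toRingHom.rangeRestrict
    ⟨fun _ _ h => hv (congrArg Subtype.val h), RingHom.rangeRestrict_surjective _⟩).toMulEquiv
    |>.uniqueFactorizationMonoid inferInstance

theorem exists_algebraMap_of_unit {x : Ω} (hx0 : x ≠ 0) (hx : x ∈ polySub L v)
    (hx' : x⁻¹ ∈ polySub L v) : ∃ c : L, algebraMap L Ω c = x := by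
  obtain ⟨f, hf⟩ := mem_polySub.mp hx
  obtain ⟨f', hf'⟩ := mem_polySub.mp hx'
  have h1 : f * f' = 1 := by
    apply hv
    rw [map_mul, hf, hf', map_one, mul_inv_cancel₀ hx0]
  obtain ⟨c, -, hc⟩ := MvPolynomial.isUnit_iff_eq_C_of_isReduced.mp (IsUnit.of_mul_eq_one _ h1)
  exact ⟨c, by rw [← hf, hc, MvPolynomial.aeval_C]⟩

variable [Fintype ι]

theorem eq_zero_of_prod_zpow {m : ι → ℤ} {c : L} (h : ∏ i, v i ^ m i = algebraMap L Ω c) (i : ι) :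
    m i = 0 := by
  classical
  have h1 : (MvPolynomial.monomial (Finsupp.equivFunOnFinite.symm fun i => (m i).toNat) (1 : L)) =
      MvPolynomial.monomial (Finsupp.equivFunOnFinite.symm fun i => (- m i).toNat) c := by
    apply hv
    rw [MvPolynomial.aeval_monomial, MvPolynomial.aeval_monomial, ← h, map_one, one_mul,
      Finsupp.prod_fintype _ _ (by simp), Finsupp.prod_fintype _ _ (by simp),
      ← Finset.prod_mul_distrib]
    refine Finset.prod_congr rfl fun i _ => ?_
    simp only [Finsupp.equivFunOnFinite_symm_apply_apply]
    rw [← zpow_natCast, ← zpow_natCast, ← zpow_add₀ (hv.ne_zero i)]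
    congr 1
    omega
  rw [MvPolynomial.monomial_eq_monomial_iff] at h1
  obtain ⟨h2, -⟩ | ⟨h2, -⟩ := h1
  · have h3 := DFunLike.congr_fun h2 i
    simp only [Finsupp.equivFunOnFinite_symm_apply_apply] at h3
    omega
  · exact absurd h2 one_ne_zero

omit hv in
theorem prod_mem_polySub (v : ι → Ω) : ∏ i, v i ∈ polySub L v :=
  prod_mem fun i _ => self_mem_polySub L v i

theorem exists_monomial_of_unit {x : Ω} (hx0 : x ≠ 0) (hx : x ∈ locSub _ (prod_mem_polySub (L := L) v))
    (hx' : x⁻¹ ∈ locSub _ (prod_mem_polySub (L := L) v)) :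
    ∃ (c : L) (m : ι → ℤ), x = algebraMap L Ω c * ∏ i, v i ^ m i := by
  obtain ⟨k, f, hf⟩ := hx
  obtain ⟨l, f', hf'⟩ := hx'
  change MvPolynomial.aeval v f = _ at hf
  change MvPolynomial.aeval v f' = _ at hf'
  have h0 : (∏ i, v i) ≠ 0 := Finset.prod_ne_zero_iff.mpr fun i _ => hv.ne_zero i
  have h1 : f * f' = MvPolynomial.monomial (Finsupp.equivFunOnFinite.symm fun _ => k + l) (1 : L) := by
    apply hv
    rw [map_mul, hf, hf', MvPolynomial.aeval_monomial, Finsupp.prod_fintype _ _ (by simp)]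
    simp only [Finsupp.equivFunOnFinite_symm_apply_apply, map_one, one_mul]
    rw [Finset.prod_pow, pow_add]
    field_simp
  obtain ⟨m, b, -, -, hfb⟩ := (MvPolynomial.dvd_monomial_iff_exists one_ne_zero).mp ⟨f', h1.symm⟩
  refine ⟨b, fun i => m i - k, ?_⟩
  rw [hfb, MvPolynomial.aeval_monomial, Finsupp.prod_fintype _ _ (by simp)] at hf
  have h2 : ∏ i, v i ^ ((m i : ℤ) - k) = (∏ i, v i ^ m i) / (∏ i, v i) ^ k := by
    rw [← Finset.prod_pow, ← Finset.prod_div_distrib]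
    refine Finset.prod_congr rfl fun i _ => ?_
    rw [zpow_sub₀ (hv.ne_zero i), zpow_natCast, zpow_natCast]
  rw [h2, ← mul_div_assoc, hf, mul_div_cancel_left₀ _ (pow_ne_zero k h0)]

end PolySub

section Common

variable {Ω : Type*} [Field Ω] {τ : Ω →+* Ω}

theorem exists_fixed_multiple {D : Subring Ω} (hD : ∀ x ∈ D, τ x ∈ D) {n : ℕ} (hn : 0 < n)
    (hτ : ∀ x, τ^[n] x = x) {d : Ω} (hd : d ∈ D) (hd0 : d ≠ 0) :
    ∃ c ∈ D, d * c ∈ D ∧ d * c ≠ 0 ∧ τ (d * c) = d * c := by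
  have h1 : ∀ k, τ^[k] d ∈ D := by
    intro k
    induction k with
    | zero => exact hd
    | succ k ih => rw [Function.iterate_succ_apply']; exact hD _ ih
  obtain ⟨m, rfl⟩ := Nat.exists_eq_succ_of_ne_zero hn.ne'
  have h2 : d * ∏ k ∈ Finset.range m, τ^[k + 1] d = ∏ k ∈ Finset.range (m + 1), τ^[k] d := by
    rw [Finset.prod_range_succ', mul_comm]
    rfl
  have hc : ∏ k ∈ Finset.range m, τ^[k + 1] d ∈ D := prod_mem fun k _ => h1 _
  refine ⟨_, hc, mul_mem hd hc, ?_, ?_⟩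
  · rw [h2]
    refine Finset.prod_ne_zero_iff.mpr fun k _ => ?_
    intro h
    refine hd0 ((τ.injective.iterate k) ?_)
    rw [h, Function.iterate_fixed (map_zero τ)]
  · rw [map_mul, map_prod]
    simp_rw [← Function.iterate_succ_apply' (f := τ)]
    rw [mul_comm, mul_comm d]
    have h3 := Finset.prod_range_succ (fun k => τ^[k + 1] d) m
    rw [Finset.prod_range_succ' (fun k => τ^[k + 1] d) m] at h3
    rw [hτ d] at h3
    exact h3

/-- Finitely many elements of the fraction field of `D` become elements of `D[1 / a]` for a single
`τ`-fixed `a`. -/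
theorem exists_fixed_denominator {D : Subring Ω} (hD : ∀ x ∈ D, τ x ∈ D) {n : ℕ} (hn : 0 < n)
    (hτ : ∀ x, τ^[n] x = x) {ι : Type*} (s : Finset ι) (v : ι → Ω)
    (hv : ∀ i ∈ s, ∃ d ∈ D, d ≠ 0 ∧ d * v i ∈ D) :
    ∃ a ∈ D, a ≠ 0 ∧ τ a = a ∧ ∀ i ∈ s, a * v i ∈ D := by
  classical
  induction s using Finset.induction_on with
  | empty => exact ⟨1, one_mem _, one_ne_zero, map_one τ, by simp⟩
  | insert i s hi ih =>
    obtain ⟨a, ha, ha0, hat, has⟩ := ih fun j hj => hv j (Finset.mem_insert_of_mem hj)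
    obtain ⟨d, hd, hd0, hdv⟩ := hv i (Finset.mem_insert_self i s)
    obtain ⟨c, hc, hdc, hdc0, hdct⟩ := exists_fixed_multiple hD hn hτ hd hd0
    refine ⟨a * (d * c), mul_mem ha hdc, mul_ne_zero ha0 hdc0, by rw [map_mul, hat, hdct], ?_⟩
    intro j hj
    obtain rfl | hj := Finset.mem_insert.mp hj
    · have h1 : a * (d * c) * v j = a * c * (d * v j) := by ring
      rw [h1]
      exact mul_mem (mul_mem ha hc) hdv
    · have h1 : a * (d * c) * v j = d * c * (a * v j) := by ring
      rw [h1]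
      exact mul_mem hdc (has j hj)

/-- Two subrings that agree after inverting one element of each agree after inverting both. -/
theorem locSub_common {A B : Subring Ω} {a b : Ω} (ha : a ∈ A) (hb : b ∈ B) (ha0 : a ≠ 0)
    (hb0 : b ≠ 0) (hat : τ a = a) (hbt : τ b = b) (hBA : B ≤ locSub A ha) (hAB : A ≤ locSub B hb) :
    ∃ (c d : Ω) (hc : c ∈ A) (hd : d ∈ B), c ≠ 0 ∧ d ≠ 0 ∧ τ c = c ∧ τ d = d ∧
      locSub A hc = locSub B hd := by
  obtain ⟨k, hk⟩ := hBA hb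
  obtain ⟨l, hl⟩ := hAB ha
  have hk0 : a ^ k * b ≠ 0 := mul_ne_zero (pow_ne_zero _ ha0) hb0
  have hl0 : b ^ l * a ≠ 0 := mul_ne_zero (pow_ne_zero _ hb0) ha0
  have key : ∀ {A B : Subring Ω} {a b : Ω} (ha : a ∈ A) (hb : b ∈ B) (ha0 : a ≠ 0)
      (hb0 : b ≠ 0) (hAB : A ≤ locSub B hb) {k l : ℕ} (hk : a ^ k * b ∈ A) (hl : b ^ l * a ∈ B),
      locSub A (mul_mem ha hk) ≤ locSub B (mul_mem hb hl) := by
    intro A B a b ha hb ha0 hb0 hAB k l hk hl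
    have hk0 : a ^ k * b ≠ 0 := mul_ne_zero (pow_ne_zero _ ha0) hb0
    have hl0 : b ^ l * a ≠ 0 := mul_ne_zero (pow_ne_zero _ hb0) ha0
    have h1 : (b * (b ^ l * a))⁻¹ ∈ locSub B (mul_mem hb hl) :=
      inv_mem_locSub _ (mul_ne_zero hb0 hl0)
    have h2 : b⁻¹ ∈ locSub B (mul_mem hb hl) := by
      have h3 : b⁻¹ = b ^ l * a * (b * (b ^ l * a))⁻¹ := by field_simp
      rw [h3]
      exact mul_mem (le_locSub _ hl) h1
    have h4 : a⁻¹ ∈ locSub B (mul_mem hb hl) := by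
      have h3 : a⁻¹ = b * b ^ l * (b * (b ^ l * a))⁻¹ := by field_simp
      rw [h3]
      exact mul_mem (le_locSub _ (mul_mem hb (pow_mem hb l))) h1
    refine locSub_le (mul_ne_zero ha0 hk0) (hAB.trans (locSub_le hb0 (le_locSub _) h2)) ?_
    rw [mul_inv, mul_inv, ← inv_pow]
    exact mul_mem h4 (mul_mem (pow_mem h4 k) h2)
  refine ⟨a * (a ^ k * b), b * (b ^ l * a), mul_mem ha hk, mul_mem hb hl, mul_ne_zero ha0 hk0,
    mul_ne_zero hb0 hl0, by simp [hat, hbt], by simp [hat, hbt], le_antisymm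
    (key ha hb ha0 hb0 hAB hk hl) (key hb ha hb0 ha0 hBA hl hk)⟩

end Common

end NoetherCyclic

namespace NoetherCyclic

open Polynomial

universe u

/-- A factorial `τ`-stable `L`-subalgebra, finitely generated as an algebra, whose fraction field
is `E`. -/
structure StableRing (L : Type*) {Ω : Type*} [Field L] [Field Ω] [Algebra L Ω] (τ : Ω →+* Ω)
    (E : Subfield Ω) (D : Subring Ω) : Prop where
  ufm : UniqueFactorizationMonoid D
  map_mem : ∀ x ∈ D, τ x ∈ D
  algebraMap_mem : ∀ c, algebraMap L Ω c ∈ D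
  exists_denominator : ∀ x ∈ E, ∃ d ∈ D, d ≠ 0 ∧ d * x ∈ D
  exists_generators : ∃ S : Finset Ω, (∀ x ∈ S, x ∈ E) ∧
    ∀ R : Subring Ω, (∀ c, algebraMap L Ω c ∈ R) → (∀ x ∈ S, x ∈ R) → D ≤ R

theorem exists_denominator_of_mem_closure {Ω : Type*} [Field Ω] {D : Subring Ω} {x : Ω}
    (hx : x ∈ Subfield.closure (D : Set Ω)) : ∃ d ∈ D, d ≠ 0 ∧ d * x ∈ D := by
  obtain ⟨y, hy, z, hz, rfl⟩ := Subfield.mem_closure_iff.mp hx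
  rw [Subring.closure_eq] at hy hz
  by_cases h0 : z = 0
  · exact ⟨1, one_mem _, one_ne_zero, by simp [h0, zero_mem]⟩
  · exact ⟨z, hz, h0, by rwa [mul_div_cancel₀ _ h0]⟩

namespace StableRing

variable {L : Type*} {Ω : Type u} [Field L] [Field Ω] [Algebra L Ω] {τ : Ω →+* Ω}
  {E : Subfield Ω} {A B : Subring Ω} {n : ℕ}

theorem le_locSub (hA : StableRing L τ E A) (hB : StableRing L τ E B) (hn : 0 < n)
    (hτ : ∀ x, τ^[n] x = x) :
    ∃ (b : Ω) (hb : b ∈ B), b ≠ 0 ∧ τ b = b ∧ A ≤ locSub B hb := by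
  obtain ⟨S, hS, hSA⟩ := hA.exists_generators
  obtain ⟨b, hb, hb0, hbt, h⟩ := exists_fixed_denominator hB.map_mem hn hτ S id
    fun x hx => hB.exists_denominator x (hS x hx)
  refine ⟨b, hb, hb0, hbt, hSA _ (fun c => NoetherCyclic.le_locSub hb (hB.algebraMap_mem c)) ?_⟩
  exact fun x hx => ⟨1, by rw [pow_one]; exact h x hx⟩

theorem exists_permPres (hA : StableRing L τ E A) (hB : StableRing L τ E B) (hn : 0 < n)
    (hτ : ∀ x, τ^[n] x = x) : ∃ (R : Subring Ω) (hR : ∀ x ∈ R, τ x ∈ R), A ≤ R ∧ B ≤ R ∧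
      (∃ (ι : Type u) (_ : Fintype ι) (t : ι → stableUnits R hR) (d : ι → ℕ),
        PermPres n ((stableUnits A hA.map_mem).comap (stableUnits R hR).subtype) t d) ∧
      ∃ (ι : Type u) (_ : Fintype ι) (t : ι → stableUnits R hR) (d : ι → ℕ),
        PermPres n ((stableUnits B hB.map_mem).comap (stableUnits R hR).subtype) t d := by
  obtain ⟨b, hb, hb0, hbt, hAB⟩ := hA.le_locSub hB hn hτ
  obtain ⟨a, ha, ha0, hat, hBA⟩ := hB.le_locSub hA hn hτ
  obtain ⟨c, d, hc, hd, hc0, hd0, hct, hdt, h⟩ := locSub_common ha hb ha0 hb0 hat hbt hBA hAB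
  have := hA.ufm
  have := hB.ufm
  have hR := map_mem_locSub hA.map_mem (hc := hc) hct
  refine ⟨locSub A hc, hR, NoetherCyclic.le_locSub hc, h ▸ NoetherCyclic.le_locSub hd, ?_, ?_⟩
  · exact exists_permPres_units hA.map_mem hR hn hτ hc hc0 hct rfl
  · exact exists_permPres_units hB.map_mem hR hn hτ hd hd0 hdt h

end StableRing

namespace Model

variable {p : ℕ} [hp : Fact p.Prime] {g : ZMod p} {L Ω : Type*} [Field L] [Field Ω]
  [Algebra L Ω] {τ σ : Ω →+* Ω} {ζ : Ω} {y : ZMod p → Ω} {u : Ωˣ}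

omit hp in
theorem map_algebraMap (M : Model p g L τ σ ζ y) (c : L) :
    ∃ c', τ (algebraMap L Ω c) = algebraMap L Ω c' := by
  obtain ⟨z, hz⟩ := M.exists_zeta
  have h1 := M.algebraMap_mem ((algebraMap L Ω).fieldRange.comap τ) ?_ c
  · obtain ⟨c', hc'⟩ := h1
    exact ⟨c', hc'.symm⟩
  · rw [Subfield.mem_comap, M.semi.map_zeta]
    exact pow_mem (RingHom.mem_fieldRange.mpr ⟨z, hz⟩) _

omit hp in
theorem map_mem_polySub_of_fixed (M : Model p g L τ σ ζ y) {ι : Type*} {z : ι → Ω}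
    (hz : ∀ i, τ (z i) = z i) (x : Ω) (hx : x ∈ polySub L z) : τ x ∈ polySub L z := by
  have h1 : polySub L z ≤ (polySub L z).comap τ := by
    refine polySub_le (fun c => ?_) fun i => ?_
    · obtain ⟨c', hc'⟩ := M.map_algebraMap c
      rw [Subring.mem_comap, hc']
      exact algebraMap_mem_polySub z c'
    · rw [Subring.mem_comap, hz]
      exact self_mem_polySub L z i
  exact h1 hx

omit hp in
theorem y_pow_mem (M : Model p g L τ σ ζ y) (j : ZMod p) : y j ^ p ∈ fixSub σ := by
  rw [mem_fixSub, map_pow, M.sigma_y, mul_pow, ← pow_mul, mul_comm j.val, pow_mul,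
    M.semi.prim.pow_eq_one, one_pow, one_mul]

theorem algebraicIndependent_of_fixSub_le (M : Model p g L τ σ ζ y) {ι : Type*} [Fintype ι]
    {z : ι → Ω} (hz : fixSub σ ≤ algCl L (Set.range z)) (hι : Fintype.card ι ≤ p) :
    AlgebraicIndependent L z :=
  algebraicIndependent_of_mem_algCl M.ind
    (fun j => mem_algCl_of_pow hp.out.pos (hz (M.y_pow_mem j))) (by rwa [ZMod.card])

theorem map_mem_fixSub (M : Model p g L τ σ ζ y) [CharZero Ω] {x : Ω} (hx : x ∈ fixSub σ) :
    τ x ∈ fixSub σ := by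
  have h1 := M.fld_eq_fixSub (u := Units.mk0 _ (M.y_ne_zero 1)) rfl
    (J := RingHom.ker (aeval (R := ℤ) g)) fun f => RingHom.mem_ker
  rw [← h1] at hx ⊢
  exact M.map_mem_fld hx

theorem fixSub_le_of_rational (M : Model p g L τ σ ζ y) [CharZero Ω]
    (e : ↥(fixSub σ ⊓ fixSub τ) ≃+* FractionRing (MvPolynomial (Fin p) ℚ)) {K : Subfield Ω}
    (hζ : ζ ∈ K)
    (hK : ∀ i, (e.symm (algebraMap (MvPolynomial (Fin p) ℚ) _ (MvPolynomial.X i)) : Ω) ∈ K) :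
    fixSub σ ≤ K := by
  let ψ : MvPolynomial (Fin p) ℚ →+* Ω :=
    ((fixSub σ ⊓ fixSub τ).subtype.comp (e.symm : _ →+* ↥(fixSub σ ⊓ fixSub τ))).comp
      (algebraMap (MvPolynomial (Fin p) ℚ) (FractionRing (MvPolynomial (Fin p) ℚ)))
  have h1 : ∀ q, ψ q ∈ K := by
    intro q
    induction q using MvPolynomial.induction_on with
    | C a =>
      have h2 := eq_ratCast (ψ.comp MvPolynomial.C) a
      rw [RingHom.comp_apply] at h2
      rw [h2]
      exact SubfieldClass.ratCast_mem K a
    | add a b ha hb => rw [map_add]; exact add_mem ha hb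
    | mul_X a j ha => rw [map_mul]; exact mul_mem ha (hK j)
  have h2 : fixSub σ ⊓ fixSub τ ≤ K := by
    intro x hx
    obtain ⟨a, b, -, hab⟩ := IsFractionRing.div_surjective (A := MvPolynomial (Fin p) ℚ) (e ⟨x, hx⟩)
    have h3 : x = ψ a / ψ b := by
      have h4 : (⟨x, hx⟩ : ↥(fixSub σ ⊓ fixSub τ)) = e.symm (algebraMap _ _ a) / e.symm (algebraMap _ _ b) := by
        rw [← map_div₀, hab, RingEquiv.symm_apply_apply]
      exact congrArg Subtype.val h4
    rw [h3]
    exact div_mem (h1 a) (h1 b)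
  rw [M.semi.eq_closure M.sigma_zeta (fun _ hx => M.map_mem_fixSub hx), Subfield.closure_le]
  rintro x (hx | rfl)
  exacts [h2 hx, hζ]

theorem exists_stableRing_of_rational (M : Model p g L τ σ ζ y) [CharZero Ω]
    (e : ↥(fixSub σ ⊓ fixSub τ) ≃+* FractionRing (MvPolynomial (Fin p) ℚ)) :
    ∃ B : Subring Ω, StableRing L τ (fixSub σ) B ∧
      ∀ x, x ≠ 0 → x ∈ B → x⁻¹ ∈ B → ∃ c, algebraMap L Ω c = x := by
  classical
  let z : Fin p → Ω := fun i => (e.symm (algebraMap (MvPolynomial (Fin p) ℚ) _ (MvPolynomial.X i)) : Ω)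
  have hz1 : ∀ i, z i ∈ fixSub σ := fun i => (Subtype.property (e.symm _)).1
  have hz2 : ∀ i, τ (z i) = z i := fun i => (Subtype.property (e.symm _)).2
  have hz : AlgebraicIndependent L z := by
    refine M.algebraicIndependent_of_fixSub_le (M.fixSub_le_of_rational e (M.zeta_mem_algCl _) ?_)
      (Fintype.card_fin p).le
    exact fun i => subset_algCl ⟨i, rfl⟩
  refine ⟨polySub L z, ⟨ufm_polySub hz, M.map_mem_polySub_of_fixed hz2, algebraMap_mem_polySub z,
    fun x hx => exists_denominator_of_mem_closure ?_, Finset.univ.image z, ?_, ?_⟩,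
    fun x h0 h1 h2 => exists_algebraMap_of_unit hz h0 h1 h2⟩
  · refine M.fixSub_le_of_rational e ?_ (fun i => Subfield.subset_closure (self_mem_polySub L z i)) hx
    obtain ⟨c, rfl⟩ := M.exists_zeta
    exact Subfield.subset_closure (algebraMap_mem_polySub z c)
  · intro x hx
    obtain ⟨i, -, rfl⟩ := Finset.mem_image.mp hx
    exact hz1 i
  · exact fun R h1 h2 => polySub_le h1 fun i => h2 _ (Finset.mem_image_of_mem z (Finset.mem_univ i))

end Model

namespace Model

variable {p : ℕ} [hp : Fact p.Prime] {g : ZMod p} {L Ω : Type*} [Field L] [Field Ω]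
  [Algebra L Ω] {τ σ : Ω →+* Ω} {ζ : Ω} {y : ZMod p → Ω} {u : Ωˣ}

theorem act_X_pow_sub_C (M : Model p g L τ σ ζ y) (hu : (u : Ω) = y 1) (k : ℕ) (m : ℕ) :
    (act τ (X ^ k - C (m : ℤ)) u : Ω) = y (g ^ k) / y 1 ^ m := by
  rw [act_sub, act_C, zpow_natCast, Units.val_div_eq_div_val, M.act_X_pow_eq hu,
    Units.val_pow_eq_pow_val, hu]

theorem exists_exponent (M : Model p g L τ σ ζ y) (hu : (u : Ω) = y 1) (j : ZMod p) :
    ∃ f : ℤ[X], aeval g f = 0 ∧ (j = 1 → (act τ f u : Ω) = y 1 ^ p) ∧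
      (j ≠ 0 → j ≠ 1 → (act τ f u : Ω) = y j / y 1 ^ j.val) := by
  by_cases h1 : j = 1
  · refine ⟨C (p : ℤ), by simp, fun _ => ?_, fun _ h => absurd h1 h⟩
    rw [act_C, zpow_natCast, Units.val_pow_eq_pow_val, hu]
  by_cases h0 : j = 0
  · exact ⟨0, map_zero _, fun h => absurd h h1, fun h => absurd h0 h⟩
  obtain ⟨i, -, rfl⟩ := M.exists_pow_eq h0
  refine ⟨X ^ i - C (((g ^ i).val : ℕ) : ℤ), ?_, fun h => absurd h h1, fun _ _ => ?_⟩
  · rw [map_sub, map_pow, aeval_X, map_natCast, map_natCast, ZMod.natCast_zmod_val, sub_self]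
  · exact M.act_X_pow_sub_C hu i _

theorem act_mem_units (M : Model p g L τ σ ζ y) (hu : (u : Ω) = y 1) (H : Subgroup Ωˣ)
    (h1 : act τ (C (p : ℤ)) u ∈ H)
    (hH : ∀ k, g ^ k ≠ 1 → act τ (X ^ k - C (((g ^ k).val : ℕ) : ℤ)) u ∈ H) {f : ℤ[X]}
    (hf : aeval g f = 0) : act τ f u ∈ H := by
  have key : ∀ f : ℤ[X], ∃ m : ℤ, (m : ZMod p) = aeval g f ∧ act τ (f - C m) u ∈ H := by
    let T : AddSubgroup ℤ[X] :=
      { carrier := {f | ∃ m : ℤ, (m : ZMod p) = aeval g f ∧ act τ (f - C m) u ∈ H}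
        zero_mem' := ⟨0, by simp, by simp [act_zero, one_mem]⟩
        add_mem' := by
          rintro a b ⟨m, hm, ha⟩ ⟨l, hl, hb⟩
          refine ⟨m + l, by push_cast; rw [hm, hl, map_add], ?_⟩
          have h2 : a + b - C (m + l) = (a - C m) + (b - C l) := by rw [C_add]; ring
          rw [h2, act_add]
          exact mul_mem ha hb
        neg_mem' := by
          rintro a ⟨m, hm, ha⟩
          refine ⟨-m, by push_cast; rw [hm, map_neg], ?_⟩
          have h2 : -a - C (-m) = -(a - C m) := by rw [C_neg]; ring
          rw [h2, act_neg]
          exact inv_mem ha }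
    have hX : ∀ k, X ^ k ∈ T := by
      intro k
      by_cases hk : g ^ k = 1
      · refine ⟨1, by simp [hk], ?_⟩
        have h2 := M.act_X_pow_sub_C hu k 1
        rw [hk, pow_one, div_self (M.y_ne_zero 1), Nat.cast_one] at h2
        rw [show act τ (X ^ k - C 1) u = 1 from Units.ext h2]
        exact one_mem _
      · exact ⟨_, by simp, hH k hk⟩
    have hT : ∀ f, f ∈ T := by
      intro f
      induction f using Polynomial.induction_on' with
      | add a b ha hb => exact add_mem ha hb
      | monomial k a =>
        have h3 := zsmul_mem (hX k) a
        rwa [← C_mul_X_pow_eq_monomial, ← smul_eq_C_mul]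
    exact hT
  obtain ⟨m, hm, h2⟩ := key f
  rw [hf, ZMod.intCast_zmod_eq_zero_iff_dvd] at hm
  obtain ⟨k, rfl⟩ := hm
  have h3 : act τ f u = act τ (f - C (p * k)) u * act τ (C (p : ℤ)) u ^ k := by
    rw [← act_C τ (act τ (C (p : ℤ)) u) k, ← act_mul, ← act_add, ← C_mul, mul_comm k]
    ring_nf
  rw [h3]
  exact mul_mem h2 (zpow_mem h1 k)

/-- The ring of Laurent polynomials in the invariant monomials. -/
theorem exists_stableRing_monomials (M : Model p g L τ σ ζ y) [CharZero Ω] (hu : (u : Ω) = y 1) :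
    ∃ A : Subring Ω, StableRing L τ (fixSub σ) A ∧
      (∀ x, x ≠ 0 → x ∈ A → x⁻¹ ∈ A → ∃ (c : L) (a : ℤ) (f : ℤ[X]), aeval g f = 0 ∧
        x = algebraMap L Ω c * y 0 ^ a * act τ f u) ∧
      y 0 ∈ A ∧ (y 0)⁻¹ ∈ A ∧ ∀ f : ℤ[X], aeval g f = 0 → (act τ f u : Ω) ∈ A := by
  classical
  choose F hF hF1 hF2 using M.exists_exponent hu
  let v : ZMod p → Ω := fun j => if j = 0 then y 0 else act τ (F j) u
  have hv0 : v 0 = y 0 := if_pos rfl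
  have hvj : ∀ j, j ≠ 0 → v j = act τ (F j) u := fun j hj => if_neg hj
  have hv : AlgebraicIndependent L v := by
    refine algebraicIndependent_of_mem_algCl M.ind (fun j => ?_) le_rfl
    have hm : ∀ j, v j ∈ algCl L (Set.range v) := fun j => subset_algCl ⟨j, rfl⟩
    have h1 : y 1 ∈ algCl L (Set.range v) := by
      refine mem_algCl_of_pow hp.out.pos ?_
      rw [← hF1 1 rfl, ← hvj 1 one_ne_zero]
      exact hm 1
    by_cases hj0 : j = 0
    · rw [hj0, ← hv0]
      exact hm 0
    by_cases hj1 : j = 1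
    · rwa [hj1]
    have h2 := hF2 j hj0 hj1
    rw [eq_div_iff (pow_ne_zero _ (M.y_ne_zero 1)), ← hvj j hj0] at h2
    rw [← h2]
    exact mul_mem (hm j) (pow_mem h1 _)
  have hvn : ∀ j, v j ≠ 0 := hv.ne_zero
  have hπ : ∏ j, v j ≠ 0 := Finset.prod_ne_zero_iff.mpr fun j _ => hvn j
  let A := locSub _ (prod_mem_polySub (L := L) v)
  have hLA : ∀ c, algebraMap L Ω c ∈ A := fun c => le_locSub _ (algebraMap_mem_polySub v c)
  have hvA : ∀ j, v j ∈ A := fun j => le_locSub _ (self_mem_polySub L v j)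
  have hvA' : ∀ j, (v j)⁻¹ ∈ A := by
    intro j
    have h1 : (v j)⁻¹ = (∏ i ∈ Finset.univ.erase j, v i) * (∏ i, v i)⁻¹ := by
      rw [eq_mul_inv_iff_mul_eq₀ hπ, ← Finset.mul_prod_erase _ _ (Finset.mem_univ j),
        inv_mul_cancel_left₀ (hvn j)]
    rw [h1]
    exact mul_mem (prod_mem fun i _ => hvA i) (inv_mem_locSub _ hπ)
  have hAle : ∀ R : Subring Ω, (∀ c, algebraMap L Ω c ∈ R) → (∀ j, v j ∈ R) →
      (∀ j, (v j)⁻¹ ∈ R) → A ≤ R := by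
    intro R h1 h2 h3
    refine locSub_le hπ (polySub_le h1 h2) ?_
    rw [← Finset.prod_inv_distrib]
    exact prod_mem fun j _ => h3 j
  have hactA : ∀ f : ℤ[X], aeval g f = 0 → (act τ f u : Ω) ∈ A := by
    intro f hf
    refine (M.act_mem_units hu (A.toSubmonoid.units) ?_ ?_ hf).1
    · have h1 : v 1 = act τ (C (p : ℤ)) u := by
        rw [hvj 1 one_ne_zero, hF1 1 rfl, act_C, zpow_natCast, Units.val_pow_eq_pow_val, hu]
      rw [Submonoid.mem_units_iff, Units.val_inv_eq_inv_val, ← h1]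
      exact ⟨hvA 1, hvA' 1⟩
    · intro k hk
      have hk0 : g ^ k ≠ 0 := pow_ne_zero _ M.g_ne_zero
      have h1 : v (g ^ k) = act τ (X ^ k - C (((g ^ k).val : ℕ) : ℤ)) u := by
        rw [hvj _ hk0, hF2 _ hk0 hk, M.act_X_pow_sub_C hu]
      rw [Submonoid.mem_units_iff, Units.val_inv_eq_inv_val, ← h1]
      exact ⟨hvA _, hvA' _⟩
  have hactA' : ∀ f : ℤ[X], aeval g f = 0 → (act τ f u : Ω)⁻¹ ∈ A := by
    intro f hf
    have h1 := hactA (-f) (by rw [map_neg, hf, neg_zero])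
    rwa [act_neg, Units.val_inv_eq_inv_val] at h1
  have hXF : ∀ j, aeval g (X * F j) = 0 := fun j => by rw [map_mul, hF, mul_zero]
  have hy0 : y 0 ∈ A := hv0 ▸ hvA 0
  have hy0' : (y 0)⁻¹ ∈ A := hv0 ▸ hvA' 0
  have hτA : A ≤ A.comap τ := by
    refine hAle _ (fun c => ?_) (fun j => ?_) fun j => ?_
    · obtain ⟨c', hc'⟩ := M.map_algebraMap c
      rw [Subring.mem_comap, hc']
      exact hLA c'
    · rw [Subring.mem_comap]
      by_cases hj : j = 0
      · rwa [hj, hv0, M.map_y_zero]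
      · rw [hvj j hj, map_act]
        exact hactA _ (hXF j)
    · rw [Subring.mem_comap, map_inv₀]
      by_cases hj : j = 0
      · rwa [hj, hv0, M.map_y_zero]
      · rw [hvj j hj, map_act]
        exact hactA' _ (hXF j)
  have hfld := M.fld_eq_fixSub hu (J := RingHom.ker (aeval (R := ℤ) g)) fun f => RingHom.mem_ker
  have hvE : ∀ j, v j ∈ fixSub σ := by
    intro j
    rw [← hfld]
    by_cases hj : j = 0
    · rw [hj, hv0]
      exact y_mem_fld
    · rw [hvj j hj]
      exact act_mem_fld (RingHom.mem_ker.mpr (hF j))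
  refine ⟨A, ⟨?_, fun x hx => hτA hx, hLA, fun x hx => exists_denominator_of_mem_closure ?_,
    Finset.univ.image v ∪ Finset.univ.image fun j => (v j)⁻¹, ?_, ?_⟩, ?_, hy0, hy0', hactA⟩
  · have := ufm_polySub hv
    exact ufm_locSub _ hπ
  · rw [← hfld] at hx
    refine fld_le ?_ (Subfield.subset_closure hy0) (fun f hf =>
      Subfield.subset_closure (hactA f (RingHom.mem_ker.mp hf))) hx
    obtain ⟨c, rfl⟩ := M.exists_zeta
    exact Subfield.subset_closure (hLA c)
  · intro x hx
    obtain hx | hx := Finset.mem_union.mp hx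
    · obtain ⟨j, -, rfl⟩ := Finset.mem_image.mp hx
      exact hvE j
    · obtain ⟨j, -, rfl⟩ := Finset.mem_image.mp hx
      exact inv_mem (hvE j)
  · exact fun R h1 h2 => hAle R h1
      (fun j => h2 _ (Finset.mem_union_left _ (Finset.mem_image_of_mem _ (Finset.mem_univ j))))
      fun j => h2 _ (Finset.mem_union_right _ (Finset.mem_image_of_mem _ (Finset.mem_univ j)))
  · intro x hx0 hx hx'
    obtain ⟨c, m, rfl⟩ := exists_monomial_of_unit hv hx0 hx hx'
    have key : ∀ s : Finset (ZMod p), 0 ∉ s → ∃ f : ℤ[X], aeval g f = 0 ∧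
        ∏ j ∈ s, v j ^ m j = act τ f u := by
      intro s
      induction s using Finset.induction_on with
      | empty => exact fun _ => ⟨0, map_zero _, by simp [act_zero]⟩
      | insert j s hj ih =>
        intro h0
        obtain ⟨f, hf, hfs⟩ := ih fun h => h0 (Finset.mem_insert_of_mem h)
        have hj0 : j ≠ 0 := fun h => h0 (h ▸ Finset.mem_insert_self j s)
        refine ⟨C (m j) * F j + f, by rw [map_add, map_mul, hF, hf, mul_zero, add_zero], ?_⟩
        rw [Finset.prod_insert hj, hfs, act_add, act_mul, act_C, Units.val_mul,
          Units.val_zpow_eq_zpow_val, hvj j hj0]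
    obtain ⟨f, hf, hfs⟩ := key (Finset.univ.erase 0) (Finset.notMem_erase _ _)
    refine ⟨c, m 0, f, hf, ?_⟩
    rw [← Finset.mul_prod_erase _ _ (Finset.mem_univ (0 : ZMod p)), hfs, hv0, mul_assoc]

theorem monomial_eq_const (M : Model p g L τ σ ζ y) (hu : (u : Ω) = y 1) {a : ℤ} {f : ℤ[X]} {c : L}
    (h : y 0 ^ a * act τ f u = algebraMap L Ω c) : a = 0 ∧ X ^ (p - 1) - 1 ∣ f := by
  have hn : 0 < p - 1 := p_sub_one_pos (p := p)
  have hmon : (X ^ (p - 1) - 1 : ℤ[X]).Monic := monic_X_pow_sub_C 1 hn.ne'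
  set r := f %ₘ (X ^ (p - 1) - 1) with hr
  have hfr : X ^ (p - 1) - 1 ∣ f - r := by
    refine ⟨f /ₘ (X ^ (p - 1) - 1), ?_⟩
    linear_combination (-1 : ℤ[X]) * modByMonic_add_div f (X ^ (p - 1) - 1 : ℤ[X])
  have hact : (act τ f u : Ω) = ∏ i : Fin (p - 1), y (g ^ (i : ℕ)) ^ r.coeff i := by
    rw [act_congr_of_dvd τ f r u (M.act_X_pow_sub_one hu) hfr]
    have hdeg : r.natDegree < p - 1 := by
      have h1 := natDegree_modByMonic_lt f hmon (by
        intro h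
        have h2 := natDegree_X_pow_sub_C (R := ℤ) (n := p - 1) (r := 1)
        rw [map_one, h, natDegree_one] at h2
        omega)
      rwa [← map_one C, natDegree_X_pow_sub_C] at h1
    have h1 : r = ∑ i ∈ Finset.range (p - 1), C (r.coeff i) * X ^ i :=
      as_sum_range_C_mul_X_pow' r hdeg
    have h2 : (act τ r u : Ω) = (r • UnitsMod.of τ u).val := rfl
    rw [h2]
    nth_rewrite 1 [h1]
    rw [Finset.sum_smul, UnitsMod.val_sum, Finset.prod_range]
    refine Finset.prod_congr rfl fun i _ => ?_
    rw [mul_smul, UnitsMod.val_C_smul]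
    congr 1
    exact M.act_X_pow_eq hu i
  let w : Option (Fin (p - 1)) → ZMod p := fun o => o.elim 0 fun i => g ^ (i : ℕ)
  have hw : Function.Injective w := by
    rintro (_ | i) (_ | j) hij
    · rfl
    · exact absurd hij.symm (pow_ne_zero _ M.g_ne_zero)
    · exact absurd hij (pow_ne_zero _ M.g_ne_zero)
    · exact congrArg some (Fin.ext (M.semi.root.pow_inj i.2 j.2 hij))
  have hind := M.ind.comp w hw
  have h0 : ∏ o, (y ∘ w) o ^ (o.elim a fun i => r.coeff (i : ℕ) : ℤ) = algebraMap L Ω c := by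
    rw [Fintype.prod_option, ← h, hact]
    rfl
  have h1 := eq_zero_of_prod_zpow hind h0
  refine ⟨h1 none, ?_⟩
  have hr0 : r = 0 := by
    ext i
    by_cases hi : i < p - 1
    · exact h1 (some ⟨i, hi⟩)
    · refine (coeff_eq_zero_of_degree_lt ((degree_modByMonic_lt f hmon).trans_le ?_)).trans rfl
      rw [← map_one C, degree_X_pow_sub_C hn]
      exact_mod_cast not_lt.mp hi
  rwa [hr0, sub_zero] at hfr

end Model

theorem exists_isPrimitiveRoot_zmod (p : ℕ) [hp : Fact p.Prime] :
    ∃ g : ZMod p, IsPrimitiveRoot g (p - 1) := by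
  obtain ⟨u, hu⟩ := IsCyclic.exists_generator (α := (ZMod p)ˣ)
  refine ⟨u, ?_⟩
  have h1 : orderOf u = p - 1 := by
    rw [orderOf_eq_card_of_forall_mem_zpowers hu, Nat.card_eq_fintype_card, ZMod.card_units]
  rw [← h1, ← orderOf_units]
  exact IsPrimitiveRoot.orderOf _

theorem Model.exists_gen_of_rational {p : ℕ} [hp : Fact p.Prime] (hn : 2 ≤ p - 1) {g : ZMod p}
    (hg : IsPrimitiveRoot g (p - 1)) {L Ω : Type*} [Field L] [Field Ω] [Algebra L Ω] [CharZero Ω]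
    {τ σ : Ω →+* Ω} {ζ : Ω} {y : ZMod p → Ω} (M : Model p g L τ σ ζ y)
    (e : ↥(fixSub σ ⊓ fixSub τ) ≃+* FractionRing (MvPolynomial (Fin p) ℚ)) :
    ∃ α, Gen p g α := by
  obtain ⟨B, hB, hBu⟩ := M.exists_stableRing_of_rational e
  let u : Ωˣ := Units.mk0 (y 1) (M.y_ne_zero 1)
  have hu : (u : Ω) = y 1 := rfl
  obtain ⟨A, hA, hAu, hy, hy', hact⟩ := M.exists_stableRing_monomials hu
  obtain ⟨R, hR, hAR, hBR, ⟨ι, _, t, d, hPA⟩, κ, _, s, e', hPB⟩ :=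
    hA.exists_permPres hB (by omega) M.semi.iter
  have hact' : ∀ f : ℤ[X], aeval g f = 0 → ((act τ f u : Ωˣ) : Ω)⁻¹ ∈ A := by
    intro f hf
    have h1 := hact (-f) (by rw [map_neg, hf, neg_zero])
    rwa [act_neg, Units.val_inv_eq_inv_val] at h1
  let y0 : stableUnits R hR :=
    ⟨UnitsMod.of τ (Units.mk0 (y 0) (M.y_ne_zero 0)), hAR hy, hAR hy'⟩
  let Y : RingHom.ker (aeval (R := ℤ) g) →ₗ[ℤ[X]] stableUnits R hR :=
    ((LinearMap.toSpanSingleton ℤ[X] (UnitsMod τ) (UnitsMod.of τ u)).comp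
      (Submodule.subtype _)).codRestrict (stableUnits R hR)
      fun x => ⟨hAR (hact x x.2), hAR (hact' x x.2)⟩
  have hval : ∀ (a : ℤ) x, (((C a : ℤ[X]) • y0 + Y x : stableUnits R hR) : UnitsMod τ).val =
      y 0 ^ a * act τ (x : ℤ[X]) u := by
    intro a x
    change (((C a : ℤ[X]) • UnitsMod.of τ (Units.mk0 (y 0) (M.y_ne_zero 0))).val * _ : Ω) = _
    rw [UnitsMod.val_C_smul]
    rfl
  refine exists_gen_of_permPres hg hn (y := y0) (Y := Y) hPB hPA
    (stableUnits_X_pow_sub_one hR M.semi.iter) (Subtype.ext (UnitsMod.ext_val ?_)) ?_ ?_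
  · exact (UnitsMod.val_X_smul _).trans M.map_y_zero
  · intro v
    constructor
    · rintro ⟨hv, hv'⟩
      obtain ⟨c, a, f, hf, hc⟩ := hAu _ (UnitsMod.val_ne_zero _) hv hv'
      have h1 : ((v - ((C a : ℤ[X]) • y0 + Y ⟨f, hf⟩) : stableUnits R hR) : UnitsMod τ).val =
          algebraMap L Ω c := by
        rw [Submodule.coe_sub, UnitsMod.val_sub, hval]
        refine (div_eq_iff (mul_ne_zero (zpow_ne_zero _ (M.y_ne_zero 0)) (Units.ne_zero _))).mpr ?_
        rw [← mul_assoc]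
        exact hc
      refine ⟨v - ((C a : ℤ[X]) • y0 + Y ⟨f, hf⟩), ?_, a, ⟨f, hf⟩, by abel⟩
      refine ⟨?_, ?_⟩
      · change UnitsMod.val ((v - _ : stableUnits R hR) : UnitsMod τ) ∈ B
        rw [h1]
        exact hB.algebraMap_mem c
      · change (UnitsMod.val ((v - _ : stableUnits R hR) : UnitsMod τ))⁻¹ ∈ B
        rw [h1, ← map_inv₀]
        exact hB.algebraMap_mem _
    · rintro ⟨w, ⟨hw, hw'⟩, a, x, rfl⟩
      rw [add_assoc]
      obtain ⟨c, hc⟩ := hBu _ (UnitsMod.val_ne_zero _) hw hw'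
      refine add_mem ⟨?_, ?_⟩ (add_mem (Submodule.smul_mem _ _ ⟨hy, hy'⟩)
        ⟨hact x x.2, hact' x x.2⟩)
      · change UnitsMod.val (w : UnitsMod τ) ∈ A
        exact hc ▸ hA.algebraMap_mem c
      · change (UnitsMod.val (w : UnitsMod τ))⁻¹ ∈ A
        have h1 := hA.algebraMap_mem c⁻¹
        rw [map_inv₀, hc] at h1
        exact h1
  · rintro a x ⟨h1, h2⟩
    obtain ⟨c, hc⟩ := hBu _ (UnitsMod.val_ne_zero _) h1 h2
    exact M.monomial_eq_const hu ((hval a x).symm.trans hc.symm)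

theorem mem_of_rational {p : ℕ} (hp : p.Prime)
    (σ : FractionRing (MvPolynomial (Fin p) ℚ) ≃ₐ[ℚ] FractionRing (MvPolynomial (Fin p) ℚ))
    (hσ : ∀ i : Fin p,
      σ (algebraMap (MvPolynomial (Fin p) ℚ) (FractionRing (MvPolynomial (Fin p) ℚ))
          (MvPolynomial.X i)) =
        algebraMap (MvPolynomial (Fin p) ℚ) (FractionRing (MvPolynomial (Fin p) ℚ))
          (MvPolynomial.X (finRotate p i)))
    (e : IntermediateField.fixedField (Subgroup.zpowers σ) ≃+*
      FractionRing (MvPolynomial (Fin p) ℚ)) :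
    p ∈ ({2, 3, 5, 7, 11, 13, 17, 19, 23, 29, 31, 37, 41, 43, 61, 67, 71} : Finset ℕ) := by
  have : Fact p.Prime := ⟨hp⟩
  obtain rfl | h2 := hp.two_le.eq_or_lt
  · simp
  obtain ⟨g, hg⟩ := exists_isPrimitiveRoot_zmod p
  obtain ⟨L, Ω, _, _, _, _, τ, σ', ζ, y, M⟩ := exists_model p hg
  obtain ⟨φ⟩ := M.nonempty_fixedField_equiv σ hσ
  obtain ⟨α, hα⟩ := M.exists_gen_of_rational (by omega) hg (φ.symm.trans e)
  exact mem_of_gen' hα hg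

end NoetherCyclic

/-- Let `p` be prime and let `σ` be the `ℚ`-automorphism of the rational function field
`ℚ(x₁, …, x_p) = Frac(ℚ[x₁, …, x_p])` cyclically permuting the indeterminates, so that
the cyclic group `C_p = ⟨σ⟩` acts regularly on `{x₁, …, x_p}`.  Then the fixed field
`ℚ(x₁, …, x_p)^{C_p}` is rational (purely transcendental) over `ℚ` if and only if
`p ∈ {2, 3, 5, 7, 11, 13, 17, 19, 23, 29, 31, 37, 41, 43, 61, 67, 71}`. -/
theorem noether_problem_Cp_rational_iff_mem
    (p : ℕ) (hp : p.Prime)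
    (σ : FractionRing (MvPolynomial (Fin p) ℚ) ≃ₐ[ℚ] FractionRing (MvPolynomial (Fin p) ℚ))
    (hσ : ∀ i : Fin p,
      σ (algebraMap (MvPolynomial (Fin p) ℚ) (FractionRing (MvPolynomial (Fin p) ℚ))
          (MvPolynomial.X i)) =
        algebraMap (MvPolynomial (Fin p) ℚ) (FractionRing (MvPolynomial (Fin p) ℚ))
          (MvPolynomial.X (finRotate p i))) :
    Nonempty ((IntermediateField.fixedField (Subgroup.zpowers σ)) ≃ₐ[ℚ]
        FractionRing (MvPolynomial (Fin p) ℚ)) ↔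
      p ∈ ({2, 3, 5, 7, 11, 13, 17, 19, 23, 29, 31, 37, 41, 43, 61, 67, 71} : Finset ℕ) := by
  constructor
  · rintro ⟨e⟩
    exact NoetherCyclic.mem_of_rational hp σ hσ e.toRingEquiv
  · intro h
    obtain ⟨g, m, α, β, u, w, ks, hc⟩ := NoetherCyclic.exists_certificate h
    exact NoetherCyclic.nonempty_algEquiv_of_certificate' hp hc σ hσ
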